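/- Let f(x) ∈ ℝ[x] be a real polynomial of degree d ≥ 1 with positive leading coefficient. Then the Hausdorff dimension of the set {α ∈ ℝ : liminf_{n→∞} n · (log n) · ‖α f(n)‖ > 0} is at least d/(d+1); in particular this set has positive Hausdorff dimension. -/

import Mathlib

open Filter MeasureTheory

namespace SmallFrac

/-- The number of cells of level `k` in a unit interval. -/
def scale (d k : ℕ) : ℕ := 2 ^ ((d + 2) * 4 ^ k)

/-- The largest index treated up to level `k`. -/
def cutoff (k : ℕ) : ℕ := 2 ^ (4 ^ k)

/-- The number of children of a cell of level `k`. -/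
def ratio (d k : ℕ) : ℕ := 2 ^ (3 * (d + 2) * 4 ^ k)

/-- The threshold `1 / (n log n)`. -/
noncomputable def tol (n : ℕ) : ℝ := 1 / (n * Real.log n)

/-- The distance to the nearest integer. -/
noncomputable def dist1 (x : ℝ) : ℝ := |x - round x|

lemma scale_pos (d k : ℕ) : 0 < scale d k := by unfold scale; positivity

lemma scale_pos' (d k : ℕ) : (0 : ℝ) < scale d k := by exact_mod_cast scale_pos d k

lemma cutoff_pos (k : ℕ) : 0 < cutoff k := by unfold cutoff; positivity

lemma scale_succ (d k : ℕ) : scale d (k + 1) = scale d k * ratio d k := by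
  unfold scale ratio
  rw [← pow_add]
  congr 1
  ring

lemma scale_eq_cutoff (d k : ℕ) : scale d k = cutoff k ^ (d + 2) := by
  unfold scale cutoff
  rw [← pow_mul, mul_comm]

lemma cutoff_succ (k : ℕ) : cutoff (k + 1) = cutoff k ^ 4 := by
  unfold cutoff
  rw [← pow_mul, pow_succ]

lemma cutoff_mono : Monotone cutoff := fun a b h => by
  unfold cutoff
  exact Nat.pow_le_pow_right (by norm_num) (Nat.pow_le_pow_right (by norm_num) h)

lemma cutoff_strictMono : StrictMono cutoff := fun a b h => by
  unfold cutoff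
  exact Nat.pow_lt_pow_right (by norm_num) (Nat.pow_lt_pow_right (by norm_num) h)

lemma scale_mono (d : ℕ) : Monotone (scale d) := fun a b h => by
  rw [scale_eq_cutoff, scale_eq_cutoff]
  exact Nat.pow_le_pow_left (cutoff_mono h) _

lemma scale_dvd (d : ℕ) {k l : ℕ} (h : k ≤ l) : scale d k ∣ scale d l := by
  unfold scale
  exact pow_dvd_pow 2 (Nat.mul_le_mul_left _ (Nat.pow_le_pow_right (by norm_num) h))

lemma two_le_cutoff (k : ℕ) : 2 ≤ cutoff k := by
  have := cutoff_mono (Nat.zero_le k)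
  simpa [cutoff] using this

lemma lt_cutoff (k : ℕ) : k < cutoff k := by
  unfold cutoff
  calc k < 4 ^ k := Nat.lt_pow_self (by norm_num)
    _ < 2 ^ (4 ^ k) := Nat.lt_pow_self (by norm_num)

/-- The number of descendants of level `l` of a cell of level `k`. -/
def desc (d k l : ℕ) : ℕ := scale d l / scale d k

lemma scale_mul_desc (d : ℕ) {k l : ℕ} (h : k ≤ l) : scale d k * desc d k l = scale d l :=
  Nat.mul_div_cancel' (scale_dvd d h)

lemma desc_pos (d : ℕ) {k l : ℕ} (h : k ≤ l) : 0 < desc d k l :=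
  Nat.div_pos (scale_mono d h) (scale_pos d k)

lemma desc_self (d k : ℕ) : desc d k k = 1 := Nat.div_self (scale_pos d k)

lemma desc_succ (d k : ℕ) : desc d k (k + 1) = ratio d k := by
  unfold desc; rw [scale_succ, Nat.mul_div_cancel_left _ (scale_pos d k)]

lemma desc_mul (d : ℕ) {k l j : ℕ} (h : k ≤ l) (h' : l ≤ j) :
    desc d k l * desc d l j = desc d k j := by
  apply Nat.eq_of_mul_eq_mul_left (scale_pos d k)
  rw [← mul_assoc, scale_mul_desc d h, scale_mul_desc d h', scale_mul_desc d (h.trans h')]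

lemma desc_cast (d : ℕ) {k l : ℕ} (h : k ≤ l) :
    (desc d k l : ℝ) = (scale d l : ℝ) / scale d k := by
  rw [eq_div_iff (scale_pos' d k).ne', mul_comm]
  exact_mod_cast scale_mul_desc d h

lemma ratio_even (d k : ℕ) : 2 ∣ ratio d k := by
  unfold ratio
  exact dvd_pow_self 2 (by positivity)

lemma ratio_pos (d k : ℕ) : 0 < ratio d k := by unfold ratio; positivity

lemma dist1_le (x : ℝ) (a : ℤ) : dist1 x ≤ |x - a| := round_le x a

lemma dist1_le_add (x y : ℝ) : dist1 x ≤ dist1 y + |x - y| := by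
  refine (dist1_le x (round y)).trans ?_
  unfold dist1
  have : x - round y = (y - round y) + (x - y) := by ring
  rw [this]
  exact abs_add_le _ _

lemma tol_pos {n : ℕ} (hn : 2 ≤ n) : 0 < tol n := by
  unfold tol
  have : (1 : ℝ) < n := by exact_mod_cast hn
  have := Real.log_pos this
  positivity

lemma tol_le_loglog {n : ℕ} (hn : 3 ≤ n) :
    tol n ≤ Real.log (Real.log n) - Real.log (Real.log ((n - 1 : ℕ) : ℝ)) := by
  have h1 : (1 : ℝ) < ((n - 1 : ℕ) : ℝ) := by
    have : 2 ≤ n - 1 := by omega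
    exact_mod_cast this
  have hn1 : ((n - 1 : ℕ) : ℝ) = (n : ℝ) - 1 := by
    rw [Nat.cast_sub (by omega)]; simp
  have h2 : (1 : ℝ) < n := by linarith
  have l1 := Real.log_pos h1
  have l2 := Real.log_pos h2
  have n0 : (0 : ℝ) < n := by linarith
  rw [← Real.log_div l2.ne' l1.ne']
  have a1 := Real.one_sub_inv_le_log_of_pos (div_pos l2 l1)
  have a2 := Real.one_sub_inv_le_log_of_pos (div_pos n0 (by linarith : (0:ℝ) < ((n - 1 : ℕ) : ℝ)))
  rw [Real.log_div (by linarith) (by linarith)] at a2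
  rw [inv_div] at a1 a2
  have a3 : 1 - ((n - 1 : ℕ) : ℝ) / n = 1 / n := by
    rw [hn1]; field_simp; ring
  rw [a3] at a2
  refine le_trans ?_ a1
  have : 1 - Real.log ((n - 1 : ℕ) : ℝ) / Real.log n
      = (Real.log n - Real.log ((n - 1 : ℕ) : ℝ)) / Real.log n := by
    field_simp
  rw [this]
  unfold tol
  rw [← div_div]
  gcongr

lemma sum_tol_le {a b : ℕ} (ha : 2 ≤ a) (hab : a ≤ b) :
    ∑ n ∈ Finset.Ioc a b, tol n ≤ Real.log (Real.log b) - Real.log (Real.log a) := by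
  induction b, hab using Nat.le_induction with
  | base => simp
  | succ b hb ih =>
    rw [← Finset.insert_Ioc_right_eq_Ioc_add_one hb, Finset.sum_insert (by simp)]
    have := tol_le_loglog (n := b + 1) (by omega)
    simp only [Nat.add_sub_cancel] at this
    linarith

lemma sum_tol_block (k : ℕ) : ∑ n ∈ Finset.Ioc (cutoff k) (cutoff (k + 1)), tol n ≤ 2 := by
  refine (sum_tol_le (two_le_cutoff k) (cutoff_mono (Nat.le_succ k))).trans ?_
  have h1 : (1 : ℝ) < cutoff k := by exact_mod_cast two_le_cutoff k
  have l1 := Real.log_pos h1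
  rw [cutoff_succ, Nat.cast_pow, Real.log_pow, Real.log_mul (by norm_num) l1.ne']
  have : Real.log ((4 : ℕ) : ℝ) ≤ 2 := by
    have h4 : ((4 : ℕ) : ℝ) = 2 ^ 2 := by norm_num
    rw [h4, Real.log_pow]
    have := Real.log_two_lt_d9
    push_cast
    linarith
  linarith

/-- The half-open cell of level `l` with index `z`. -/
def cell (d l : ℕ) (z : ℤ) : Set ℝ := Set.Ico ((z : ℝ) / scale d l) ((z + 1) / scale d l)

/-- The closed cell of level `l` with index `z`. -/
def ccell (d l : ℕ) (z : ℤ) : Set ℝ := Set.Icc ((z : ℝ) / scale d l) ((z + 1) / scale d l)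

/-- The indices of the level `l` descendants of the level `k` cell `z`. -/
noncomputable def descendants (d k l : ℕ) (z : ℤ) : Finset ℤ :=
  Finset.Ico (z * desc d k l) ((z + 1) * desc d k l)

lemma mem_descendants {d k l : ℕ} (h : k ≤ l) {z w : ℤ} :
    w ∈ descendants d k l z ↔ w / (desc d k l : ℤ) = z := by
  have hp : (0 : ℤ) < desc d k l := by exact_mod_cast desc_pos d h
  rw [descendants, Finset.mem_Ico, Int.ediv_eq_iff_of_pos hp, add_mul, one_mul]

lemma card_descendants (d k l : ℕ) (z : ℤ) : (descendants d k l z).card = desc d k l := by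
  simp [descendants, add_mul]

lemma volume_cell (d l : ℕ) (z : ℤ) : volume (cell d l z) = ENNReal.ofReal (1 / scale d l) := by
  rw [cell, Real.volume_Ico]
  congr 1
  ring

lemma cell_subset_ccell (d l : ℕ) (z : ℤ) : cell d l z ⊆ ccell d l z := Set.Ico_subset_Icc_self

lemma mem_descendants_cast {d k l : ℕ} (h : k ≤ l) {z w : ℤ} (hw : w ∈ descendants d k l z) :
    (z : ℝ) / scale d k ≤ w / scale d l ∧ ((w : ℝ) + 1) / scale d l ≤ (z + 1) / scale d k := by
  rw [descendants, Finset.mem_Ico] at hw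
  have hk := scale_pos' d k
  have hl := scale_pos' d l
  have e : (scale d l : ℝ) = scale d k * desc d k l := by exact_mod_cast (scale_mul_desc d h).symm
  have h1 : (z : ℝ) * desc d k l ≤ w := by exact_mod_cast hw.1
  have h2 : (w : ℝ) + 1 ≤ (z + 1) * desc d k l := by exact_mod_cast hw.2
  constructor
  · rw [div_le_div_iff₀ hk hl, e]
    nlinarith
  · rw [div_le_div_iff₀ hl hk, e]
    nlinarith

lemma cell_subset {d k l : ℕ} (h : k ≤ l) {z w : ℤ} (hw : w ∈ descendants d k l z) :
    cell d l w ⊆ cell d k z := by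
  obtain ⟨h1, h2⟩ := mem_descendants_cast h hw
  exact Set.Ico_subset_Ico h1 h2

lemma ccell_subset {d k l : ℕ} (h : k ≤ l) {z w : ℤ} (hw : w ∈ descendants d k l z) :
    ccell d l w ⊆ ccell d k z := by
  obtain ⟨h1, h2⟩ := mem_descendants_cast h hw
  exact Set.Icc_subset_Icc h1 h2

lemma cell_disjoint (d l : ℕ) {z w : ℤ} (h : z ≠ w) : Disjoint (cell d l z) (cell d l w) := by
  have hl := scale_pos' d l
  rw [Set.disjoint_left]
  rintro x ⟨h1, h2⟩ ⟨h3, h4⟩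
  rw [div_le_iff₀ hl] at h1 h3
  rw [lt_div_iff₀ hl] at h2 h4
  have a : z < w + 1 := by exact_mod_cast h1.trans_lt h4
  have b : w < z + 1 := by exact_mod_cast h3.trans_lt h2
  omega

lemma mem_descendants_trans {d k l j : ℕ} (h : k ≤ l) (h' : l ≤ j) {z w x : ℤ}
    (hw : w ∈ descendants d k l z) (hx : x ∈ descendants d l j w) : x ∈ descendants d k j z := by
  rw [mem_descendants h] at hw
  rw [mem_descendants h'] at hx
  rw [mem_descendants (h.trans h'), ← desc_mul d h h', mul_comm]
  push_cast
  rw [← Int.ediv_ediv_of_nonneg (by positivity), hx, hw]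

lemma exists_mid {d k l j : ℕ} (h : k ≤ l) (h' : l ≤ j) {z x : ℤ}
    (hx : x ∈ descendants d k j z) :
    ∃ w ∈ descendants d k l z, x ∈ descendants d l j w := by
  refine ⟨x / (desc d l j : ℤ), ?_, (mem_descendants h').2 rfl⟩
  rw [mem_descendants (h.trans h'), ← desc_mul d h h', mul_comm] at hx
  push_cast at hx
  rw [← Int.ediv_ediv_of_nonneg (by positivity)] at hx
  rwa [mem_descendants h]

lemma card_heavy_le (μ : Measure ℝ) (d : ℕ) {l l' : ℕ} (h : l ≤ l') (z : ℤ) {ε θ : ℝ}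
    (hε : 0 ≤ ε) (hθ : 0 ≤ θ)
    (hμ : μ (cell d l z) ≤ ENNReal.ofReal ε * volume (cell d l z)) (s : Finset ℤ)
    (hs : s ⊆ descendants d l l' z)
    (hs' : ∀ w ∈ s, ENNReal.ofReal θ * volume (cell d l' w) ≤ μ (cell d l' w)) :
    (s.card : ℝ) * θ ≤ ε * desc d l l' := by
  have hl := scale_pos' d l
  have hl' := scale_pos' d l'
  have key : (s.card : ENNReal) * (ENNReal.ofReal θ * ENNReal.ofReal (1 / scale d l'))
      ≤ ENNReal.ofReal ε * ENNReal.ofReal (1 / scale d l) := by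
    calc (s.card : ENNReal) * (ENNReal.ofReal θ * ENNReal.ofReal (1 / scale d l'))
        = ∑ w ∈ s, ENNReal.ofReal θ * volume (cell d l' w) := by
          simp only [volume_cell]
          rw [Finset.sum_const, nsmul_eq_mul]
      _ ≤ ∑ w ∈ s, μ (cell d l' w) := Finset.sum_le_sum hs'
      _ = μ (⋃ w ∈ s, cell d l' w) := by
          rw [measure_biUnion_finset]
          · intro a _ b _ hab
            exact cell_disjoint d l' hab
          · intro a _
            exact measurableSet_Ico
      _ ≤ μ (cell d l z) := by
          apply measure_mono
          refine Set.iUnion₂_subset fun w hw => cell_subset h (hs hw)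
      _ ≤ _ := by rwa [volume_cell] at hμ
  rw [← ENNReal.ofReal_natCast, ← ENNReal.ofReal_mul hθ, ← ENNReal.ofReal_mul (by positivity),
    ← ENNReal.ofReal_mul hε, ENNReal.ofReal_le_ofReal_iff (by positivity)] at key
  rw [desc_cast d h]
  rw [mul_one_div, mul_one_div, mul_div_assoc', div_le_div_iff₀ hl' hl] at key
  rw [mul_div_assoc', le_div_iff₀ hl]
  exact key

/-- The set of `α` for which `α F_j` is within `c / (j log j)` of an integer. -/
def near (F : ℕ → ℝ) (c : ℝ) (j : ℕ) : Set ℝ := {α | dist1 (α * F j) ≤ c * tol j}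

lemma volume_near_le (F : ℕ → ℝ) (c : ℝ) (j : ℕ) (x v : ℝ) (hF : 0 < F j) (hv : 1 ≤ v * F j)
    (hc : 0 ≤ c * tol j) :
    volume (Set.Ico x (x + v) ∩ near F c j) ≤ ENNReal.ofReal (8 * (c * tol j) * v) := by
  set e := c * tol j with he
  set s : Finset ℤ := Finset.Icc ⌊x * F j⌋ ⌈(x + v) * F j⌉ with hs
  have hsub : Set.Ico x (x + v) ∩ near F c j ⊆
      ⋃ a ∈ s, Set.Icc (((a : ℝ) - e) / F j) ((a + e) / F j) := by
    rintro α ⟨⟨h1, h2⟩, h3⟩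
    have h3' : |α * F j - round (α * F j)| ≤ e := h3
    have h4 := abs_sub_round (α * F j)
    rw [abs_le] at h3' h4
    have g1 : x * F j ≤ α * F j := by gcongr
    have g2 : α * F j ≤ (x + v) * F j := by gcongr
    simp only [Set.mem_iUnion]
    refine ⟨round (α * F j), ?_, ?_⟩
    · rw [hs, Finset.mem_Icc]
      have f1 := Int.floor_le (x * F j)
      have f2 := Int.le_ceil ((x + v) * F j)
      constructor
      · have : (⌊x * F j⌋ : ℝ) < round (α * F j) + 1 := by linarith
        have : ⌊x * F j⌋ < round (α * F j) + 1 := by exact_mod_cast this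
        omega
      · have : (round (α * F j) : ℝ) < ⌈(x + v) * F j⌉ + 1 := by linarith
        have : round (α * F j) < ⌈(x + v) * F j⌉ + 1 := by exact_mod_cast this
        omega
    · rw [Set.mem_Icc, div_le_iff₀ hF, le_div_iff₀ hF]
      constructor <;> linarith
  refine (measure_mono hsub).trans ((measure_biUnion_finset_le _ _).trans ?_)
  simp only [Real.volume_Icc]
  have e1 : ∀ a : ℤ, ((a : ℝ) + e) / F j - (a - e) / F j = 2 * e / F j := by
    intro a; ring
  simp only [e1]
  rw [Finset.sum_const, nsmul_eq_mul, ← ENNReal.ofReal_natCast,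
    ← ENNReal.ofReal_mul (by positivity)]
  apply ENNReal.ofReal_le_ofReal
  have hcard : (s.card : ℝ) ≤ 4 * (v * F j) := by
    have h5 : ((⌈(x + v) * F j⌉ + 1 - ⌊x * F j⌋ : ℤ) : ℝ) ≤ 4 * (v * F j) := by
      push_cast
      have := Int.ceil_lt_add_one ((x + v) * F j)
      have := Int.lt_floor_add_one (x * F j)
      nlinarith
    have h6 : (0 : ℝ) ≤ 4 * (v * F j) := by linarith
    rw [hs, Int.card_Icc]
    rcases le_total 0 (⌈(x + v) * F j⌉ + 1 - ⌊x * F j⌋) with h7 | h7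
    · have : (((⌈(x + v) * F j⌉ + 1 - ⌊x * F j⌋).toNat : ℤ) : ℝ) ≤ 4 * (v * F j) := by
        rw [Int.toNat_of_nonneg h7]; exact h5
      exact_mod_cast this
    · rw [Int.toNat_of_nonpos h7]; simpa using h6
  calc (s.card : ℝ) * (2 * e / F j) ≤ 4 * (v * F j) * (2 * e / F j) := by gcongr
    _ = 8 * e * v := by field_simp; ring

/-- A tree of cells from level `k` to level `L` rooted at `z` in which every cell has exactly
half of its possible children. -/
structure HalfTree (d k L : ℕ) (z : ℤ) (T : ℕ → Finset ℤ) : Prop where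
  root : T k = {z}
  parent : ∀ l, k ≤ l → l < L → ∀ x ∈ T (l + 1), ∃ y ∈ T l, x ∈ descendants d l (l + 1) y
  half : ∀ l, k ≤ l → l < L → ∀ y ∈ T l,
    2 * (T (l + 1) ∩ descendants d l (l + 1) y).card = ratio d l

open Classical in
/-- The cells three levels below `s` whose left endpoint is well approximated by some
`a / F n`. -/
noncomputable def hitCells (F : ℕ → ℝ) (d L : ℕ) (s : Finset ℤ) : Finset ℤ :=
  (s.biUnion (descendants d L (L + 3))).filter fun w =>
    ∃ n ∈ Finset.Ioc (cutoff L) (cutoff (L + 3)),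
      dist1 ((w : ℝ) / scale d (L + 3) * F n) ≤ tol n

lemma mem_hitCells {F : ℕ → ℝ} {d L : ℕ} {s : Finset ℤ} {w : ℤ} : w ∈ hitCells F d L s ↔
    (∃ y ∈ s, w ∈ descendants d L (L + 3) y) ∧ ∃ n ∈ Finset.Ioc (cutoff L) (cutoff (L + 3)),
      dist1 ((w : ℝ) / scale d (L + 3) * F n) ≤ tol n := by
  simp [hitCells]

/-- A positive proportion of the cells below the leaves of any long half-tree are hit. -/
def HitProp (F : ℕ → ℝ) (d : ℕ) : Prop :=
  ∃ κ : ℝ, 0 < κ ∧ ∀ k, ∃ L₀, ∀ L, L₀ ≤ L → ∀ z T, HalfTree d k L z T →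
    κ * (T L).card * desc d L (L + 3) ≤ (hitCells F d L (T L)).card

/-- A cell is light if it is not charged too much by the measure of its level. -/
def Light (d : ℕ) (μ : ℕ → Measure ℝ) (θ : ℝ) (l : ℕ) (z : ℤ) : Prop :=
  μ l (cell d l z) ≤ ENNReal.ofReal θ * volume (cell d l z)

/-- A good cell is light, and clean unless it has the initial level. -/
def Good (d : ℕ) (μ : ℕ → Measure ℝ) (θ : ℝ) (k₀ : ℕ) (clean : ℕ → ℤ → Prop) (l : ℕ) (z : ℤ) :
    Prop :=
  Light d μ θ l z ∧ (k₀ < l → clean l z)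

section tree
variable {d : ℕ} {μ : ℕ → Measure ℝ} {θ ε : ℝ} {k₀ : ℕ} {clean : ℕ → ℤ → Prop}

lemma exists_subtree (G : ℕ → ℤ → Prop) {k : ℕ} {z : ℤ} (hz : G k z)
    (hG : ∀ l y, k ≤ l → G l y → ∃ s ⊆ descendants d l (l + 1) y, (∀ x ∈ s, G (l + 1) x) ∧
      2 * s.card = ratio d l) :
    ∃ T : ℕ → Finset ℤ, (∀ L, HalfTree d k L z T) ∧ ∀ l, k ≤ l → ∀ y ∈ T l, G l y := by
  classical
  have hG' : ∀ l y, ∃ s : Finset ℤ, k ≤ l → G l y → s ⊆ descendants d l (l + 1) y ∧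
      (∀ x ∈ s, G (l + 1) x) ∧ 2 * s.card = ratio d l := by
    intro l y
    by_cases h : k ≤ l ∧ G l y
    · obtain ⟨s, h1, h2, h3⟩ := hG l y h.1 h.2
      exact ⟨s, fun _ _ => ⟨h1, h2, h3⟩⟩
    · exact ⟨∅, fun a b => absurd ⟨a, b⟩ h⟩
  choose S hS using hG'
  let A : ℕ → Finset ℤ := fun i => Nat.rec {z} (fun i a => a.biUnion (S (k + i))) i
  have A0 : A 0 = {z} := rfl
  have AS : ∀ i, A (i + 1) = (A i).biUnion (S (k + i)) := fun i => rfl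
  have AG : ∀ i, ∀ y ∈ A i, G (k + i) y := by
    intro i
    induction i with
    | zero => intro y hy; rw [A0, Finset.mem_singleton] at hy; rw [hy]; exact hz
    | succ i ih =>
      intro y hy
      rw [AS, Finset.mem_biUnion] at hy
      obtain ⟨x, hx, hxy⟩ := hy
      exact (hS (k + i) x (by omega) (ih x hx)).2.1 y hxy
  refine ⟨fun l => A (l - k), fun L => ⟨by simp [A0], ?_, ?_⟩, ?_⟩
  · intro l hkl _ x hx
    obtain ⟨i, rfl⟩ := Nat.exists_eq_add_of_le hkl
    have e : k + i + 1 - k = i + 1 := by omega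
    simp only [e, AS, Finset.mem_biUnion] at hx
    obtain ⟨y, hy, hxy⟩ := hx
    refine ⟨y, by simpa using hy, (hS (k + i) y (by omega) (AG i y hy)).1 hxy⟩
  · intro l hkl _ y hy
    obtain ⟨i, rfl⟩ := Nat.exists_eq_add_of_le hkl
    have e : k + i + 1 - k = i + 1 := by omega
    have e' : k + i - k = i := by omega
    simp only [e'] at hy
    simp only [e, AS]
    have h1 := hS (k + i) y (by omega) (AG i y hy)
    rw [← h1.2.2]
    congr 2
    ext x
    rw [Finset.mem_inter, Finset.mem_biUnion]
    constructor
    · rintro ⟨⟨y', hy', hx⟩, hx'⟩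
      have h2 := (hS (k + i) y' (by omega) (AG i y' hy')).1 hx
      rw [mem_descendants (by omega)] at h2 hx'
      rw [h2] at hx'
      rwa [← hx']
    · intro hx
      exact ⟨⟨y, hy, hx⟩, h1.1 hx⟩
  · intro l hkl y hy
    obtain ⟨i, rfl⟩ := Nat.exists_eq_add_of_le hkl
    exact AG i y (by simpa using hy)

open Classical in
lemma card_bad_le (hθ : 0 < θ) (hε : 0 ≤ ε) (hεθ : ε ≤ θ)
    (H1 : ∀ l, k₀ ≤ l → ∀ z, Light d μ θ l z → ∀ i, 1 ≤ i →
      μ (l + i) (cell d l z) ≤ ENNReal.ofReal ε * volume (cell d l z))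
    (H2 : ∀ l, k₀ ≤ l → ∀ w, ¬ clean (l + 1) w →
      volume (cell d (l + 1) w) ≤ μ l (cell d (l + 1) w))
    {l : ℕ} (hl : k₀ ≤ l) {z : ℤ} (hz : Good d μ θ k₀ clean l z) {i : ℕ} (hi : 1 ≤ i) :
    (((descendants d l (l + i) z).filter fun w => ¬ Good d μ θ k₀ clean (l + i) w).card : ℝ)
      ≤ (ε / θ + θ) * desc d l (l + i) := by
  set s1 := (descendants d l (l + i) z).filter fun w => ¬ Light d μ θ (l + i) w
  set s2 := (descendants d l (l + i) z).filter fun w => ¬ clean (l + i) w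
  have hsub : ((descendants d l (l + i) z).filter fun w => ¬ Good d μ θ k₀ clean (l + i) w)
      ⊆ s1 ∪ s2 := by
    intro w hw
    rw [Finset.mem_filter] at hw
    rw [Finset.mem_union, Finset.mem_filter, Finset.mem_filter]
    by_cases h : Light d μ θ (l + i) w
    · right
      refine ⟨hw.1, fun hc => hw.2 ⟨h, fun _ => hc⟩⟩
    · left; exact ⟨hw.1, h⟩
  have c1 : (s1.card : ℝ) * θ ≤ ε * desc d l (l + i) := by
    refine card_heavy_le (μ (l + i)) d (by omega) z hε hθ.le (H1 l hl z hz.1 i hi) s1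
      (Finset.filter_subset _ _) ?_
    intro w hw
    exact (not_le.1 (Finset.mem_filter.1 hw).2).le
  have c2 : (s2.card : ℝ) * 1 ≤ θ * desc d l (l + i) := by
    have hμ : μ (l + (i - 1)) (cell d l z) ≤ ENNReal.ofReal θ * volume (cell d l z) := by
      rcases Nat.eq_or_lt_of_le hi with h | h
      · subst h; exact hz.1
      · refine (H1 l hl z hz.1 (i - 1) (by omega)).trans ?_
        gcongr
    refine card_heavy_le (μ (l + (i - 1))) d (by omega) z hθ.le zero_le_one hμ s2
      (Finset.filter_subset _ _) ?_
    intro w hw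
    have h2 := (Finset.mem_filter.1 hw).2
    have e : l + i = l + (i - 1) + 1 := by omega
    rw [e] at h2 ⊢
    simpa using H2 (l + (i - 1)) (by omega) w h2
  have c3 := (Finset.card_le_card hsub).trans (Finset.card_union_le _ _)
  have c3' :
        (((descendants d l (l + i) z).filter fun w => ¬ Good d μ θ k₀ clean (l + i) w).card : ℝ)
    ≤ s1.card + s2.card := by exact_mod_cast c3
  rw [add_mul, div_mul_eq_mul_div]
  have : (s1.card : ℝ) ≤ ε * desc d l (l + i) / θ := by rwa [le_div_iff₀ hθ]
  linarith

lemma exists_good_half (hθ : 0 < θ) (hε : 0 ≤ ε) (hεθ : ε ≤ θ) (hhalf : ε / θ + θ ≤ 1 / 2)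
    (H1 : ∀ l, k₀ ≤ l → ∀ z, Light d μ θ l z → ∀ i, 1 ≤ i →
      μ (l + i) (cell d l z) ≤ ENNReal.ofReal ε * volume (cell d l z))
    (H2 : ∀ l, k₀ ≤ l → ∀ w, ¬ clean (l + 1) w →
      volume (cell d (l + 1) w) ≤ μ l (cell d (l + 1) w))
    {l : ℕ} (hl : k₀ ≤ l) {z : ℤ} (hz : Good d μ θ k₀ clean l z) :
    ∃ s ⊆ descendants d l (l + 1) z, (∀ x ∈ s, Good d μ θ k₀ clean (l + 1) x) ∧
      2 * s.card = ratio d l := by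
  classical
  have h1 := card_bad_le hθ hε hεθ H1 H2 hl hz (le_refl 1)
  have h2 := Finset.card_filter_add_card_filter_not (s := descendants d l (l + 1) z)
    (fun w => Good d μ θ k₀ clean (l + 1) w)
  rw [card_descendants] at h2
  have hR := desc_succ d l
  rw [hR] at h1 h2
  have h3 : (ratio d l : ℝ) / 2 ≤
      ((descendants d l (l + 1) z).filter fun w => Good d μ θ k₀ clean (l + 1) w).card := by
    have h4 : ((ε / θ + θ) * ratio d l : ℝ) ≤ 1 / 2 * ratio d l := by gcongr
    have h5 : (((descendants d l (l + 1) z).filter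
        fun w => Good d μ θ k₀ clean (l + 1) w).card : ℝ) + ((descendants d l (l + 1) z).filter
        fun w => ¬ Good d μ θ k₀ clean (l + 1) w).card = ratio d l := by exact_mod_cast h2
    linarith
  obtain ⟨r, hr⟩ := ratio_even d l
  have h6 : r ≤ ((descendants d l (l + 1) z).filter
      fun w => Good d μ θ k₀ clean (l + 1) w).card := by
    have : (r : ℝ) ≤ ((descendants d l (l + 1) z).filter
      fun w => Good d μ θ k₀ clean (l + 1) w).card := by
      rw [hr] at h3; push_cast at h3; linarith
    exact_mod_cast this
  obtain ⟨s, hs, hsc⟩ := Finset.exists_subset_card_eq h6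
  refine ⟨s, hs.trans (Finset.filter_subset _ _), fun x hx => (Finset.mem_filter.1 (hs hx)).2, ?_⟩
  rw [hsc, hr]

lemma HalfTree.ancestor {k L : ℕ} {z : ℤ} {T : ℕ → Finset ℤ} (h : HalfTree d k L z T) {l l' : ℕ}
    (hkl : k ≤ l) (hll : l ≤ l') (hL : l' ≤ L) :
    ∀ x ∈ T l', ∃ y ∈ T l, x ∈ descendants d l l' y := by
  induction l', hll using Nat.le_induction with
  | base => intro x hx; exact ⟨x, hx, by rw [mem_descendants le_rfl, desc_self]; simp⟩
  | succ l' hll ih =>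
    intro x hx
    obtain ⟨y, hy, hxy⟩ := h.parent l' (by omega) (by omega) x hx
    obtain ⟨v, hv, hvy⟩ := ih (by omega) y hy
    exact ⟨v, hv, mem_descendants_trans hll (by omega) hvy hxy⟩

lemma exists_hit_step (F : ℕ → ℝ) (hθ : 0 < θ) (hε : 0 ≤ ε) (hεθ : ε ≤ θ)
    (hhalf : ε / θ + θ ≤ 1 / 2) {κ : ℝ} (hκ : 3 * (ε / θ + θ) < κ)
    (hF : ∀ k, ∃ L₀, ∀ L, L₀ ≤ L → ∀ z T, HalfTree d k L z T →
      κ * (T L).card * desc d L (L + 3) ≤ (hitCells F d L (T L)).card)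
    (H1 : ∀ l, k₀ ≤ l → ∀ z, Light d μ θ l z → ∀ i, 1 ≤ i →
      μ (l + i) (cell d l z) ≤ ENNReal.ofReal ε * volume (cell d l z))
    (H2 : ∀ l, k₀ ≤ l → ∀ w, ¬ clean (l + 1) w →
      volume (cell d (l + 1) w) ≤ μ l (cell d (l + 1) w))
    {k : ℕ} (hk : k₀ ≤ k) {z : ℤ} (hz : Good d μ θ k₀ clean k z) :
    ∃ k' w, k < k' ∧ w ∈ descendants d k k' z ∧ Good d μ θ k₀ clean k' w ∧
      (∀ l, k ≤ l → l ≤ k' → ∃ y, Good d μ θ k₀ clean l y ∧ w ∈ descendants d l k' y) ∧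
      ∃ n, cutoff k < n ∧ n ≤ cutoff k' ∧ dist1 ((w : ℝ) / scale d k' * F n) ≤ tol n := by
  classical
  obtain ⟨L₀, hL₀⟩ := hF k
  obtain ⟨T, hT, hTG⟩ := exists_subtree (d := d) (Good d μ θ k₀ clean) hz
    (fun l y hl hy => exists_good_half hθ hε hεθ hhalf H1 H2 (hk.trans hl) hy)
  set L := max L₀ k with hLdef
  have hkL : k ≤ L := le_max_right _ _
  have hcount := hL₀ L (le_max_left _ _) z T (hT L)
  have hTpos : ∀ i, 0 < (T (k + i)).card := by
    intro i
    induction i with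
    | zero => simp [(hT L).root]
    | succ i ih =>
      obtain ⟨y, hy⟩ := Finset.card_pos.1 ih
      have := (hT (k + i + 1)).half (k + i) (by omega) (by omega) y hy
      have h2 := ratio_pos d (k + i)
      have h3 : 0 < (T (k + i + 1) ∩ descendants d (k + i) (k + i + 1) y).card := by omega
      exact h3.trans_le (Finset.card_le_card Finset.inter_subset_left)
  have hTL : 0 < (T L).card := by
    obtain ⟨i, hi⟩ := Nat.exists_eq_add_of_le hkL
    rw [hi]; exact hTpos i
  -- bad cells
  set bad : ℕ → ℤ → Finset ℤ := fun i y =>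
    ((descendants d L (L + i) y).filter fun w => ¬ Good d μ θ k₀ clean (L + i) w).biUnion
      (descendants d (L + i) (L + 3)) with hbad
  have hbadc : ∀ i, 1 ≤ i → i ≤ 3 → ∀ y ∈ T L,
      ((bad i y).card : ℝ) ≤ (ε / θ + θ) * desc d L (L + 3) := by
    intro i hi hi3 y hy
    have h1 := card_bad_le hθ hε hεθ H1 H2 (hk.trans hkL) (hTG L hkL y hy) hi
    have h2 : (bad i y).card ≤ ((descendants d L (L + i) y).filter
        fun w => ¬ Good d μ θ k₀ clean (L + i) w).card * desc d (L + i) (L + 3) := by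
      refine Finset.card_biUnion_le_card_mul _ _ _ fun w _ => ?_
      rw [card_descendants]
    have h2' : ((bad i y).card : ℝ) ≤ ((descendants d L (L + i) y).filter
        fun w => ¬ Good d μ θ k₀ clean (L + i) w).card * desc d (L + i) (L + 3) := by
      exact_mod_cast h2
    refine h2'.trans ?_
    rw [← desc_mul d (by omega : L ≤ L + i) (by omega : L + i ≤ L + 3)]
    push_cast
    rw [← mul_assoc]
    gcongr
  set Bad := (T L).biUnion fun y => bad 1 y ∪ bad 2 y ∪ bad 3 y with hBad
  have hBadc : (Bad.card : ℝ) ≤ 3 * (ε / θ + θ) * (T L).card * desc d L (L + 3) := by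
    have h1 : (Bad.card : ℝ) ≤ ∑ y ∈ T L, ((bad 1 y ∪ bad 2 y ∪ bad 3 y).card : ℝ) := by
      exact_mod_cast Finset.card_biUnion_le
    refine h1.trans ?_
    have h2 : ∀ y ∈ T L, ((bad 1 y ∪ bad 2 y ∪ bad 3 y).card : ℝ)
        ≤ 3 * (ε / θ + θ) * desc d L (L + 3) := by
      intro y hy
      have a1 := hbadc 1 (by norm_num) (by norm_num) y hy
      have a2 := hbadc 2 (by norm_num) (by norm_num) y hy
      have a3 := hbadc 3 (by norm_num) (by norm_num) y hy
      have a4 : ((bad 1 y ∪ bad 2 y ∪ bad 3 y).card : ℝ)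
          ≤ (bad 1 y).card + (bad 2 y).card + (bad 3 y).card := by
        have := Finset.card_union_le (bad 1 y ∪ bad 2 y) (bad 3 y)
        have := Finset.card_union_le (bad 1 y) (bad 2 y)
        norm_cast
        omega
      linarith
    refine (Finset.sum_le_sum h2).trans (le_of_eq ?_)
    rw [Finset.sum_const, nsmul_eq_mul]
    ring
  have hlt : Bad.card < (hitCells F d L (T L)).card := by
    have h1 : (0 : ℝ) < (T L).card * desc d L (L + 3) := by
      have := desc_pos d (by omega : L ≤ L + 3)
      positivity
    have h2 : (Bad.card : ℝ) < (hitCells F d L (T L)).card := by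
      refine hBadc.trans_lt (lt_of_lt_of_le ?_ hcount)
      rw [mul_assoc, mul_assoc κ]
      exact mul_lt_mul_of_pos_right hκ h1
    exact_mod_cast h2
  obtain ⟨w, hw, hwb⟩ := Finset.exists_mem_notMem_of_card_lt_card hlt
  obtain ⟨⟨y, hy, hwy⟩, n, hn, hnd⟩ := mem_hitCells.1 hw
  rw [Finset.mem_Ioc] at hn
  have hanc : ∀ i, i ≤ 3 → ∃ v,
      Good d μ θ k₀ clean (L + i) v ∧ w ∈ descendants d (L + i) (L + 3) v := by
    intro i hi
    rcases Nat.eq_zero_or_pos i with h0 | h0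
    · subst h0; exact ⟨y, hTG L hkL y hy, hwy⟩
    · obtain ⟨v, hv, hwv⟩ := exists_mid (by omega : L ≤ L + i) (by omega : L + i ≤ L + 3) hwy
      refine ⟨v, ?_, hwv⟩
      by_contra hcon
      apply hwb
      rw [hBad, Finset.mem_biUnion]
      refine ⟨y, hy, ?_⟩
      have hm : w ∈ bad i y := by
        rw [hbad]
        exact Finset.mem_biUnion.2 ⟨v, Finset.mem_filter.2 ⟨hv, hcon⟩, hwv⟩
      have : i = 1 ∨ i = 2 ∨ i = 3 := by omega
      rcases this with rfl | rfl | rfl <;> simp [hm]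
  have hself : ∀ v, w ∈ descendants d (L + 3) (L + 3) v → v = w := by
    intro v hv
    rw [mem_descendants le_rfl, desc_self] at hv
    simpa using hv.symm
  have hroot : w ∈ descendants d k (L + 3) z := by
    obtain ⟨v, hv, hyv⟩ := (hT L).ancestor le_rfl hkL le_rfl y hy
    rw [(hT L).root, Finset.mem_singleton] at hv
    subst hv
    exact mem_descendants_trans hkL (by omega) hyv hwy
  refine ⟨L + 3, w, by omega, hroot, ?_, ?_, n, ?_, hn.2, hnd⟩
  · obtain ⟨v, hv, hvw⟩ := hanc 3 le_rfl
    rwa [← hself v hvw]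
  · intro l hkl hl
    rcases Nat.lt_or_ge l L with h | h
    · obtain ⟨v, hv, hyv⟩ := (hT L).ancestor hkl h.le le_rfl y hy
      exact ⟨v, hTG l hkl v hv, mem_descendants_trans h.le (by omega) hyv hwy⟩
    · obtain ⟨i, rfl⟩ := Nat.exists_eq_add_of_le h
      exact hanc i (by omega)
  · exact lt_of_le_of_lt (cutoff_mono hkL) hn.1

end tree

lemma exists_cover {B : Set ℝ} {s : ℝ} (hs : 0 < s) (hB : Measure.hausdorffMeasure s B = 0)
    {ε : ENNReal} (hε : ε ≠ 0) :
    ∃ x δ : ℕ → ℝ, (∀ i, 0 < δ i) ∧ ∑' i, ENNReal.ofReal (δ i ^ s) < ε ∧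
      B ⊆ ⋃ i, Set.Icc (x i - δ i) (x i + δ i) := by
  have hε2 : ε / 2 ≠ 0 := (ENNReal.half_pos hε).ne'
  rw [Measure.hausdorffMeasure_apply] at hB
  have h1 := (iSup_eq_bot.1 hB) 1
  have h2 := iSup_eq_bot.1 h1 zero_lt_one
  have h3 : (⨅ (t : ℕ → Set ℝ) (_ : B ⊆ ⋃ n, t n) (_ : ∀ n, Metric.ediam (t n) ≤ 1),
      ∑' n, ⨆ _ : (t n).Nonempty, Metric.ediam (t n) ^ s) < ε / 2 := by
    rw [h2]; exact pos_iff_ne_zero.2 hε2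
  simp only [iInf_lt_iff] at h3
  obtain ⟨t, hBt, ht1, hsum⟩ := h3
  obtain ⟨e, he, hes⟩ := ENNReal.exists_pos_sum_of_countable hε2 ℕ
  have hne : ∀ i, ∃ x : ℝ, (t i).Nonempty → x ∈ t i := by
    intro i
    by_cases h : (t i).Nonempty
    · obtain ⟨x, hx⟩ := h; exact ⟨x, fun _ => hx⟩
    · exact ⟨0, fun h' => absurd h' h⟩
  choose x hx using hne
  have hfin : ∀ i, Metric.ediam (t i) ≠ ⊤ := fun i => ((ht1 i).trans_lt ENNReal.one_lt_top).ne
  refine ⟨x, fun i => ((Metric.ediam (t i)).toReal ^ s + e i) ^ (1 / s), ?_, ?_, ?_⟩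
  · intro i
    have := he i
    positivity
  · have hi : ∀ i, ENNReal.ofReal ((((Metric.ediam (t i)).toReal ^ s + e i) ^ (1 / s)) ^ s)
        = (⨆ _ : (t i).Nonempty, Metric.ediam (t i) ^ s) + e i := by
      intro i
      have h0 : 0 ≤ (Metric.ediam (t i)).toReal ^ s + e i := by positivity
      rw [← Real.rpow_mul h0, one_div_mul_cancel hs.ne', Real.rpow_one,
        ENNReal.ofReal_add (by positivity) (by positivity), ENNReal.ofReal_coe_nnreal,
        ← ENNReal.ofReal_rpow_of_nonneg ENNReal.toReal_nonneg hs.le, ENNReal.ofReal_toReal (hfin i)]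
      congr 1
      by_cases h : (t i).Nonempty
      · simp [h]
      · rw [Set.not_nonempty_iff_eq_empty] at h
        simp [h, hs]
    simp only [hi]
    rw [ENNReal.tsum_add]
    calc _ < ε / 2 + ε / 2 := ENNReal.add_lt_add hsum hes
      _ = ε := ENNReal.add_halves ε
  · intro b hb
    obtain ⟨i, hi⟩ := Set.mem_iUnion.1 (hBt hb)
    refine Set.mem_iUnion.2 ⟨i, ?_⟩
    have h4 := Metric.edist_le_ediam_of_mem hi (hx i ⟨b, hi⟩)
    have h5 : |b - x i| ≤ (Metric.ediam (t i)).toReal := by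
      rw [← Real.dist_eq, dist_edist]
      exact ENNReal.toReal_mono (hfin i) h4
    have h6 : (Metric.ediam (t i)).toReal ≤ ((Metric.ediam (t i)).toReal ^ s + e i) ^ (1 / s) := by
      calc (Metric.ediam (t i)).toReal = ((Metric.ediam (t i)).toReal ^ s) ^ (1 / s) := by
            rw [← Real.rpow_mul ENNReal.toReal_nonneg, mul_one_div_cancel hs.ne', Real.rpow_one]
        _ ≤ _ := by
            gcongr
            simp
    have := abs_le.1 (h5.trans h6)
    constructor <;> linarith

section path
variable {d k₀ : ℕ}

lemma exists_path (good : ℕ → ℤ → Prop) (hit : ℕ → ℕ → ℤ → Prop) {z₀ : ℤ} (hz₀ : good k₀ z₀)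
    (hstep : ∀ k, k₀ ≤ k → ∀ z, good k z → ∃ k' w, k < k' ∧ w ∈ descendants d k k' z ∧
      good k' w ∧ (∀ l, k ≤ l → l ≤ k' → ∃ y, good l y ∧ w ∈ descendants d l k' y) ∧ hit k k' w) :
    ∃ α : ℝ, (∀ l, k₀ ≤ l → ∃ y, good l y ∧ α ∈ ccell d l y) ∧
      ∀ N, ∃ k k' w, N ≤ k ∧ k < k' ∧ k₀ ≤ k ∧ hit k k' w ∧ α ∈ ccell d k' w := by
  let S := {p : ℕ × ℤ // k₀ ≤ p.1 ∧ good p.1 p.2}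
  have hstep' : ∀ p : S, ∃ q : S, p.1.1 < q.1.1 ∧ q.1.2 ∈ descendants d p.1.1 q.1.1 p.1.2 ∧
      (∀ l, p.1.1 ≤ l → l ≤ q.1.1 → ∃ y, good l y ∧ q.1.2 ∈ descendants d l q.1.1 y) ∧
      hit p.1.1 q.1.1 q.1.2 := by
    rintro ⟨⟨k, z⟩, hk, hz⟩
    obtain ⟨k', w, h1, h2, h3, h4, h5⟩ := hstep k hk z hz
    exact ⟨⟨(k', w), by simp only at *; omega, h3⟩, h1, h2, h4, h5⟩
  choose next hnext using hstep'
  let p : ℕ → S := fun i => Nat.rec ⟨(k₀, z₀), le_rfl, hz₀⟩ (fun _ q => next q) i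
  have p0 : (p 0).1.1 = k₀ := rfl
  have hp : ∀ i, p (i + 1) = next (p i) := fun i => rfl
  have hlt : ∀ i, (p i).1.1 < (p (i + 1)).1.1 := fun i => by rw [hp]; exact (hnext (p i)).1
  have hsm : StrictMono fun i => (p i).1.1 := strictMono_nat_of_lt_succ hlt
  obtain ⟨α, hα⟩ := IsCompact.nonempty_iInter_of_sequence_nonempty_isCompact_isClosed
    (fun i => ccell d (p i).1.1 (p i).1.2)
    (fun i => by
      have h := (hnext (p i)).2.1
      rw [← hp] at h
      exact ccell_subset (hlt i).le h)
    (fun i => by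
      have := scale_pos' d (p i).1.1
      refine Set.nonempty_Icc.2 ?_
      gcongr
      linarith)
    isCompact_Icc (fun i => isClosed_Icc)
  rw [Set.mem_iInter] at hα
  refine ⟨α, ?_, ?_⟩
  · intro l hl
    have hex : ∃ i, l ≤ (p (i + 1)).1.1 := ⟨l, (Nat.le_succ l).trans (hsm.le_apply (x := l + 1))⟩
    classical
    have h1 := Nat.find_spec hex
    set i := Nat.find hex with hi
    have h2 : (p i).1.1 ≤ l := by
      rcases Nat.eq_zero_or_pos i with h0 | h0
      · rw [h0, p0]; exact hl
      · have := Nat.find_min hex (m := i - 1) (by omega)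
        rw [Nat.sub_add_cancel h0] at this
        omega
    have h3 := (hnext (p i)).2.2.1
    rw [← hp] at h3
    obtain ⟨y, hy, hyw⟩ := h3 l h2 h1
    exact ⟨y, hy, ccell_subset h1 hyw (hα (i + 1))⟩
  · intro N
    have h3 := (hnext (p N)).2.2.2
    rw [← hp] at h3
    exact ⟨(p N).1.1, (p (N + 1)).1.1, (p (N + 1)).1.2, hsm.le_apply, hlt N, (p N).2.1, h3,
      hα (N + 1)⟩

end path

/-- `F` is comparable to `n ^ d`. -/
def Growth (F : ℕ → ℝ) (d n₀ : ℕ) : Prop :=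
  ∀ n, n₀ ≤ n → (n : ℝ) ^ d / 2 ≤ F n ∧ F n ≤ 2 * (n : ℝ) ^ d

/-- The measure of a finite neighbourhood of the points `a / F j` with `j` in the `l`th block. -/
noncomputable def killMeasure (F : ℕ → ℝ) (c : ℝ) (l : ℕ) : Measure ℝ :=
  ∑ j ∈ Finset.Ioc (cutoff l) (cutoff (l + 1)), volume.restrict (near F (2 * c) j)

/-- The weighted measure attached to a cover by intervals. -/
noncomputable def coverMeasure (s : ℝ) (x δ : ℕ → ℝ) : Measure ℝ :=
  Measure.sum fun i => ENNReal.ofReal (δ i ^ (s - 1)) •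
    volume.restrict (Set.Icc (x i - 2 * δ i) (x i + 2 * δ i))

lemma coverMeasure_le {s : ℝ} {x δ : ℕ → ℝ} (hδ : ∀ i, 0 < δ i) (A : Set ℝ)
    (hA : MeasurableSet A) :
    coverMeasure s x δ A ≤ 4 * ∑' i, ENNReal.ofReal (δ i ^ s) := by
  rw [coverMeasure, Measure.sum_apply _ hA, ← ENNReal.tsum_mul_left]
  refine ENNReal.tsum_le_tsum fun i => ?_
  rw [Measure.smul_apply, Measure.restrict_apply hA, smul_eq_mul]
  calc _ ≤ ENNReal.ofReal (δ i ^ (s - 1)) * volume (Set.Icc (x i - 2 * δ i) (x i + 2 * δ i)) := by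
        gcongr; exact Set.inter_subset_right
    _ = 4 * ENNReal.ofReal (δ i ^ s) := by
        have := hδ i
        rw [Real.volume_Icc, ← ENNReal.ofReal_mul (by positivity)]
        have h4 : (4 : ENNReal) = ENNReal.ofReal 4 := by norm_num
        rw [h4, ← ENNReal.ofReal_mul (by norm_num), Real.rpow_sub_one this.ne']
        congr 1
        field_simp
        ring

lemma le_coverMeasure {s : ℝ} {x δ : ℕ → ℝ} (i : ℕ) {A : Set ℝ} (hA : MeasurableSet A)
    (h : A ⊆ Set.Icc (x i - 2 * δ i) (x i + 2 * δ i)) :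
    ENNReal.ofReal (δ i ^ (s - 1)) * volume A ≤ coverMeasure s x δ A := by
  rw [coverMeasure, Measure.sum_apply _ hA]
  refine le_trans (le_of_eq ?_) (ENNReal.le_tsum i)
  rw [Measure.smul_apply, Measure.restrict_apply hA, smul_eq_mul, Set.inter_eq_left.2 h]

lemma measurableSet_cell (d l : ℕ) (z : ℤ) : MeasurableSet (cell d l z) := measurableSet_Ico

lemma killMeasure_apply (F : ℕ → ℝ) (c : ℝ) (l : ℕ) {A : Set ℝ} (hA : MeasurableSet A) :
    killMeasure F c l A =
      ∑ j ∈ Finset.Ioc (cutoff l) (cutoff (l + 1)), volume (A ∩ near F (2 * c) j) := by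
  rw [killMeasure, Measure.finsetSum_apply]
  exact Finset.sum_congr rfl fun j _ => Measure.restrict_apply hA

lemma killMeasure_le {F : ℕ → ℝ} {d n₀ : ℕ} (hd : 1 ≤ d) (hF : Growth F d n₀) {c : ℝ} (hc : 0 ≤ c)
    {l l' : ℕ} (hl : l < l') (hn : n₀ ≤ cutoff l') (z : ℤ) :
    killMeasure F c l' (cell d l z) ≤ ENNReal.ofReal (32 * c) * volume (cell d l z) := by
  rw [killMeasure_apply _ _ _ (measurableSet_cell _ _ _), volume_cell]
  have hs := scale_pos' d l
  have hterm : ∀ j ∈ Finset.Ioc (cutoff l') (cutoff (l' + 1)),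
      volume (cell d l z ∩ near F (2 * c) j)
        ≤ ENNReal.ofReal (16 * c * (1 / scale d l) * tol j) := by
    intro j hj
    rw [Finset.mem_Ioc] at hj
    have hj2 : 2 ≤ j := (two_le_cutoff l').trans hj.1.le
    have ht := tol_pos hj2
    have e : cell d l z = Set.Ico ((z : ℝ) / scale d l) (z / scale d l + 1 / scale d l) := by
      rw [cell, add_div]
    have hjF := (hF j (hn.trans hj.1.le)).1
    have h1 : (scale d l : ℝ) ≤ F j := by
      refine le_trans ?_ hjF
      rw [le_div_iff₀ two_pos]
      have h2 : cutoff l ^ 4 ≤ j := by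
        rw [← cutoff_succ]
        exact (cutoff_mono hl).trans hj.1.le
      have h3 : scale d l * 2 ≤ j ^ d := by
        calc scale d l * 2 ≤ cutoff l ^ (d + 2) * cutoff l := by
              rw [scale_eq_cutoff]; gcongr; exact two_le_cutoff l
          _ = cutoff l ^ (d + 3) := by ring
          _ ≤ cutoff l ^ (4 * d) := Nat.pow_le_pow_right (cutoff_pos l) (by omega)
          _ = (cutoff l ^ 4) ^ d := by rw [pow_mul]
          _ ≤ j ^ d := by gcongr
      exact_mod_cast h3
    have h := volume_near_le F (2 * c) j (z / scale d l) (1 / scale d l) (hs.trans_le h1)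
      (by rw [one_div, inv_mul_eq_div, le_div_iff₀ hs]; linarith) (by positivity)
    rw [e]
    refine h.trans (le_of_eq ?_)
    congr 1
    ring
  refine (Finset.sum_le_sum hterm).trans ?_
  rw [← ENNReal.ofReal_sum_of_nonneg, ← Finset.mul_sum, ← ENNReal.ofReal_mul (by positivity)]
  · apply ENNReal.ofReal_le_ofReal
    have := sum_tol_block l'
    calc _ ≤ 16 * c * (1 / scale d l) * 2 := by gcongr
      _ = _ := by ring
  · intro j hj
    rw [Finset.mem_Ioc] at hj
    have ht := tol_pos ((two_le_cutoff l').trans hj.1.le)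
    positivity

/-- The closed cell avoids all neighbourhoods from the preceding block. -/
def Clean (F : ℕ → ℝ) (c : ℝ) (d l : ℕ) (z : ℤ) : Prop :=
  ∀ j ∈ Finset.Ioc (cutoff (l - 1)) (cutoff l), ∀ α ∈ ccell d l z, α ∉ near F c j

lemma growth_div_scale_le {F : ℕ → ℝ} {d n₀ : ℕ} (hF : Growth F d n₀) {c : ℝ}
    {k₀ : ℕ} (hn : n₀ ≤ k₀) (hM : ∀ x : ℝ, k₀ ≤ x → 2 * Real.log x ≤ c * x) {k l : ℕ}
    (hk : k₀ ≤ k) {j : ℕ} (h1 : cutoff k < j) (h2 : j ≤ cutoff l) :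
    0 < F j ∧ F j / scale d l ≤ c * tol j := by
  have hkj : k < j := (lt_cutoff k).trans h1
  have hj2 : 2 ≤ j := (two_le_cutoff k).trans h1.le
  have hj : (1 : ℝ) < j := by exact_mod_cast hj2
  have hjl := Real.log_pos hj
  obtain ⟨g1, g2⟩ := hF j (by omega)
  refine ⟨lt_of_lt_of_le (by positivity) g1, ?_⟩
  have hm := hM (cutoff l) (by exact_mod_cast (by omega : k₀ ≤ cutoff l))
  have hs := scale_pos' d l
  rw [div_le_iff₀ hs]
  unfold tol
  rw [mul_one_div, div_mul_eq_mul_div, le_div_iff₀ (by positivity), scale_eq_cutoff]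
  push_cast
  have hjm : (j : ℝ) ≤ cutoff l := by exact_mod_cast h2
  have hlog : Real.log j ≤ Real.log (cutoff l) := Real.log_le_log (by linarith) hjm
  calc F j * (j * Real.log j) ≤ 2 * (j : ℝ) ^ d * (j * Real.log j) := by gcongr
    _ ≤ 2 * (cutoff l : ℝ) ^ d * (cutoff l * Real.log (cutoff l)) := by gcongr
    _ = (cutoff l : ℝ) ^ (d + 1) * (2 * Real.log (cutoff l)) := by ring
    _ ≤ (cutoff l : ℝ) ^ (d + 1) * (c * cutoff l) := by gcongr
    _ = _ := by ring

lemma volume_le_killMeasure {F : ℕ → ℝ} {d n₀ : ℕ} (hF : Growth F d n₀) {c : ℝ}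
    {k₀ : ℕ} (hn : n₀ ≤ k₀) (hM : ∀ x : ℝ, k₀ ≤ x → 2 * Real.log x ≤ c * x) {l : ℕ}
    (hl : k₀ ≤ l) {w : ℤ} (hw : ¬ Clean F c d (l + 1) w) :
    volume (cell d (l + 1) w) ≤ killMeasure F c l (cell d (l + 1) w) := by
  unfold Clean at hw
  push Not at hw
  obtain ⟨j, hj, α, hα, hαj⟩ := hw
  simp only [Nat.add_sub_cancel] at hj
  rw [killMeasure_apply _ _ _ (measurableSet_cell _ _ _)]
  have hj' := Finset.mem_Ioc.1 hj
  obtain ⟨hFj, hle⟩ := growth_div_scale_le hF hn hM hl hj'.1 hj'.2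
  have hsub : cell d (l + 1) w ⊆ near F (2 * c) j := by
    intro β hβ
    have hβ' := cell_subset_ccell _ _ _ hβ
    have h1 : |β - α| ≤ 1 / scale d (l + 1) := by
      have a1 := hα.1
      have a2 := hα.2
      have b1 := hβ'.1
      have b2 := hβ'.2
      rw [add_div] at a2 b2
      rw [abs_le]
      constructor <;> linarith
    have h2 : |β * F j - α * F j| ≤ F j / scale d (l + 1) := by
      rw [← sub_mul, abs_mul, abs_of_pos hFj]
      calc _ ≤ 1 / (scale d (l + 1) : ℝ) * F j := by gcongr
        _ = _ := by ring
    have h3 := dist1_le_add (β * F j) (α * F j)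
    have h4 : dist1 (α * F j) ≤ c * tol j := hαj
    show dist1 (β * F j) ≤ 2 * c * tol j
    linarith
  calc volume (cell d (l + 1) w) = volume (cell d (l + 1) w ∩ near F (2 * c) j) := by
        rw [Set.inter_eq_left.2 hsub]
    _ ≤ _ := Finset.single_le_sum
        (f := fun j => volume (cell d (l + 1) w ∩ near F (2 * c) j)) (fun _ _ => zero_le) hj

/-- The points at which `n log n ‖α F n‖` has a finite positive lower limit. -/
def badSet (F : ℕ → ℝ) : Set ℝ :=
  {α | ∃ c > 0, (∀ᶠ j in atTop, c * tol j ≤ dist1 (α * F j)) ∧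
    ∃ᶠ j in atTop, dist1 (α * F j) ≤ 2 * tol j}

/-- The measure used to test the lightness of cells of level `l`. -/
noncomputable def levelMeasure (F : ℕ → ℝ) (c θ s : ℝ) (x δ : ℕ → ℝ) (l : ℕ) : Measure ℝ :=
  killMeasure F c l + ENNReal.ofReal (2 * θ / cutoff (l - 1)) • coverMeasure s x δ

lemma volume_cell_ne_zero (d l : ℕ) (z : ℤ) : volume (cell d l z) ≠ 0 := by
  rw [volume_cell]
  have := scale_pos' d l
  exact (ENNReal.ofReal_pos.2 (by positivity)).ne'

lemma volume_cell_ne_top (d l : ℕ) (z : ℤ) : volume (cell d l z) ≠ ⊤ := by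
  rw [volume_cell]
  exact ENNReal.ofReal_ne_top

lemma levelMeasure_le {F : ℕ → ℝ} {d n₀ : ℕ} (hd : 1 ≤ d) (hF : Growth F d n₀) {c θ s ε : ℝ}
    (hc : 0 ≤ c) (hθ : 0 < θ) {x δ : ℕ → ℝ} {k₀ : ℕ} (hn : n₀ ≤ k₀) (hcε : 32 * c ≤ ε / 2)
    (hk : 1 ≤ k₀) (hkε : θ / cutoff (k₀ - 1) ≤ ε / 2) {l : ℕ} (hl : k₀ ≤ l) {z : ℤ}
    (hz : Light d (levelMeasure F c θ s x δ) θ l z) {i : ℕ} (hi : 1 ≤ i) :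
    levelMeasure F c θ s x δ (l + i) (cell d l z) ≤ ENNReal.ofReal ε * volume (cell d l z) := by
  have hcut : ∀ m, (0 : ℝ) < cutoff m := fun m => by exact_mod_cast cutoff_pos m
  have h1 := killMeasure_le hd hF hc (l := l) (l' := l + i) (by omega)
    (by have := lt_cutoff (l + i); omega) z
  have h2 : ENNReal.ofReal (2 * θ / cutoff (l - 1)) * coverMeasure s x δ (cell d l z)
      ≤ ENNReal.ofReal θ * volume (cell d l z) := by
    refine le_trans ?_ hz
    rw [levelMeasure, Measure.add_apply, Measure.smul_apply, smul_eq_mul]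
    exact le_add_self
  have h3 : ENNReal.ofReal (2 * θ / cutoff (l + i - 1)) * coverMeasure s x δ (cell d l z)
      ≤ ENNReal.ofReal (ε / 2) * volume (cell d l z) := by
    have e : 2 * θ / cutoff (l + i - 1)
        = (cutoff (l - 1) / cutoff (l + i - 1)) * (2 * θ / cutoff (l - 1)) := by
      have := (hcut (l - 1)).ne'
      field_simp
    have hnn : (0 : ℝ) ≤ cutoff (l - 1) / cutoff (l + i - 1) := by
      have := hcut (l - 1); have := hcut (l + i - 1); positivity
    rw [e, ENNReal.ofReal_mul hnn, mul_assoc]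
    calc _ ≤ ENNReal.ofReal (cutoff (l - 1) / cutoff (l + i - 1)) *
          (ENNReal.ofReal θ * volume (cell d l z)) := by gcongr
      _ = ENNReal.ofReal (cutoff (l - 1) / cutoff (l + i - 1) * θ) * volume (cell d l z) := by
          rw [ENNReal.ofReal_mul hnn, mul_assoc]
      _ ≤ _ := by
          gcongr
          refine le_trans ?_ hkε
          rw [div_mul_eq_mul_div, div_le_div_iff₀ (hcut _) (hcut _)]
          have a1 : cutoff (l - 1) * cutoff (k₀ - 1) ≤ cutoff (l + i - 1) := by
            calc cutoff (l - 1) * cutoff (k₀ - 1) ≤ cutoff (l - 1) * cutoff (l - 1) := by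
                  gcongr; exact cutoff_mono (by omega)
              _ = cutoff (l - 1) ^ 2 := by ring
              _ ≤ cutoff (l - 1) ^ 4 := Nat.pow_le_pow_right (cutoff_pos _) (by norm_num)
              _ = cutoff (l - 1 + 1) := (cutoff_succ _).symm
              _ ≤ _ := cutoff_mono (by omega)
          have a2 : (cutoff (l - 1) : ℝ) * cutoff (k₀ - 1) ≤ cutoff (l + i - 1) := by
            exact_mod_cast a1
          nlinarith
  rw [levelMeasure, Measure.add_apply, Measure.smul_apply, smul_eq_mul]
  calc _ ≤ ENNReal.ofReal (ε / 2) * volume (cell d l z)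
        + ENNReal.ofReal (ε / 2) * volume (cell d l z) := by
        refine add_le_add (h1.trans ?_) h3
        gcongr
    _ = _ := by
        have hε : 0 ≤ ε / 2 := le_trans (by positivity) hcε
        rw [← add_mul, ← ENNReal.ofReal_add hε hε, add_halves]

lemma not_mem_of_light {F : ℕ → ℝ} {d : ℕ} {c θ : ℝ} (hθ : 0 < θ)
    {x δ : ℕ → ℝ} {k₀ : ℕ} {i : ℕ} (hδ : 0 < δ i) (hi : δ i < 1 / scale d k₀) {α : ℝ}
    (hα : ∀ l, k₀ ≤ l → ∃ y, Light d (levelMeasure F c θ (d / (d + 1)) x δ) θ l y ∧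
      α ∈ ccell d l y) : α ∉ Set.Icc (x i - δ i) (x i + δ i) := by
  intro hαi
  classical
  have hcut : ∀ m, (0 : ℝ) < cutoff m := fun m => by exact_mod_cast cutoff_pos m
  have hex : ∃ l, 1 / (scale d l : ℝ) ≤ δ i := by
    obtain ⟨m, hm⟩ := exists_nat_gt (1 / δ i)
    refine ⟨m, ?_⟩
    rw [div_le_iff₀ (scale_pos' d m)]
    rw [div_lt_iff₀ hδ] at hm
    have h1 : m ≤ scale d m := by
      rw [scale_eq_cutoff]
      exact (lt_cutoff m).le.trans (Nat.le_self_pow (by omega) _)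
    have h2 : (m : ℝ) ≤ scale d m := by exact_mod_cast h1
    nlinarith
  have hspec := Nat.find_spec hex
  set l := Nat.find hex with hl
  have hkl : k₀ < l := by
    by_contra hcon
    have h1 : (scale d l : ℝ) ≤ scale d k₀ := by exact_mod_cast scale_mono d (not_lt.1 hcon)
    have h2 : 1 / (scale d k₀ : ℝ) ≤ 1 / scale d l := by
      have := scale_pos' d l
      gcongr
    linarith
  have hmin : δ i < 1 / scale d (l - 1) := by
    have := Nat.find_min hex (m := l - 1) (by omega)
    exact not_le.1 this
  obtain ⟨y, hy, hαy⟩ := hα l hkl.le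
  have hsub : cell d l y ⊆ Set.Icc (x i - 2 * δ i) (x i + 2 * δ i) := by
    intro β hβ
    obtain ⟨a1, a2⟩ := hαy
    obtain ⟨b1, b2⟩ := cell_subset_ccell _ _ _ hβ
    rw [add_div] at a2 b2
    obtain ⟨c1, c2⟩ := hαi
    constructor <;> linarith
  have h1 := le_coverMeasure (s := (d / (d + 1) : ℝ)) i (measurableSet_cell d l y) hsub
  have hd0 : (0 : ℝ) < (d : ℝ) + 1 := by positivity
  have h2 : (cutoff (l - 1) : ℝ) ≤ δ i ^ ((d : ℝ) / (d + 1) - 1) := by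
    have hc1 : (1 : ℝ) ≤ cutoff (l - 1) := by exact_mod_cast cutoff_pos (l - 1)
    have e : (d : ℝ) / (d + 1) - 1 = -(1 / ((d : ℝ) + 1)) := by field_simp; ring
    rw [e, Real.rpow_neg hδ.le, ← Real.inv_rpow hδ.le]
    have h3 : (cutoff (l - 1) : ℝ) ^ ((d : ℝ) + 1) ≤ (δ i)⁻¹ := by
      have h4 : (scale d (l - 1) : ℝ) ≤ (δ i)⁻¹ := by
        rw [lt_div_iff₀ (scale_pos' d _)] at hmin
        rw [← one_div, le_div_iff₀ hδ]
        linarith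
      refine le_trans ?_ h4
      rw [scale_eq_cutoff]
      push_cast
      rw [← Real.rpow_natCast]
      apply Real.rpow_le_rpow_of_exponent_le hc1
      push_cast
      linarith
    calc (cutoff (l - 1) : ℝ)
        = ((cutoff (l - 1) : ℝ) ^ ((d : ℝ) + 1)) ^ (1 / ((d : ℝ) + 1)) := by
          rw [← Real.rpow_mul (by linarith), mul_one_div_cancel hd0.ne', Real.rpow_one]
      _ ≤ _ := by gcongr
  have h5 : ENNReal.ofReal (2 * θ) * volume (cell d l y)
      ≤ ENNReal.ofReal θ * volume (cell d l y) := by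
    refine le_trans ?_ hy
    rw [levelMeasure, Measure.add_apply, Measure.smul_apply, smul_eq_mul]
    refine le_trans ?_ le_add_self
    calc _ = ENNReal.ofReal (2 * θ / cutoff (l - 1)) *
          (ENNReal.ofReal (cutoff (l - 1)) * volume (cell d l y)) := by
          rw [← mul_assoc, ← ENNReal.ofReal_mul (by have := hcut (l - 1); positivity),
            div_mul_cancel₀ _ (hcut _).ne']
      _ ≤ _ := by
          gcongr
          refine le_trans ?_ h1
          gcongr
  rw [ENNReal.mul_le_mul_iff_left (volume_cell_ne_zero d l y) (volume_cell_ne_top d l y),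
    ENNReal.ofReal_le_ofReal_iff hθ.le] at h5
  linarith

lemma exists_light_root {F : ℕ → ℝ} {d n₀ : ℕ} (hd : 1 ≤ d) (hF : Growth F d n₀) {c θ s ε : ℝ}
    (hc : 0 ≤ c) (hθ : 0 < θ) (hθ1 : θ ≤ 1 / 2) {x δ : ℕ → ℝ} (hδ : ∀ i, 0 < δ i) {k₀ : ℕ}
    (hn : n₀ ≤ k₀) (hcε : 32 * c ≤ ε / 2) (hεθ : ε < θ) (hk : 1 ≤ k₀)
    (hsum : 4 * ∑' i, ENNReal.ofReal (δ i ^ s)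
      ≤ ENNReal.ofReal (ε / 2) * ENNReal.ofReal (1 / scale d 0)) :
    ∃ z, Light d (levelMeasure F c θ s x δ) θ k₀ z := by
  classical
  by_contra! hcon
  have hε : 0 ≤ ε / 2 := le_trans (by positivity) hcε
  have h1 := killMeasure_le hd hF hc (l := 0) (l' := k₀) (by omega)
    (by have := lt_cutoff k₀; omega) 0
  have h2 : ENNReal.ofReal (2 * θ / cutoff (k₀ - 1)) * coverMeasure s x δ (cell d 0 0)
      ≤ ENNReal.ofReal (ε / 2) * volume (cell d 0 0) := by
    rw [volume_cell]
    calc _ ≤ 1 * (4 * ∑' i, ENNReal.ofReal (δ i ^ s)) := by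
          gcongr
          · rw [ENNReal.ofReal_le_one, div_le_one (by exact_mod_cast cutoff_pos _)]
            have : (1 : ℝ) ≤ cutoff (k₀ - 1) := by exact_mod_cast cutoff_pos (k₀ - 1)
            linarith
          · exact coverMeasure_le hδ _ (measurableSet_cell _ _ _)
      _ ≤ _ := by rwa [one_mul]
  have h3 : levelMeasure F c θ s x δ k₀ (cell d 0 0) ≤ ENNReal.ofReal ε * volume (cell d 0 0) := by
    rw [levelMeasure, Measure.add_apply, Measure.smul_apply, smul_eq_mul]
    calc _ ≤ ENNReal.ofReal (ε / 2) * volume (cell d 0 0)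
          + ENNReal.ofReal (ε / 2) * volume (cell d 0 0) := by
          refine add_le_add (h1.trans ?_) h2
          gcongr
      _ = _ := by rw [← add_mul, ← ENNReal.ofReal_add hε hε, add_halves]
  have h4 := card_heavy_le (levelMeasure F c θ s x δ k₀) d (Nat.zero_le k₀) 0 (by linarith) hθ.le h3
    (descendants d 0 k₀ 0) subset_rfl fun w _ => (not_le.1 (hcon w)).le
  rw [card_descendants, mul_comm] at h4
  have h5 : (0 : ℝ) < desc d 0 k₀ := by exact_mod_cast desc_pos d (Nat.zero_le k₀)
  have := le_of_mul_le_mul_right h4 h5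
  linarith

theorem hausdorffMeasure_badSet_ne_zero {F : ℕ → ℝ} {d n₀ : ℕ} (hd : 1 ≤ d) (hF : Growth F d n₀)
    (hhit : HitProp F d) : Measure.hausdorffMeasure ((d : ℝ) / (d + 1)) (badSet F) ≠ 0 := by
  intro h0
  obtain ⟨κ, hκ, hhit⟩ := hhit
  set θ := min (κ / 16) (1 / 8) with hθd
  have hθ : 0 < θ := by positivity
  have hθκ : θ ≤ κ / 16 := min_le_left _ _
  have hθ8 : θ ≤ 1 / 8 := min_le_right _ _
  set ε := θ ^ 2 with hεd
  have hε : 0 < ε := by positivity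
  have hεθ : ε < θ := by nlinarith
  have hεdθ : ε / θ = θ := by rw [hεd]; field_simp
  set c := ε / 64 with hcd
  have hc : 0 < c := by positivity
  have hc1 : c ≤ 1 := by linarith
  have hlog : ∃ M : ℝ, ∀ x, M ≤ x → 2 * Real.log x ≤ c * x := by
    have := Real.isLittleO_log_id_atTop.bound (show 0 < c / 2 by positivity)
    obtain ⟨M, hM⟩ := eventually_atTop.1 this
    refine ⟨max M 1, fun x hx => ?_⟩
    have h1 := hM x ((le_max_left _ _).trans hx)
    have hx1 : 1 ≤ x := (le_max_right _ _).trans hx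
    simp only [id, Real.norm_eq_abs, abs_of_nonneg (Real.log_nonneg hx1)] at h1
    rw [abs_of_nonneg (by linarith)] at h1
    linarith
  obtain ⟨M, hM⟩ := hlog
  obtain ⟨k₀, hk₀⟩ := exists_nat_ge (max (max (n₀ : ℝ) M) (2 * θ / ε + 2))
  have hn : n₀ ≤ k₀ := by exact_mod_cast ((le_max_left _ _).trans (le_max_left _ _)).trans hk₀
  have hM' : ∀ x : ℝ, k₀ ≤ x → 2 * Real.log x ≤ c * x := fun x hx =>
    hM x ((((le_max_right _ _).trans (le_max_left _ _)).trans hk₀).trans hx)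
  have hk2 : 2 * θ / ε + 2 ≤ k₀ := (le_max_right _ _).trans hk₀
  have hk1 : 2 ≤ k₀ := by
    have : (2 : ℝ) ≤ k₀ := le_trans (by have : 0 ≤ 2 * θ / ε := by positivity
                                        linarith) hk2
    exact_mod_cast this
  have hkε : θ / cutoff (k₀ - 1) ≤ ε / 2 := by
    have h1 : ((k₀ - 1 : ℕ) : ℝ) ≤ cutoff (k₀ - 1) := by exact_mod_cast (lt_cutoff _).le
    rw [Nat.cast_sub (by omega), Nat.cast_one] at h1
    have h2 : 2 * θ / ε ≤ cutoff (k₀ - 1) := by linarith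
    rw [div_le_iff₀ hε] at h2
    rw [div_le_iff₀ (by exact_mod_cast cutoff_pos _)]
    linarith
  have hd0 : (0 : ℝ) < d := by exact_mod_cast hd
  have hs : 0 < (d : ℝ) / (d + 1) := by positivity
  set ε₀ : ENNReal := min (ENNReal.ofReal (ε / 8) * ENNReal.ofReal (1 / scale d 0))
    (ENNReal.ofReal ((1 / scale d k₀ : ℝ) ^ ((d : ℝ) / (d + 1)))) with hε₀
  have hε₀0 : ε₀ ≠ 0 := by
    have a := scale_pos' d 0
    have b := scale_pos' d k₀
    have h1 : (0 : ENNReal) < ENNReal.ofReal (ε / 8) * ENNReal.ofReal (1 / scale d 0) := by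
      rw [← ENNReal.ofReal_mul (by positivity)]
      exact ENNReal.ofReal_pos.2 (by positivity)
    exact (lt_min h1 (ENNReal.ofReal_pos.2 (by positivity))).ne'
  obtain ⟨x, δ, hδ, hsum, hcov⟩ := exists_cover hs h0 hε₀0
  have hδs : ∀ i, δ i < 1 / scale d k₀ := by
    intro i
    have h1 : ENNReal.ofReal (δ i ^ ((d : ℝ) / (d + 1))) <
        ENNReal.ofReal ((1 / scale d k₀ : ℝ) ^ ((d : ℝ) / (d + 1))) :=
      ((ENNReal.le_tsum i).trans_lt hsum).trans_le (min_le_right _ _)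
    have b := scale_pos' d k₀
    rw [ENNReal.ofReal_lt_ofReal_iff (by positivity)] at h1
    exact (Real.rpow_lt_rpow_iff (hδ i).le (by positivity) hs).1 h1
  set μ := levelMeasure F c θ (d / (d + 1)) x δ with hμ
  obtain ⟨z₀, hz₀⟩ := exists_light_root (s := d / (d + 1)) (x := x) hd hF hc.le hθ (by linarith)
    hδ hn (by linarith : 32 * c ≤ ε / 2) hεθ (by omega) (by
      calc 4 * ∑' i, ENNReal.ofReal (δ i ^ ((d : ℝ) / (d + 1)))
          ≤ 4 * (ENNReal.ofReal (ε / 8) * ENNReal.ofReal (1 / scale d 0)) := by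
            gcongr
            exact hsum.le.trans (min_le_left _ _)
        _ = ENNReal.ofReal (ε / 2) * ENNReal.ofReal (1 / scale d 0) := by
            have h4 : (4 : ENNReal) = ENNReal.ofReal 4 := by norm_num
            rw [← mul_assoc, h4, ← ENNReal.ofReal_mul (by norm_num)]
            congr 2
            ring)
  have H1 : ∀ l, k₀ ≤ l → ∀ z, Light d μ θ l z → ∀ i, 1 ≤ i →
      μ (l + i) (cell d l z) ≤ ENNReal.ofReal ε * volume (cell d l z) := fun l hl z hz i hi =>
    levelMeasure_le hd hF hc.le hθ hn (by linarith) (by omega) hkε hl hz hi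
  have H2 : ∀ l, k₀ ≤ l → ∀ w, ¬ Clean F c d (l + 1) w →
      volume (cell d (l + 1) w) ≤ μ l (cell d (l + 1) w) := by
    intro l hl w hw
    refine (volume_le_killMeasure hF hn hM' hl hw).trans ?_
    rw [hμ, levelMeasure, Measure.add_apply]
    exact le_self_add
  obtain ⟨α, hα1, hα2⟩ := exists_path (d := d) (k₀ := k₀) (Good d μ θ k₀ (Clean F c d))
    (fun k k' w => ∃ n, cutoff k < n ∧ n ≤ cutoff k' ∧
      dist1 ((w : ℝ) / scale d k' * F n) ≤ tol n) (z₀ := z₀) ⟨hz₀, fun h => absurd h (lt_irrefl _)⟩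
    (fun k hk z hz => exists_hit_step F hθ hε.le hεθ.le (by rw [hεdθ]; linarith)
      (by rw [hεdθ]; linarith : 3 * (ε / θ + θ) < κ) hhit H1 H2 hk hz)
  have hαB : α ∈ badSet F := by
    refine ⟨c, hc, ?_, ?_⟩
    · refine eventually_atTop.2 ⟨cutoff k₀ + 1, fun j hj => ?_⟩
      classical
      have hex : ∃ l, j ≤ cutoff l := ⟨j, (lt_cutoff j).le⟩
      have hsp := Nat.find_spec hex
      set l := Nat.find hex with hl
      have hkl : k₀ < l := cutoff_strictMono.lt_iff_lt.1 (by omega)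
      have hmin := Nat.find_min hex (m := l - 1) (by omega)
      obtain ⟨y, hy, hαy⟩ := hα1 l hkl.le
      have := hy.2 hkl j (Finset.mem_Ioc.2 ⟨not_le.1 hmin, hsp⟩) α hαy
      exact (not_le.1 this).le
    · rw [frequently_atTop]
      intro N
      obtain ⟨k, k', w, hN, hkk, hk, ⟨n, h1, h2, h3⟩, hαw⟩ := hα2 N
      refine ⟨n, by have := lt_cutoff k; omega, ?_⟩
      obtain ⟨hFn, hle⟩ := growth_div_scale_le hF hn hM' hk h1 h2
      have h4 := dist1_le_add (α * F n) ((w : ℝ) / scale d k' * F n)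
      have h5 : |α * F n - (w : ℝ) / scale d k' * F n| ≤ F n / scale d k' := by
        rw [← sub_mul, abs_mul, abs_of_pos hFn]
        obtain ⟨a1, a2⟩ := hαw
        rw [add_div] at a2
        have : |α - (w : ℝ) / scale d k'| ≤ 1 / scale d k' := by
          rw [abs_le]; constructor
          · have := scale_pos' d k'
            have : 0 ≤ 1 / (scale d k' : ℝ) := by positivity
            linarith
          · linarith
        calc _ ≤ 1 / (scale d k' : ℝ) * F n := by gcongr
          _ = _ := by ring
      have ht := tol_pos ((two_le_cutoff k).trans h1.le)
      nlinarith
  obtain ⟨i, hi⟩ := Set.mem_iUnion.1 (hcov hαB)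
  refine not_mem_of_light (F := F) (c := c) hθ (hδ i) (hδs i) (fun l hl => ?_) hi
  obtain ⟨y, hy, hαy⟩ := hα1 l hl
  exact ⟨y, hy.1, hαy⟩

open Polynomial in
lemma abs_eval_le_pow (g : Polynomial ℝ) (m : ℕ) (hg : g.natDegree ≤ m) :
    ∃ A : ℝ, 0 ≤ A ∧ ∀ x : ℝ, 1 ≤ x → |g.eval x| ≤ A * x ^ m := by
  refine ⟨∑ i ∈ Finset.range (m + 1), |g.coeff i|, by positivity, fun x hx => ?_⟩
  rw [Polynomial.eval_eq_sum_range' (Nat.lt_succ_of_le hg), Finset.sum_mul]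
  refine (Finset.abs_sum_le_sum_abs _ _).trans (Finset.sum_le_sum fun i hi => ?_)
  rw [abs_mul, abs_of_nonneg (by positivity : (0 : ℝ) ≤ x ^ i)]
  gcongr
  exact Nat.lt_succ_iff.1 (Finset.mem_range.1 hi)

open Polynomial in
lemma exists_shift_approx (f : Polynomial ℝ) {d : ℕ} (hd : 2 ≤ d) (hf : f.Monic)
    (hdeg : f.natDegree = d) :
    ∃ h A : ℝ, 0 ≤ A ∧ ∀ x : ℝ, 1 ≤ x → |f.eval x - (x + h) ^ d| ≤ A * x ^ (d - 2) := by
  have hd0 : (d : ℝ) ≠ 0 := by positivity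
  set h := f.coeff (d - 1) / d with hh
  obtain ⟨A, hA, hA'⟩ := abs_eval_le_pow (f - (X + C h) ^ d) (d - 2) (by
    rw [Polynomial.natDegree_le_iff_coeff_eq_zero]
    intro N hN
    rw [coeff_sub, coeff_X_add_C_pow]
    rcases lt_trichotomy N d with h1 | h1 | h1
    · have h2 : N = d - 1 := by omega
      have h3 : d - (d - 1) = 1 := by omega
      rw [h2, h3, pow_one, Nat.choose_symm (by omega : 1 ≤ d), Nat.choose_one_right, hh]
      field_simp
      ring
    · rw [h1]
      have := hf.coeff_natDegree
      rw [hdeg] at this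
      simp [this]
    · rw [Nat.choose_eq_zero_of_lt h1, coeff_eq_zero_of_natDegree_lt (by omega)]
      simp)
  refine ⟨h, A, hA, fun x hx => ?_⟩
  have := hA' x hx
  simpa using this

lemma abs_sub_mul_pow_le {x y : ℝ} (hx : 0 ≤ x) (hy : 0 ≤ y) {d : ℕ} (hd : 1 ≤ d) :
    |x - y| * x ^ (d - 1) ≤ |x ^ d - y ^ d| := by
  obtain ⟨m, rfl⟩ : ∃ m, d = m + 1 := ⟨d - 1, by omega⟩
  rw [← (Commute.all x y).geom_sum₂_mul, abs_mul, mul_comm]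
  gcongr
  rw [abs_of_nonneg (Finset.sum_nonneg fun i _ => by positivity)]
  refine le_trans ?_ (Finset.single_le_sum (f := fun i => x ^ i * y ^ (m + 1 - 1 - i))
    (fun i _ => by positivity) (Finset.mem_range.2 (Nat.lt_succ_self m)))
  simp

open Polynomial in
lemma growth_of_monic (f : Polynomial ℝ) {d : ℕ} (hd : 1 ≤ d) (hf : f.Monic)
    (hdeg : f.natDegree = d) : ∃ n₀, Growth (fun n => f.eval (n : ℝ)) d n₀ := by
  obtain ⟨A, hA, hA'⟩ := abs_eval_le_pow (f - X ^ d) (d - 1) (by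
    rw [Polynomial.natDegree_le_iff_coeff_eq_zero]
    intro N hN
    rw [coeff_sub, coeff_X_pow]
    rcases Nat.lt_or_ge d N with h1 | h1
    · rw [coeff_eq_zero_of_natDegree_lt (by omega), if_neg (by omega), sub_zero]
    · have : N = d := by omega
      have h2 := hf.coeff_natDegree
      rw [hdeg] at h2
      simp [this, h2])
  obtain ⟨m, hm⟩ := exists_nat_ge (2 * A + 1)
  refine ⟨m, fun n hn => ?_⟩
  have hn' : 2 * A + 1 ≤ n := hm.trans (by exact_mod_cast hn)
  have h1 := hA' n (by linarith)
  simp only [eval_sub, eval_pow, eval_X] at h1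
  have h2 : A * (n : ℝ) ^ (d - 1) ≤ (n : ℝ) ^ d / 2 := by
    obtain ⟨e, rfl⟩ : ∃ e, d = e + 1 := ⟨d - 1, by omega⟩
    simp only [Nat.add_sub_cancel]
    have h0 : (0 : ℝ) ≤ (n : ℝ) ^ e := by positivity
    rw [pow_succ]
    nlinarith
  have h3 := abs_le.1 (h1.trans h2)
  have h0 : (0 : ℝ) ≤ (n : ℝ) ^ d := by positivity
  constructor <;> linarith

lemma near_line_aux (e : ℕ) {A T Δ N : ℝ} (hA : 0 ≤ A) (hN0 : 0 < N) (hTr : 1 ≤ T) (hΔ : 1 ≤ Δ)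
    (hN : 1 ≤ N) (hJN : N ≤ T * N) :
    Δ + A * (2 * (T * N)) ^ e + (2 ^ (e + 2 + 2) + 2) * T ^ (e + 2) * (A * (2 * N) ^ e) ≤
      2 ^ (e + 1) * (1 + A * 2 ^ (e + 2) + A * 2 ^ (e + 2) * (2 ^ (e + 2 + 2) + 2)) * (T + Δ) / N
      * (T * N / 2) ^ (e + 1) := by
  obtain ⟨J, hJ⟩ : ∃ J, J = T * N := ⟨_, rfl⟩
  rw [← hJ] at hJN ⊢
  have hJe : (1 : ℝ) ≤ J ^ e := one_le_pow₀ (by linarith)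
  have hTe : (1 : ℝ) ≤ T ^ e := one_le_pow₀ hTr
  have hR : 2 ^ (e + 1) * (1 + A * 2 ^ (e + 2) + A * 2 ^ (e + 2) * (2 ^ (e + 2 + 2) + 2))
        * (T + Δ) / N
      * (J / 2) ^ (e + 1)
      = (1 + A * 2 ^ (e + 2) + A * 2 ^ (e + 2) * (2 ^ (e + 2 + 2) + 2))
        * (T + Δ) * (T * J ^ e) := by
    rw [div_pow, pow_succ J e]
    have : J = T * N := hJ
    rw [div_mul_div_comm, div_eq_iff (by positivity), this]
    ring
  rw [hR]
  have b1 : Δ ≤ (T + Δ) * (T * J ^ e) := by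
    have : 1 ≤ T * J ^ e := by nlinarith
    nlinarith
  have b2 : A * (2 * J) ^ e ≤ A * 2 ^ (e + 2) * ((T + Δ) * (T * J ^ e)) := by
    rw [mul_pow, mul_assoc]
    have h8 : (2 : ℝ) ^ e * J ^ e ≤ 2 ^ (e + 2) * ((T + Δ) * (T * J ^ e)) := by
      have : 1 ≤ (T + Δ) * T := by nlinarith
      calc (2 : ℝ) ^ e * J ^ e ≤ 2 ^ (e + 2) * (1 * J ^ e) := by
            rw [one_mul]; gcongr; norm_num; omega
        _ ≤ 2 ^ (e + 2) * (((T + Δ) * T) * J ^ e) := by gcongr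
        _ = _ := by ring
    gcongr
  have b3 : (2 ^ (e + 2 + 2) + 2) * T ^ (e + 2) * (A * (2 * N) ^ e)
      ≤ A * 2 ^ (e + 2) * (2 ^ (e + 2 + 2) + 2) * ((T + Δ) * (T * J ^ e)) := by
    have h8 : T ^ (e + 2) * (2 * N) ^ e ≤ 2 ^ (e + 2) * ((T + Δ) * (T * J ^ e)) := by
      calc T ^ (e + 2) * (2 * N) ^ e = 2 ^ e * (T * (T * J ^ e)) := by rw [hJ]; ring
        _ ≤ 2 ^ (e + 2) * ((T + Δ) * (T * J ^ e)) := by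
          gcongr
          · norm_num
          · omega
          · linarith
    calc (2 ^ (e + 2 + 2) + 2) * T ^ (e + 2) * (A * (2 * N) ^ e)
        = A * (2 ^ (e + 2 + 2) + 2) * (T ^ (e + 2) * (2 * N) ^ e) := by ring
      _ ≤ A * (2 ^ (e + 2 + 2) + 2) * (2 ^ (e + 2) * ((T + Δ) * (T * J ^ e))) := by gcongr
      _ = _ := by ring
  calc _ ≤ (T + Δ) * (T * J ^ e) + A * 2 ^ (e + 2) * ((T + Δ) * (T * J ^ e))
        + A * 2 ^ (e + 2) * (2 ^ (e + 2 + 2) + 2) * ((T + Δ) * (T * J ^ e)) := by linarith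
    _ = _ := by ring

/-- Pairs with `q f(j)` close to `p f(n)` lie close to a line. -/
lemma exists_near_line (f : Polynomial ℝ) {d : ℕ} (hd : 2 ≤ d) (hf : f.Monic)
    (hdeg : f.natDegree = d) :
    ∃ h A : ℝ, 0 < A ∧ ∃ N₀ : ℕ, ∀ N T : ℕ, N₀ ≤ N → 1 ≤ T → ∀ Δ : ℝ, 1 ≤ Δ → Δ ≤ N →
      ∀ p q : ℕ, 0 < p → 0 < q → ∀ n j : ℕ, N ≤ n → n < 2 * N → T * N ≤ j → j < 2 * (T * N) →
      |q * f.eval (j : ℝ) - p * f.eval (n : ℝ)| ≤ Δ →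
      |(j + h) - ((p : ℝ) / q) ^ (1 / (d : ℝ)) * (n + h)| ≤ A * (T + Δ) / N := by
  obtain ⟨h, A, hA, hfA⟩ := exists_shift_approx f hd hf hdeg
  obtain ⟨n₀, hgr⟩ := growth_of_monic f (by omega) hf hdeg
  obtain ⟨m, hm⟩ := exists_nat_ge (max (2 * |h|) 2)
  refine ⟨h, 2 ^ (d - 1) * (1 + A * 2 ^ d + A * 2 ^ d * (2 ^ (d + 2) + 2)),
    by positivity, max n₀ m, ?_⟩
  intro N T hN hT Δ hΔ hΔN p q hp hq n j hn hn2 hj hj2 hle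
  have hNm : max (2 * |h|) 2 ≤ (N : ℝ) := hm.trans (by exact_mod_cast (le_max_right _ _).trans hN)
  have hNh : 2 * |h| ≤ N := (le_max_left _ _).trans hNm
  have hN2 : (2 : ℝ) ≤ N := (le_max_right _ _).trans hNm
  have hN0 : (0 : ℝ) < N := by linarith
  have hTr : (1 : ℝ) ≤ T := by exact_mod_cast hT
  have hnr : (N : ℝ) ≤ n := by exact_mod_cast hn
  have hnr2 : (n : ℝ) ≤ 2 * N := by exact_mod_cast hn2.le
  have hjr : (T : ℝ) * N ≤ j := by exact_mod_cast hj
  have hjr2 : (j : ℝ) ≤ 2 * (T * N) := by exact_mod_cast hj2.le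
  have hJN : (N : ℝ) ≤ T * N := by nlinarith
  set J : ℝ := T * N with hJ
  have hpr : (0 : ℝ) < p := by exact_mod_cast hp
  have hqr : (1 : ℝ) ≤ q := by exact_mod_cast hq
  have hq0 : (0 : ℝ) < q := by linarith
  have hfn := hfA n (by linarith)
  have hfj := hfA j (by linarith)
  set k : ℝ := ((p : ℝ) / q) ^ (1 / (d : ℝ)) with hk
  have hk0 : 0 < k := by positivity
  have hkd : k ^ d = p / q := by
    rw [hk, ← Real.rpow_natCast, ← Real.rpow_mul (by positivity),
      one_div_mul_cancel (by positivity), Real.rpow_one]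
  -- bound for p / q
  have hgn := (hgr n (((le_max_left _ _).trans hN).trans hn)).1
  have hNj : N ≤ j := by
    have : (N : ℝ) ≤ j := by linarith
    exact_mod_cast this
  have hgj := (hgr j (((le_max_left _ _).trans hN).trans hNj)).2
  simp only at hgn hgj
  have hpq : (p : ℝ) / q ≤ (2 ^ (d + 2) + 2) * T ^ d := by
    have h1 : p * f.eval (n : ℝ) ≤ q * f.eval (j : ℝ) + Δ := by
      have := (abs_le.1 hle).1; linarith
    have h2 : (p : ℝ) * ((N : ℝ) ^ d / 2) ≤ q * (2 * (2 * J) ^ d) + q * N ^ d := by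
      calc (p : ℝ) * ((N : ℝ) ^ d / 2) ≤ p * f.eval (n : ℝ) := by
            gcongr
            refine le_trans ?_ hgn
            gcongr
        _ ≤ q * f.eval (j : ℝ) + Δ := h1
        _ ≤ q * (2 * (2 * J) ^ d) + q * N ^ d := by
            gcongr
            · refine hgj.trans ?_
              gcongr
            · have : (N : ℝ) ≤ N ^ d := le_self_pow₀ (by linarith) (by omega)
              nlinarith
    rw [div_le_iff₀ hq0]
    have h3 : (1 : ℝ) ≤ (T : ℝ) ^ d := one_le_pow₀ hTr
    have h4 : (0 : ℝ) < (N : ℝ) ^ d := by positivity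
    have h5 : (p : ℝ) * (N : ℝ) ^ d ≤ (2 ^ (d + 2) + 2) * T ^ d * q * N ^ d := by
      have e : q * (2 * (2 * J) ^ d) + q * (N : ℝ) ^ d
          = (2 ^ (d + 1) * T ^ d + 1) * q * N ^ d := by
        rw [hJ]; ring
      rw [e] at h2
      have : (2 ^ (d + 1) * (T : ℝ) ^ d + 1) * q * N ^ d
          ≤ (2 ^ (d + 1) * T ^ d + T ^ d) * q * N ^ d := by gcongr
      calc (p : ℝ) * (N : ℝ) ^ d = 2 * (p * ((N : ℝ) ^ d / 2)) := by ring
        _ ≤ 2 * ((2 ^ (d + 1) * T ^ d + T ^ d) * q * N ^ d) := by linarith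
        _ = _ := by ring
    exact le_of_mul_le_mul_right h5 h4
  -- main inequality
  have hX : J / 2 ≤ j + h := by
    have := neg_abs_le h
    linarith
  have hX0 : 0 ≤ j + h := by linarith
  have hY0 : 0 ≤ k * (n + h) := by
    have := neg_abs_le h
    have : 0 ≤ n + h := by linarith
    positivity
  have hmain : |(j + h) ^ d - (k * (n + h)) ^ d|
      ≤ Δ + A * (2 * J) ^ (d - 2) + (2 ^ (d + 2) + 2) * T ^ d * (A * (2 * N) ^ (d - 2)) := by
    rw [mul_pow, hkd]
    have e : (j + h) ^ d - (p : ℝ) / q * (n + h) ^ d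
        = (q * f.eval (j : ℝ) - p * f.eval (n : ℝ)) / q - (f.eval (j : ℝ) - (j + h) ^ d)
          + (p : ℝ) / q * (f.eval (n : ℝ) - (n + h) ^ d) := by
      field_simp
      ring
    rw [e]
    refine (abs_add_le _ _).trans (add_le_add ((abs_sub _ _).trans (add_le_add ?_ ?_)) ?_)
    · rw [abs_div, abs_of_pos hq0, div_le_iff₀ hq0]
      nlinarith
    · refine hfj.trans ?_
      gcongr
    · rw [abs_mul, abs_of_nonneg (by positivity : 0 ≤ (p : ℝ) / q)]
      gcongr
      refine hfn.trans ?_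
      gcongr
  have hlow := abs_sub_mul_pow_le hX0 hY0 (by omega : 1 ≤ d)
  have hpos : (0 : ℝ) < (J / 2) ^ (d - 1) := by
    have : 0 < J := by linarith
    positivity
  have h6 : |(j + h) - k * (n + h)| * (J / 2) ^ (d - 1)
      ≤ Δ + A * (2 * J) ^ (d - 2) + (2 ^ (d + 2) + 2) * T ^ d * (A * (2 * N) ^ (d - 2)) := by
    refine le_trans ?_ (hlow.trans hmain)
    gcongr
  refine le_of_mul_le_mul_right (h6.trans ?_) hpos
  obtain ⟨e, rfl⟩ : ∃ e, d = e + 2 := ⟨d - 2, by omega⟩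
  have e1 : e + 2 - 1 = e + 1 := by omega
  have e2 : e + 2 - 2 = e := by omega
  rw [e1, e2]
  exact near_line_aux e hA hN0 hTr hΔ (by linarith) hJN

lemma card_int_le (S : Finset ℤ) {x v : ℝ} (hv : 0 ≤ v) (h : ∀ i ∈ S, x ≤ i ∧ (i : ℝ) ≤ x + v) :
    (S.card : ℝ) ≤ v + 1 := by
  have hsub : S ⊆ Finset.Icc ⌈x⌉ ⌊x + v⌋ := fun i hi =>
    Finset.mem_Icc.2 ⟨Int.ceil_le.2 (h i hi).1, Int.le_floor.2 (h i hi).2⟩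
  have h1 := Finset.card_le_card hsub
  rw [Int.card_Icc] at h1
  have h2 : ((⌊x + v⌋ + 1 - ⌈x⌉ : ℤ) : ℝ) ≤ v + 1 := by
    push_cast
    have := Int.floor_le (x + v)
    have := Int.le_ceil x
    linarith
  rcases le_total 0 (⌊x + v⌋ + 1 - ⌈x⌉) with h3 | h3
  · have h4 : (S.card : ℤ) ≤ ⌊x + v⌋ + 1 - ⌈x⌉ := by omega
    have h5 : (S.card : ℝ) ≤ ((⌊x + v⌋ + 1 - ⌈x⌉ : ℤ) : ℝ) := by exact_mod_cast h4
    linarith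
  · have h4 : S.card = 0 := by omega
    rw [h4]
    push_cast
    linarith

lemma card_int_dvd_le (S : Finset ℤ) {x v : ℝ} (hv : 0 ≤ v) {q : ℕ} (hq : 0 < q)
    (h : ∀ i ∈ S, x ≤ i ∧ (i : ℝ) ≤ x + v) (hmod : ∀ i ∈ S, ∀ j ∈ S, (q : ℤ) ∣ i - j) :
    (S.card : ℝ) ≤ v / q + 1 := by
  rcases S.eq_empty_or_nonempty with rfl | ⟨a, ha⟩
  · simp; positivity
  have hqr : (0 : ℝ) < q := by exact_mod_cast hq
  have hinj : Set.InjOn (fun i : ℤ => (i - a) / (q : ℤ)) S := by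
    intro i hi j hj hij
    simp only at hij
    have h1 := Int.ediv_mul_cancel (hmod i hi a ha)
    have h2 := Int.ediv_mul_cancel (hmod j hj a ha)
    rw [hij, h2] at h1
    omega
  rw [← Finset.card_image_of_injOn hinj]
  refine card_int_le (x := (x - a) / q) _ (by positivity) ?_
  intro i hi
  obtain ⟨j, hj, rfl⟩ := Finset.mem_image.1 hi
  have h1 : (((j - a) / (q : ℤ) : ℤ) : ℝ) = (j - a) / q := by
    rw [Int.cast_div (hmod j hj a ha) (by exact_mod_cast hq.ne')]
    push_cast; rfl
  rw [h1, ← add_div]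
  obtain ⟨h2, h3⟩ := h j hj
  constructor <;> gcongr; linarith

lemma card_nat_le (S : Finset ℕ) {x v : ℝ} (hv : 0 ≤ v) (h : ∀ i ∈ S, x ≤ i ∧ (i : ℝ) ≤ x + v) :
    (S.card : ℝ) ≤ v + 1 := by
  rw [← Finset.card_image_of_injective S (Nat.cast_injective (R := ℤ))]
  refine card_int_le (x := x) _ hv fun i hi => ?_
  obtain ⟨j, hj, rfl⟩ := Finset.mem_image.1 hi
  exact_mod_cast h j hj

open Polynomial in
/-- A polynomial with a large top coefficient is small at few integers. -/
lemma card_small_eval_le (G : Polynomial ℝ) {d : ℕ} (hd : 1 ≤ d) (hdeg : G.natDegree ≤ d)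
    (hlead : 1 ≤ |G.coeff d|) {Δ : ℝ} (hΔ : 1 ≤ Δ) (S : Finset ℕ)
    (hS : ∀ i ∈ S, |G.eval (i : ℝ)| ≤ Δ) : (S.card : ℝ) ≤ 3 * d * Δ := by
  classical
  set H := G.map (algebraMap ℝ ℂ) with hH
  have hd' : G.natDegree = d := by
    refine le_antisymm hdeg (le_natDegree_of_ne_zero ?_)
    intro h0
    rw [h0, abs_zero] at hlead
    linarith
  have hcard : H.roots.card = d := by
    rw [IsAlgClosed.card_roots_eq_natDegree, hH, natDegree_map, hd']
  have hnorm : ∀ i : ℕ,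
      |G.coeff d| * (H.roots.map fun r => ‖(i : ℂ) - r‖).prod = |G.eval (i : ℝ)| := by
    intro i
    have h1 := (IsAlgClosed.splits H).eval_eq_prod_roots (i : ℂ)
    have h2 : H.eval (i : ℂ) = ((G.eval (i : ℝ) : ℝ) : ℂ) := by
      rw [hH, eval_map_algebraMap]
      have := Polynomial.aeval_algebraMap_apply ℂ (i : ℝ) G
      simpa using this
    rw [h2] at h1
    have h3 := congrArg (fun z : ℂ => ‖z‖) h1
    simp only [norm_mul, Complex.norm_real, Real.norm_eq_abs] at h3
    rw [h3, hH, leadingCoeff_map, leadingCoeff, hd']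
    congr 1
    · simp
    · rw [← hH]
      have := map_multiset_prod (normHom : ℂ →*₀ ℝ) (H.roots.map fun r => (i : ℂ) - r)
      simp only [Multiset.map_map] at this
      exact this.symm
  have hex : ∀ i ∈ S, ∃ r ∈ H.roots.toFinset, |(i : ℝ) - r.re| ≤ Δ := by
    intro i hi
    by_contra! hcon
    have h1 : Δ ^ d < (H.roots.map fun r => ‖(i : ℂ) - r‖).prod := by
      have h2 : ∀ r ∈ H.roots, Δ < ‖(i : ℂ) - r‖ := by
        intro r hr
        refine (hcon r (Multiset.mem_toFinset.2 hr)).trans_le ?_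
        simpa using Complex.abs_re_le_norm ((i : ℂ) - r)
      have key : ∀ s : Multiset ℂ, (∀ r ∈ s, Δ < ‖(i : ℂ) - r‖) → s ≠ 0 →
          Δ ^ s.card < (s.map fun r => ‖(i : ℂ) - r‖).prod := by
        intro s
        induction s using Multiset.induction_on with
        | empty => intro _ h; exact absurd rfl h
        | cons a s ih =>
          intro h _
          rw [Multiset.card_cons, Multiset.map_cons, Multiset.prod_cons, pow_succ']
          have ha := h a (Multiset.mem_cons_self a s)
          rcases eq_or_ne s 0 with h0 | h0
          · subst h0; simpa using ha
          · have := ih (fun r hr => h r (Multiset.mem_cons_of_mem hr)) h0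
            exact mul_lt_mul'' ha this (by linarith) (by positivity)
      have := key H.roots h2 (by rintro h0; rw [h0, Multiset.card_zero] at hcard; omega)
      rwa [hcard] at this
    have h2 := hS i hi
    rw [← hnorm] at h2
    have h3 : Δ ≤ Δ ^ d := le_self_pow₀ hΔ (by omega)
    have h4 : 0 ≤ (H.roots.map fun r => ‖(i : ℂ) - r‖).prod := le_trans (by positivity) h1.le
    nlinarith
  have hsub : S ⊆ H.roots.toFinset.biUnion fun r => S.filter fun i : ℕ => |(i : ℝ) - r.re| ≤ Δ := by
    intro i hi
    obtain ⟨r, hr, hir⟩ := hex i hi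
    exact Finset.mem_biUnion.2 ⟨r, hr, Finset.mem_filter.2 ⟨hi, hir⟩⟩
  have h1 : (S.card : ℝ) ≤ ∑ r ∈ H.roots.toFinset,
      ((S.filter fun i : ℕ => |(i : ℝ) - r.re| ≤ Δ).card : ℝ) := by
    exact_mod_cast (Finset.card_le_card hsub).trans Finset.card_biUnion_le
  have h2 : ∀ r ∈ H.roots.toFinset,
      ((S.filter fun i : ℕ => |(i : ℝ) - r.re| ≤ Δ).card : ℝ) ≤ 3 * Δ := by
    intro r _
    refine (card_nat_le (x := r.re - Δ) (v := 2 * Δ) _ (by linarith) fun i hi => ?_).trans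
      (by linarith)
    have := abs_le.1 (Finset.mem_filter.1 hi).2
    constructor <;> linarith
  refine h1.trans ((Finset.sum_le_sum h2).trans ?_)
  rw [Finset.sum_const, nsmul_eq_mul]
  have h3 : (H.roots.toFinset.card : ℝ) ≤ d := by
    rw [← hcard]; exact_mod_cast Multiset.toFinset_card_le _
  nlinarith

open Polynomial in
lemma coeff_comp_linear (f : Polynomial ℝ) {d : ℕ} (hf : f.Monic) (hdeg : f.natDegree = d)
    (a b : ℝ) : (f.comp (C a + C b * X)).coeff d = b ^ d ∧
      (f.comp (C a + C b * X)).natDegree ≤ d := by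
  have e : f.comp (C a + C b * X) = (taylor a f).comp (C b * X) := by
    rw [taylor_apply, comp_assoc]
    congr 1
    simp [add_comm]
  rw [e]
  constructor
  · rw [comp_C_mul_X_coeff, ← hdeg, coeff_taylor_natDegree, hf, one_mul]
  · refine natDegree_comp_le.trans ?_
    rw [natDegree_taylor, hdeg]
    have : (C b * X : ℝ[X]).natDegree ≤ 1 := by simpa using natDegree_C_mul_X_pow_le b 1
    nlinarith

lemma eq_pow_of_mul_pow_eq {p q d : ℕ} (hpq : p.Coprime q) {σ : ℤ} {τ : ℕ}
    (h : IsCoprime σ (τ : ℤ)) (he : (q : ℤ) * σ ^ d = p * (τ : ℤ) ^ d) :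
    q = τ ^ d ∧ p = σ.natAbs ^ d := by
  have he' := congrArg Int.natAbs he
  simp only [Int.natAbs_mul, Int.natAbs_pow, Int.natAbs_natCast] at he'
  have hc : Nat.Coprime σ.natAbs τ := by
    have := Int.isCoprime_iff_gcd_eq_one.1 h
    simpa [Int.gcd] using this
  have hcd : Nat.Coprime (σ.natAbs ^ d) (τ ^ d) := hc.pow d d
  constructor
  · refine Nat.dvd_antisymm (hpq.symm.dvd_of_dvd_mul_left ⟨_, he'.symm⟩) ?_
    exact hcd.symm.dvd_of_dvd_mul_right ⟨p, by rw [he', mul_comm]⟩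
  · refine Nat.dvd_antisymm (hpq.dvd_of_dvd_mul_left ⟨_, he'⟩) ?_
    exact hcd.dvd_of_dvd_mul_right ⟨q, by rw [← he', mul_comm]⟩

open Polynomial in
lemma card_collinear_le (f : Polynomial ℝ) {d : ℕ} (hd : 1 ≤ d) (hf : f.Monic)
    (hdeg : f.natDegree = d) {p q : ℕ} (hp : 0 < p) (hpq : p.Coprime q) {Δ H : ℝ}
    (hΔ : 1 ≤ Δ) (hH : 0 ≤ H) (S : Finset (ℕ × ℕ))
    (hS : ∀ x ∈ S, |q * f.eval (x.2 : ℝ) - p * f.eval (x.1 : ℝ)| ≤ Δ)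
    (hinj : ∀ x ∈ S, ∀ y ∈ S, x.1 = y.1 → x = y)
    (hcol : ∀ x ∈ S, ∀ y ∈ S, ∀ z ∈ S,
      ((y.1 : ℤ) - x.1) * ((z.2 : ℤ) - x.2) = ((z.1 : ℤ) - x.1) * ((y.2 : ℤ) - x.2))
    (hlen : ∀ x ∈ S, ∀ y ∈ S, (y.1 : ℝ) - x.1 ≤ H) :
    (S.card : ℝ) ≤ 3 * d * Δ ∨ ∃ σ τ : ℕ, 0 < σ ∧ 0 < τ ∧ q = τ ^ d ∧ p = σ ^ d ∧
      (S.card : ℝ) ≤ H / τ + 1 := by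
  classical
  have hdr : (1 : ℝ) ≤ d := by exact_mod_cast hd
  rcases Nat.lt_or_ge 1 S.card with hc | hc
  swap
  · left
    have : (S.card : ℝ) ≤ 1 := by exact_mod_cast hc
    nlinarith
  obtain ⟨x₀, hx₀, hmin⟩ := S.exists_min_image Prod.fst (Finset.card_pos.1 (by omega))
  obtain ⟨x₁, hx₁, hne⟩ := Finset.exists_mem_ne hc x₀
  have hlt : x₀.1 < x₁.1 := lt_of_le_of_ne (hmin _ hx₁) fun h => hne (hinj _ hx₁ _ hx₀ h.symm)
  obtain ⟨g, τ, σ, hg, hcop, hτ, hσ⟩ : ∃ g τ σ : ℤ, 0 < g ∧ IsCoprime σ τ ∧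
      (x₁.1 : ℤ) - x₀.1 = τ * g ∧ (x₁.2 : ℤ) - x₀.2 = σ * g := by
    have hg : 0 < Int.gcd ((x₁.2 : ℤ) - x₀.2) ((x₁.1 : ℤ) - x₀.1) :=
      Int.gcd_pos_of_ne_zero_right _ (by omega)
    obtain ⟨σ, τ, h1, h2, h3⟩ := Int.exists_gcd_one hg
    exact ⟨_, τ, σ, by exact_mod_cast hg, Int.isCoprime_iff_gcd_eq_one.2 h1, h3, h2⟩
  have hτ0 : 0 < τ := by
    have : 0 < τ * g := by rw [← hτ]; omega
    exact pos_of_mul_pos_left this hg.le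
  lift τ to ℕ using hτ0.le
  have hτ0' : 0 < τ := by exact_mod_cast hτ0
  have hpar : ∀ x ∈ S, ((x.1 : ℤ) - x₀.1) * σ = (x.2 - x₀.2) * τ := by
    intro x hx
    have h := hcol _ hx₀ _ hx _ hx₁
    rw [hτ, hσ] at h
    have : (((x.1 : ℤ) - x₀.1) * σ) * g = ((x.2 - x₀.2) * τ) * g := by linarith
    exact mul_right_cancel₀ hg.ne' this
  have hdvd : ∀ x ∈ S, τ ∣ x.1 - x₀.1 := by
    intro x hx
    have h1 : (τ : ℤ) ∣ ((x.1 : ℤ) - x₀.1) := by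
      refine hcop.symm.dvd_of_dvd_mul_right ?_
      exact ⟨x.2 - x₀.2, by rw [hpar x hx, mul_comm]⟩
    have := hmin x hx
    have h2 : ((x.1 : ℤ) - x₀.1) = ((x.1 - x₀.1 : ℕ) : ℤ) := by push_cast [this]; rfl
    rw [h2] at h1
    exact_mod_cast h1
  have hstep : ∀ x ∈ S, (x.1 : ℝ) = x₀.1 + τ * ((x.1 - x₀.1) / τ : ℕ) ∧
      (x.2 : ℝ) = x₀.2 + σ * ((x.1 - x₀.1) / τ : ℕ) := by
    intro x hx
    obtain ⟨i, hi⟩ := hdvd x hx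
    have h1 := hmin x hx
    have h2 : x.1 = x₀.1 + τ * i := by omega
    rw [hi, Nat.mul_div_cancel_left _ hτ0']
    refine ⟨by exact_mod_cast h2, ?_⟩
    have h3 := hpar x hx
    rw [h2] at h3
    have h4 : ((x.2 : ℤ) - x₀.2) = σ * i := by
      have : ((x.2 : ℤ) - x₀.2) * τ = (σ * i) * τ := by rw [← h3]; push_cast; ring
      exact mul_right_cancel₀ hτ0.ne' this
    have h5 : (x.2 : ℤ) = x₀.2 + σ * i := by linarith
    exact_mod_cast h5
  have hinj' : Set.InjOn (fun x : ℕ × ℕ => (x.1 - x₀.1) / τ) S := by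
    intro x hx y hy hxy
    refine hinj x hx y hy ?_
    simp only at hxy
    have h1 := (hstep x hx).1
    have h2 := (hstep y hy).1
    rw [hxy, ← h2] at h1
    exact_mod_cast h1
  set G : ℝ[X] := C (q : ℝ) * f.comp (C (x₀.2 : ℝ) + C (σ : ℝ) * X)
    - C (p : ℝ) * f.comp (C (x₀.1 : ℝ) + C (τ : ℝ) * X) with hG
  have hcoeff : G.coeff d = (((q : ℤ) * σ ^ d - p * (τ : ℤ) ^ d : ℤ) : ℝ) := by
    rw [hG, coeff_sub, coeff_C_mul, coeff_C_mul, (coeff_comp_linear f hf hdeg _ _).1,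
      (coeff_comp_linear f hf hdeg _ _).1]
    push_cast
    ring
  have hGdeg : G.natDegree ≤ d := by
    refine (natDegree_sub_le _ _).trans (max_le ?_ ?_) <;>
      exact (natDegree_C_mul_le _ _).trans (coeff_comp_linear f hf hdeg _ _).2
  by_cases h0 : (q : ℤ) * σ ^ d - p * (τ : ℤ) ^ d = 0
  · right
    obtain ⟨h1, h2⟩ := eq_pow_of_mul_pow_eq (d := d) hpq hcop (by linarith)
    refine ⟨σ.natAbs, τ, ?_, hτ0', h1, h2, ?_⟩
    · rcases Nat.eq_zero_or_pos σ.natAbs with h3 | h3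
      · rw [h3, zero_pow (by omega)] at h2; omega
      · exact h3
    · have hcard := Finset.card_image_of_injOn hinj'
      rw [← hcard]
      refine card_nat_le (x := 0) _ (by positivity) fun i hi => ⟨by positivity, ?_⟩
      obtain ⟨x, hx, rfl⟩ := Finset.mem_image.1 hi
      have h3 := (hstep x hx).1
      have h4 := hlen _ hx₀ _ hx
      rw [zero_add, le_div_iff₀ (by exact_mod_cast hτ0'), mul_comm]
      linarith
  · left
    have hcard := Finset.card_image_of_injOn hinj'
    rw [← hcard]
    refine card_small_eval_le G hd hGdeg ?_ hΔ _ fun i hi => ?_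
    · rw [hcoeff, ← Int.cast_abs]
      exact_mod_cast Int.one_le_abs h0
    · obtain ⟨x, hx, rfl⟩ := Finset.mem_image.1 hi
      have h3 := hstep x hx
      have := hS x hx
      rw [h3.1, h3.2] at this
      simpa [hG, eval_comp] using this

set_option maxHeartbeats 1000000 in
lemma exists_card_solutions_le (f : Polynomial ℝ) {d : ℕ} (hd : 2 ≤ d) (hf : f.Monic)
    (hdeg : f.natDegree = d) :
    ∃ C : ℝ, 1 ≤ C ∧ ∃ N₀ : ℕ, ∀ N T : ℕ, N₀ ≤ N → 1 ≤ T → ∀ Δ : ℝ, 1 ≤ Δ → C * (T + Δ) ≤ N →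
      ∀ p q : ℕ, 0 < p → 0 < q → p.Coprime q → ∀ S : Finset (ℕ × ℕ),
      (∀ x ∈ S, N ≤ x.1 ∧ x.1 < 2 * N ∧ T * N ≤ x.2 ∧ x.2 < 2 * (T * N) ∧
        |q * f.eval (x.2 : ℝ) - p * f.eval (x.1 : ℝ)| ≤ Δ) →
      (S.card : ℝ) ≤ C * T * Δ ^ 2 ∨ ∃ σ τ : ℕ, 0 < σ ∧ 0 < τ ∧ q = τ ^ d ∧ p = σ ^ d ∧
        (S.card : ℝ) ≤ C * T * Δ ^ 2 + 2 * N / τ := by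
  classical
  obtain ⟨h, A₀, hA₀, N₀, hline₀⟩ := exists_near_line f hd hf hdeg
  set A := A₀ + 1 with hAdef
  have hA1 : 1 ≤ A := by linarith
  have hA : 0 < A := by linarith
  have hdr : (2 : ℝ) ≤ d := by exact_mod_cast hd
  refine ⟨2 * (16 * A + 1) * (3 * d + 1), by nlinarith, N₀, ?_⟩
  set C := 2 * (16 * A + 1) * (3 * d + 1) with hC
  intro N T hN hT Δ hΔ hCN p q hp hq hpq S hS
  have hTr : (1 : ℝ) ≤ T := by exact_mod_cast hT
  have hC1 : 1 ≤ C := by rw [hC]; nlinarith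
  have hC2 : 8 * A ≤ C := by rw [hC]; nlinarith
  have hNpos : (0 : ℝ) < N := by nlinarith
  have hΔN : Δ ≤ N := by nlinarith
  set κ := ((p : ℝ) / q) ^ (1 / (d : ℝ)) with hκ
  set e := A * (T + Δ) / N with he
  set H := N / (8 * A * (T + Δ)) with hH
  have hTΔ : 0 < T + Δ := by linarith
  have hHpos : 0 < H := by positivity
  have heH : e * H = 1 / 8 := by rw [he, hH]; field_simp
  have he4 : e ≤ 1 / 8 := by
    rw [he, div_le_iff₀ hNpos]
    nlinarith
  have hnear : ∀ x ∈ S, |((x.2 : ℝ) + h) - κ * (x.1 + h)| ≤ e := fun x hx => by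
    obtain ⟨h1, h2, h3, h4, h5⟩ := hS x hx
    refine (hline₀ N T hN hT Δ hΔ hΔN p q hp hq x.1 x.2 h1 h2 h3 h4 h5).trans ?_
    rw [he]
    gcongr
    linarith
  have hdiff : ∀ x ∈ S, ∀ y ∈ S, |((y.2 : ℝ) - x.2) - κ * (y.1 - x.1)| ≤ 2 * e := by
    intro x hx y hy
    have h1 := hnear x hx
    have h2 := hnear y hy
    have e1 : ((y.2 : ℝ) - x.2) - κ * (y.1 - x.1)
      = (((y.2 : ℝ) + h) - κ * (y.1 + h)) - (((x.2 : ℝ) + h) - κ * (x.1 + h)) := by ring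
    rw [e1]
    refine (abs_sub _ _).trans (by linarith)
  have hinj : ∀ x ∈ S, ∀ y ∈ S, x.1 = y.1 → x = y := by
    intro x hx y hy hxy
    have h1 := hdiff x hx y hy
    rw [hxy, sub_self, mul_zero, sub_zero] at h1
    have h2 : |(y.2 : ℤ) - x.2| < 1 := by
      have : |((y.2 : ℝ) - x.2)| < 1 := by linarith
      exact_mod_cast this
    rw [Int.abs_lt_one_iff] at h2
    exact Prod.ext hxy (by omega)
  set idx : ℕ × ℕ → ℕ := fun x => ⌊((x.1 : ℝ) - N) / H⌋₊ with hidx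
  set K := ⌊(N : ℝ) / H⌋₊ + 1 with hK
  have hmaps : ∀ x ∈ S, idx x ∈ Finset.range K := by
    intro x hx
    obtain ⟨h1, h2, -⟩ := hS x hx
    rw [Finset.mem_range, hK, Nat.lt_add_one_iff]
    refine Nat.floor_mono ?_
    have : (x.1 : ℝ) ≤ 2 * N := by exact_mod_cast h2.le
    gcongr
    linarith
  have hcardS := Finset.card_eq_sum_card_fiberwise hmaps
  have hNH : (N : ℝ) / H = 8 * A * (T + Δ) := by rw [hH]; field_simp
  have hKle : (K : ℝ) ≤ 8 * A * (T + Δ) + 1 := by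
    rw [hK, ← hNH]
    push_cast
    have := Nat.floor_le (by positivity : 0 ≤ (N : ℝ) / H)
    linarith
  have hlenI : ∀ i, ∀ x ∈ S.filter (fun x => idx x = i), ∀ y ∈ S.filter (fun x => idx x = i),
      (y.1 : ℝ) - x.1 ≤ H := by
    intro i x hx y hy
    obtain ⟨hx, hxi⟩ := Finset.mem_filter.1 hx
    obtain ⟨hy, hyi⟩ := Finset.mem_filter.1 hy
    have hx1 : (N : ℝ) ≤ x.1 := by exact_mod_cast (hS x hx).1
    have hxl := Nat.floor_le (by apply div_nonneg _ hHpos.le; linarith : 0 ≤ ((x.1 : ℝ) - N) / H)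
    have hyl := Nat.lt_floor_add_one (((y.1 : ℝ) - N) / H)
    simp only [hidx] at hxi hyi
    rw [hxi, le_div_iff₀ hHpos] at hxl
    rw [hyi, div_lt_iff₀ hHpos] at hyl
    linarith
  have hcls : ∀ i, ((S.filter (fun x => idx x = i)).card : ℝ) ≤ 3 * d * Δ ∨
      ∃ σ τ : ℕ, 0 < σ ∧ 0 < τ ∧ q = τ ^ d ∧ p = σ ^ d ∧
      ((S.filter (fun x => idx x = i)).card : ℝ) ≤ H / τ + 1 := by
    intro i
    have hsub : ∀ x ∈ S.filter (fun x => idx x = i), x ∈ S := fun x hx => (Finset.mem_filter.1 hx).1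
    refine card_collinear_le f (by omega) hf hdeg hp hpq hΔ hHpos.le _
      (fun x hx => (hS x (hsub x hx)).2.2.2.2)
      (fun x hx y hy => hinj x (hsub x hx) y (hsub y hy)) ?_ (hlenI i)
    intro x hx y hy z hz
    have a1 := hdiff x (hsub x hx) y (hsub y hy)
    have a2 := hdiff x (hsub x hx) z (hsub z hz)
    have b1 : |(y.1 : ℝ) - x.1| ≤ H := abs_le.2 ⟨by linarith [hlenI i y hy x hx], hlenI i x hx y hy⟩
    have b2 : |(z.1 : ℝ) - x.1| ≤ H := abs_le.2 ⟨by linarith [hlenI i z hz x hx], hlenI i x hx z hz⟩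
    have e1 : ((y.1 : ℝ) - x.1) * ((z.2 : ℝ) - x.2) - ((z.1 : ℝ) - x.1) * ((y.2 : ℝ) - x.2)
        = ((y.1 : ℝ) - x.1) * (((z.2 : ℝ) - x.2) - κ * (z.1 - x.1))
          - ((z.1 : ℝ) - x.1) * (((y.2 : ℝ) - x.2) - κ * (y.1 - x.1)) := by ring
    have e2 : |((y.1 : ℝ) - x.1) * ((z.2 : ℝ) - x.2) - ((z.1 : ℝ) - x.1) * ((y.2 : ℝ) - x.2)|
        < 1 := by
      rw [e1]
      refine lt_of_le_of_lt (abs_sub _ _) ?_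
      rw [abs_mul, abs_mul]
      have c1 := mul_le_mul b1 a2 (abs_nonneg _) hHpos.le
      have c2 := mul_le_mul b2 a1 (abs_nonneg _) hHpos.le
      nlinarith
    have e3 : |((y.1 : ℤ) - x.1) * ((z.2 : ℤ) - x.2) - ((z.1 : ℤ) - x.1) * ((y.2 : ℤ) - x.2)|
        < 1 := by exact_mod_cast e2
    rw [Int.abs_lt_one_iff] at e3
    linarith
  have hKC : (8 * A * (T + Δ) + 1) * (3 * d * Δ + 1) ≤ C * T * Δ ^ 2 := by
    have h1 : T + Δ ≤ 2 * (T * Δ) := by nlinarith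
    have h2 : 8 * A * (T + Δ) + 1 ≤ (16 * A + 1) * (T * Δ) := by
      have : 1 ≤ T * Δ := by nlinarith
      nlinarith
    have h3 : 3 * d * Δ + 1 ≤ (3 * d + 1) * Δ := by nlinarith
    calc (8 * A * (T + Δ) + 1) * (3 * d * Δ + 1)
        ≤ ((16 * A + 1) * (T * Δ)) * ((3 * d + 1) * Δ) := by gcongr
      _ = C / 2 * T * Δ ^ 2 := by rw [hC]; ring
      _ ≤ C * T * Δ ^ 2 := by gcongr; linarith
  by_cases hex : ∃ i, ¬ ((S.filter (fun x => idx x = i)).card : ℝ) ≤ 3 * d * Δ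
  · right
    obtain ⟨i, hi⟩ := hex
    obtain ⟨σ, τ, hσ, hτ, hqτ, hpσ, -⟩ := (hcls i).resolve_left hi
    refine ⟨σ, τ, hσ, hτ, hqτ, hpσ, ?_⟩
    have hτr : (1 : ℝ) ≤ τ := by exact_mod_cast hτ
    have hall : ∀ i ∈ Finset.range K, ((S.filter (fun x => idx x = i)).card : ℝ)
        ≤ (3 * d * Δ + 1) + H / τ := by
      intro i _
      have : 0 ≤ H / τ := by positivity
      rcases hcls i with h1 | ⟨σ', τ', -, -, hq', -, h1⟩
      · linarith
      · have : τ' = τ := Nat.pow_left_injective (by omega : d ≠ 0) (hq'.symm.trans hqτ)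
        rw [this] at h1
        nlinarith
    rw [hcardS]
    push_cast
    refine (Finset.sum_le_sum hall).trans ?_
    rw [Finset.sum_const, Finset.card_range, nsmul_eq_mul, mul_add]
    refine add_le_add (le_trans (by gcongr) hKC) ?_
    have hHN : H ≤ N := by
      rw [hH]
      apply div_le_self hNpos.le
      nlinarith
    calc (K : ℝ) * (H / τ) ≤ (8 * A * (T + Δ) + 1) * (H / τ) := by gcongr
      _ = (N + H) / τ := by rw [← hNH]; field_simp
      _ ≤ 2 * N / τ := by gcongr; linarith
  · left
    push Not at hex
    rw [hcardS]
    push_cast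
    refine (Finset.sum_le_sum fun i _ => hex i).trans ?_
    rw [Finset.sum_const, Finset.card_range, nsmul_eq_mul]
    refine le_trans ?_ hKC
    gcongr
    linarith

lemma sum_inv_sq_le (Q : ℕ) : ∑ τ ∈ Finset.Icc 1 Q, 1 / (τ : ℝ) ^ 2 ≤ 2 := by
  have h := sum_Ioo_inv_sq_le (α := ℝ) 0 (Q + 1)
  have e : Finset.Icc 1 Q = Finset.Ioo 0 (Q + 1) := by ext; simp; omega
  rw [e]
  simpa using h

lemma le_of_near_ratio {F : ℕ → ℝ} {d n₀ : ℕ} (hF : Growth F d n₀) {N T : ℕ} (hN : n₀ ≤ N)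
    (hT : 1 ≤ T) (hd : 1 ≤ d) {Δ : ℝ} (hΔ : Δ ≤ N) {p q n j : ℕ} (hq : 0 < q)
    (h1 : N ≤ n) (h2 : n < 2 * N) (h3 : T * N ≤ j) (h4 : j < 2 * (T * N))
    (h : |q * F j - p * F n| ≤ Δ) : p ≤ (2 ^ (d + 2) + 2) * T ^ d * q := by
  have hN0 : (0 : ℝ) < N := by exact_mod_cast (by omega : 0 < N)
  have hN1 : (1 : ℝ) ≤ N := by exact_mod_cast (by omega : 1 ≤ N)
  have hTr : (1 : ℝ) ≤ T := by exact_mod_cast hT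
  have hq1 : (1 : ℝ) ≤ q := by exact_mod_cast hq
  have hTN : N ≤ T * N := Nat.le_mul_of_pos_left _ hT
  have hFn := (hF n (by omega)).1
  have hFj := (hF j (by omega)).2
  have hn : (N : ℝ) ^ d ≤ (n : ℝ) ^ d := by gcongr
  have hj : (j : ℝ) ^ d ≤ (2 * (T * N)) ^ d := by
    have : (j : ℝ) ≤ 2 * (T * N) := by exact_mod_cast h4.le
    gcongr
  have h5 := abs_le.1 h
  have h6 : (N : ℝ) ≤ (N : ℝ) ^ d := le_self_pow₀ hN1 (by omega)
  have h7 : (p : ℝ) * ((N : ℝ) ^ d / 2) ≤ p * F n := by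
    gcongr
    linarith
  have h8 : (q : ℝ) * F j ≤ q * (2 * (2 * (T * N)) ^ d) := by
    gcongr
    linarith
  have h9 : (p : ℝ) * (N : ℝ) ^ d ≤ (2 ^ (d + 2) + 2) * T ^ d * q * N ^ d := by
    have e : (q : ℝ) * (2 * (2 * (T * N)) ^ d) = 2 ^ (d + 1) * T ^ d * q * N ^ d := by
      rw [mul_pow, mul_pow]; ring
    have h10 : (N : ℝ) ^ d ≤ T ^ d * q * N ^ d := by
      have : (1 : ℝ) ≤ T ^ d := one_le_pow₀ hTr
      have : (1 : ℝ) ≤ T ^ d * q := by nlinarith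
      exact le_mul_of_one_le_left (by positivity) this
    have e2 : ((2 : ℝ) ^ (d + 2) + 2) * T ^ d * q * N ^ d
      = 2 * (2 ^ (d + 1) * T ^ d * q * N ^ d) + 2 * (T ^ d * q * N ^ d) := by ring
    rw [e2, ← e]
    linarith
  have h10 := le_of_mul_le_mul_right h9 (by positivity)
  exact_mod_cast h10

lemma exists_sum_inv_le (f : Polynomial ℝ) {d : ℕ} (hd : 2 ≤ d) (hf : f.Monic)
    (hdeg : f.natDegree = d) :
    ∃ C : ℝ, 1 ≤ C ∧ ∃ N₀ : ℕ, ∀ N T : ℕ, N₀ ≤ N → 1 ≤ T → ∀ Δ : ℝ, 1 ≤ Δ → C * (T + Δ) ≤ N →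
      ∀ (Q : ℕ) (p q : ℕ × ℕ → ℕ) (S : Finset (ℕ × ℕ)),
      (∀ x ∈ S, N ≤ x.1 ∧ x.1 < 2 * N ∧ T * N ≤ x.2 ∧ x.2 < 2 * (T * N)) →
      (∀ x ∈ S, 0 < p x ∧ 0 < q x ∧ (p x).Coprime (q x) ∧ q x ≤ Q ∧
        |q x * f.eval (x.2 : ℝ) - p x * f.eval (x.1 : ℝ)| ≤ Δ) →
      ∑ x ∈ S, 1 / (q x : ℝ) ≤ C * (Q * T ^ (d + 1) * Δ ^ 2 + T * N) := by
  classical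
  obtain ⟨C, hC, N₀, hsol⟩ := exists_card_solutions_le f hd hf hdeg
  obtain ⟨n₀, hF⟩ := growth_of_monic f (by omega) hf hdeg
  set P : ℕ := 2 ^ (d + 2) + 2 with hP
  have hP1 : (1 : ℝ) ≤ P := by
    have : 1 ≤ P := by rw [hP]; exact Nat.le_add_left_of_le (by norm_num)
    exact_mod_cast this
  refine ⟨C * (4 * P), by nlinarith, max N₀ n₀, ?_⟩
  intro N T hN hT Δ hΔ hCN Q p q S hS hpq
  have hTr : (1 : ℝ) ≤ T := by exact_mod_cast hT
  have hCN' : C * (T + Δ) ≤ N := by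
    refine le_trans ?_ hCN
    have : C ≤ C * (4 * P) := by nlinarith
    gcongr
  have hΔN : Δ ≤ N := by nlinarith
  have hNpos : (0 : ℝ) < N := by linarith
  have hple : ∀ x ∈ S, p x ≤ P * T ^ d * q x := fun x hx => by
    obtain ⟨h1, h2, h3, h4⟩ := hS x hx
    obtain ⟨h5, h6, h7, h8, h9⟩ := hpq x hx
    exact le_of_near_ratio hF (le_trans (le_max_right _ _) hN) hT (by omega) hΔN h6 h1 h2 h3 h4 h9
  set t : Finset (ℕ × ℕ) := (Finset.Icc 1 Q ×ˢ Finset.Icc 1 (P * T ^ d * Q)).filter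
    fun y => y.2 ≤ P * T ^ d * y.1 with ht
  set Θ : Finset (ℕ × ℕ) := (Finset.Icc 1 Q ×ˢ Finset.Icc 1 (P * T * Q)).filter
    fun y => y.2 ≤ P * T * y.1 with hΘ
  have hmaps : ∀ x ∈ S, (q x, p x) ∈ t := by
    intro x hx
    obtain ⟨h5, h6, h7, h8, h9⟩ := hpq x hx
    simp only [ht, Finset.mem_filter, Finset.mem_product, Finset.mem_Icc]
    have := hple x hx
    exact ⟨⟨⟨h6, h8⟩, h5, this.trans (Nat.mul_le_mul_left _ h8)⟩, this⟩
  rw [← Finset.sum_fiberwise_of_maps_to hmaps]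
  set g : ℕ × ℕ → ℕ × ℕ → ℝ := fun y s =>
    if y = (s.1 ^ d, s.2 ^ d) then 2 * N / (s.1 : ℝ) ^ 3 else 0 with hg
  have hgnn : ∀ y s, 0 ≤ g y s := fun y s => by
    simp only [hg]; split_ifs <;> positivity
  have hfib : ∀ y ∈ t, ∑ x ∈ S with (q x, p x) = y, 1 / (q x : ℝ)
      ≤ C * T * Δ ^ 2 / y.1 + ∑ s ∈ Θ, g y s := by
    intro y hy
    simp only [ht, Finset.mem_filter, Finset.mem_product, Finset.mem_Icc] at hy
    obtain ⟨⟨⟨hy1, hy2⟩, hy3, hy4⟩, hy5⟩ := hy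
    have hgs : 0 ≤ ∑ s ∈ Θ, g y s := Finset.sum_nonneg fun s _ => hgnn y s
    have hy1' : (0 : ℝ) < y.1 := by exact_mod_cast hy1
    have e1 : ∑ x ∈ S with (q x, p x) = y, 1 / (q x : ℝ)
        = ((S.filter fun x => (q x, p x) = y).card : ℝ) / y.1 := by
      rw [Finset.sum_congr rfl (g := fun _ => 1 / (y.1 : ℝ)), Finset.sum_const, nsmul_eq_mul,
        mul_one_div]
      intro x hx
      rw [← (Finset.mem_filter.1 hx).2]
    rw [e1]
    rcases (S.filter fun x => (q x, p x) = y).eq_empty_or_nonempty with h0 | ⟨x₀, hx₀⟩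
    · rw [h0]; simp only [Finset.card_empty, Nat.cast_zero, zero_div]; positivity
    obtain ⟨hx₀, hx₀y⟩ := Finset.mem_filter.1 hx₀
    have hcop := (hpq x₀ hx₀).2.2.1
    rw [Prod.ext_iff] at hx₀y
    simp only at hx₀y
    rw [hx₀y.1, hx₀y.2] at hcop
    rcases hsol N T (le_trans (le_max_left _ _) hN) hT Δ hΔ hCN' y.2 y.1 hy3 hy1 hcop
        (S.filter fun x => (q x, p x) = y) (by
          intro x hx
          obtain ⟨hx, hxy⟩ := Finset.mem_filter.1 hx
          obtain ⟨h1, h2, h3, h4⟩ := hS x hx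
          obtain ⟨h5, h6, h7, h8, h9⟩ := hpq x hx
          rw [← hxy]
          exact ⟨h1, h2, h3, h4, h9⟩) with h | ⟨σ, τ, hσ, hτ, hqτ, hpσ, h⟩
    · have : ((S.filter fun x => (q x, p x) = y).card : ℝ) / y.1 ≤ C * T * Δ ^ 2 / y.1 := by
        gcongr
      linarith
    · have hτr : (1 : ℝ) ≤ τ := by exact_mod_cast hτ
      have hmem : (τ, σ) ∈ Θ := by
        have h1 : τ ≤ Q := (Nat.le_self_pow (by omega) τ).trans (hqτ ▸ hy2)
        have h2 : σ ≤ P * T * τ := by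
          rw [hpσ, hqτ] at hy5
          refine (Nat.pow_le_pow_iff_left (by omega : d ≠ 0)).1 (hy5.trans ?_)
          rw [mul_pow, mul_pow]
          gcongr
          exact Nat.le_self_pow (by omega) P
        simp only [hΘ, Finset.mem_filter, Finset.mem_product, Finset.mem_Icc]
        exact ⟨⟨⟨hτ, h1⟩, hσ, h2.trans (Nat.mul_le_mul_left _ h1)⟩, h2⟩
      have h1 : g y (τ, σ) ≤ ∑ s ∈ Θ, g y s :=
        Finset.single_le_sum (fun s _ => hgnn y s) hmem
      have h2 : g y (τ, σ) = 2 * N / (τ : ℝ) ^ 3 := by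
        simp only [hg]; rw [if_pos (Prod.ext hqτ hpσ)]
      have h3 : ((S.filter fun x => (q x, p x) = y).card : ℝ) / y.1
          ≤ (C * T * Δ ^ 2 + 2 * N / τ) / y.1 := by gcongr
      have h4 : 2 * N / (τ : ℝ) / y.1 ≤ 2 * N / (τ : ℝ) ^ 3 := by
        rw [div_div]
        gcongr
        rw [hqτ]
        push_cast
        rw [← pow_succ']
        exact pow_le_pow_right₀ hτr (by omega)
      rw [add_div] at h3
      linarith
  refine (Finset.sum_le_sum hfib).trans ?_
  rw [Finset.sum_add_distrib]
  have hA : ∑ y ∈ t, C * T * Δ ^ 2 / (y.1 : ℝ) ≤ C * P * (Q * T ^ (d + 1) * Δ ^ 2) := by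
    rw [ht, Finset.sum_filter, Finset.sum_product]
    have : ∀ y ∈ Finset.Icc 1 Q, (∑ b ∈ Finset.Icc 1 (P * T ^ d * Q),
        if b ≤ P * T ^ d * y then C * T * Δ ^ 2 / (y : ℝ) else 0)
        ≤ C * P * (T ^ (d + 1) * Δ ^ 2) := by
      intro y hy
      have hy0 : (0 : ℝ) < y := by exact_mod_cast (Finset.mem_Icc.1 hy).1
      rw [← Finset.sum_filter, Finset.sum_const, nsmul_eq_mul]
      have hc : ((Finset.Icc 1 (P * T ^ d * Q)).filter (· ≤ P * T ^ d * y)).card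
          ≤ P * T ^ d * y := by
        refine (Finset.card_le_card (t := Finset.Icc 1 (P * T ^ d * y)) ?_).trans (by simp)
        intro b hb
        simp only [Finset.mem_filter, Finset.mem_Icc] at hb ⊢
        exact ⟨hb.1.1, hb.2⟩
      calc _ ≤ ((P * T ^ d * y : ℕ) : ℝ) * (C * T * Δ ^ 2 / y) := by
            gcongr
        _ = C * P * (T ^ (d + 1) * Δ ^ 2) := by push_cast; field_simp; ring
    refine (Finset.sum_le_sum this).trans (le_of_eq ?_)
    rw [Finset.sum_const, Nat.card_Icc, nsmul_eq_mul, Nat.add_sub_cancel]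
    ring
  have hB : ∑ y ∈ t, ∑ s ∈ Θ, g y s ≤ 4 * P * (T * N) := by
    rw [Finset.sum_comm]
    have h1 : ∀ s ∈ Θ, ∑ y ∈ t, g y s ≤ 2 * N / (s.1 : ℝ) ^ 3 := by
      intro s _
      simp only [hg]
      rw [Finset.sum_ite_eq']
      split_ifs
      · exact le_rfl
      · positivity
    refine (Finset.sum_le_sum h1).trans ?_
    rw [hΘ, Finset.sum_filter, Finset.sum_product]
    have : ∀ y ∈ Finset.Icc 1 Q, (∑ b ∈ Finset.Icc 1 (P * T * Q),
        if b ≤ P * T * y then 2 * N / (y : ℝ) ^ 3 else 0)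
        ≤ 2 * P * (T * N) * (1 / (y : ℝ) ^ 2) := by
      intro y hy
      have hy0 : (0 : ℝ) < y := by exact_mod_cast (Finset.mem_Icc.1 hy).1
      rw [← Finset.sum_filter, Finset.sum_const, nsmul_eq_mul]
      have hc : ((Finset.Icc 1 (P * T * Q)).filter (· ≤ P * T * y)).card ≤ P * T * y := by
        refine (Finset.card_le_card (t := Finset.Icc 1 (P * T * y)) ?_).trans (by simp)
        intro b hb
        simp only [Finset.mem_filter, Finset.mem_Icc] at hb ⊢
        exact ⟨hb.1.1, hb.2⟩
      calc _ ≤ ((P * T * y : ℕ) : ℝ) * (2 * N / (y : ℝ) ^ 3) := by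
            gcongr
        _ = _ := by push_cast; field_simp
    refine (Finset.sum_le_sum this).trans ?_
    rw [← Finset.mul_sum]
    have := sum_inv_sq_le Q
    have h0 : 0 ≤ 2 * P * (T * N : ℝ) := by positivity
    nlinarith
  have h0 : 0 ≤ Q * (T : ℝ) ^ (d + 1) * Δ ^ 2 := by positivity
  have h1 : (0 : ℝ) ≤ T * N := by positivity
  have h2 : C * P * (Q * T ^ (d + 1) * Δ ^ 2) ≤ C * (4 * P) * (Q * T ^ (d + 1) * Δ ^ 2) := by
    gcongr
    linarith
  have h3 : 4 * P * (T * N : ℝ) ≤ C * (4 * P) * (T * N) := by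
    have : 0 ≤ 4 * P * (T * N : ℝ) := by positivity
    nlinarith
  linarith

lemma card_le_mul_image {α β : Type*} [DecidableEq β] (s : Finset α) (g : α → β) {B : ℝ}
    (h : ∀ b ∈ s.image g, ((s.filter fun x => g x = b).card : ℝ) ≤ B) :
    (s.card : ℝ) ≤ B * (s.image g).card := by
  rw [Finset.card_eq_sum_card_fiberwise (fun x hx => Finset.mem_image_of_mem g hx)]
  push_cast
  refine (Finset.sum_le_sum h).trans (le_of_eq ?_)
  rw [Finset.sum_const, nsmul_eq_mul, mul_comm]

lemma card_int_le_of_pairwise (S : Finset ℤ) {v : ℝ} (hv : 0 ≤ v) {q : ℕ} (hq : 0 < q)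
    (h : ∀ i ∈ S, ∀ j ∈ S, (i : ℝ) - j ≤ v) (hmod : ∀ i ∈ S, ∀ j ∈ S, (q : ℤ) ∣ i - j) :
    (S.card : ℝ) ≤ v / q + 1 := by
  rcases S.eq_empty_or_nonempty with rfl | hne
  · simp; positivity
  refine card_int_dvd_le (x := S.min' hne) S hv hq (fun i hi => ⟨?_, ?_⟩) hmod
  · exact_mod_cast S.min'_le i hi
  · have := h i hi _ (S.min'_mem hne)
    linarith

lemma card_common_hits_le {I Fn Fj ηn ηj v x m : ℝ} (hI : 0 < I) (hFn : 0 < Fn) (hFj : 0 < Fj)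
    (hηn : 0 ≤ ηn) (hηj : 0 ≤ ηj) (hv : 0 ≤ v) (hm0 : 0 ≤ m) {p q : ℕ} (hq : 0 < q)
    (hpq : p.Coprime q) (hτ : q * ηj + p * ηn ≤ 1 / 2)
    (hm : v ≤ m ∨ (0 < |q * Fj - p * Fn| ∧ 2 * (q * ηj + p * ηn) ≤ m * |q * Fj - p * Fn|))
    (Y : Finset ℤ) (hY : ∀ w ∈ Y, x ≤ w / I ∧ w / I ≤ x + v)
    (hn : ∀ w ∈ Y, dist1 (w / I * Fn) ≤ ηn) (hj : ∀ w ∈ Y, dist1 (w / I * Fj) ≤ ηj) :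
    (Y.card : ℝ) ≤ (2 * ηj * I / Fj + 1) * ((m * Fn + 2 * ηn) / q + 1)
      * (v * |q * Fj - p * Fn| + 2) := by
  classical
  set D := q * Fj - p * Fn with hD
  set τ := q * ηj + p * ηn with hτdef
  have hτ0 : 0 ≤ τ := by positivity
  set a : ℤ → ℤ := fun w => round (w / I * Fn) with ha
  set b : ℤ → ℤ := fun w => round (w / I * Fj) with hb
  set r : ℤ → ℤ := fun w => q * b w - p * a w with hr
  have hqr : (0 : ℝ) < q := by exact_mod_cast hq
  have hnear : ∀ w ∈ Y, |w / I * D - r w| ≤ τ := by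
    intro w hw
    have h1 := hn w hw
    have h2 := hj w hw
    unfold dist1 at h1 h2
    have e : w / I * D - r w = q * (w / I * Fj - b w) - p * (w / I * Fn - a w) := by
      simp only [hr]; push_cast; rw [hD]; ring
    rw [e]
    refine (abs_sub _ _).trans (add_le_add ?_ ?_)
    · rw [abs_mul, Nat.abs_cast]; gcongr
    · rw [abs_mul, Nat.abs_cast]; gcongr
  have hrimage : ((Y.image r).card : ℝ) ≤ v * |D| + 2 := by
    have h1 : ((Y.image r).card : ℝ) ≤ (v * |D| + 2 * τ) / (1 : ℕ) + 1 := by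
      refine card_int_le_of_pairwise _ (by positivity) one_pos ?_ (fun _ _ _ _ => by simp)
      intro i hi j hj
      obtain ⟨w, hw, rfl⟩ := Finset.mem_image.1 hi
      obtain ⟨w', hw', rfl⟩ := Finset.mem_image.1 hj
      have h1 := abs_le.1 (hnear w hw)
      have h2 := abs_le.1 (hnear w' hw')
      have h3 : (w / I - w' / I) * D ≤ v * |D| := by
        refine (le_abs_self _).trans ?_
        rw [abs_mul]
        gcongr
        have := hY w hw
        have := hY w' hw'
        rw [abs_le]; constructor <;> linarith
      nlinarith
    rw [Nat.cast_one, div_one] at h1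
    linarith
  have hinner : ∀ ρ α : ℤ, ((((Y.filter fun w => r w = ρ).filter fun w => a w = α).card : ℕ) : ℝ)
      ≤ 2 * ηj * I / Fj + 1 := by
    intro ρ α
    have := card_int_le_of_pairwise ((Y.filter fun w => r w = ρ).filter fun w => a w = α)
      (v := 2 * ηj * I / Fj) (by positivity) one_pos ?_ (fun _ _ _ _ => by simp)
    · simpa using this
    intro w hw w' hw'
    simp only [Finset.mem_filter] at hw hw'
    have hbb : b w = b w' := by
      have h1 := hw.1.2.trans hw'.1.2.symm
      simp only [hr] at h1
      rw [hw.2, hw'.2] at h1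
      have h2 : (q : ℤ) * b w = q * b w' := by linarith
      exact mul_left_cancel₀ (by exact_mod_cast hq.ne') h2
    have h1 := hj w hw.1.1
    have h2 := hj w' hw'.1.1
    unfold dist1 at h1 h2
    simp only [hb] at hbb
    rw [hbb] at h1
    have h1 := (abs_le.1 h1).2
    have h2 := (abs_le.1 h2).1
    rw [le_div_iff₀ hFj]
    have h3 : w / I * Fj - w' / I * Fj ≤ 2 * ηj := by linarith
    have e : (w / I * Fj - w' / I * Fj) * I = (w - w') * Fj := by field_simp
    rw [← e]
    nlinarith
  have hmid : ∀ ρ ∈ Y.image r, (((Y.filter fun w => r w = ρ).card : ℕ) : ℝ)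
      ≤ (2 * ηj * I / Fj + 1) * ((m * Fn + 2 * ηn) / q + 1) := by
    intro ρ _
    refine (card_le_mul_image _ a (fun α _ => hinner ρ α)).trans ?_
    refine mul_le_mul_of_nonneg_left ?_ (by positivity)
    refine card_int_le_of_pairwise _ (by positivity) hq ?_ ?_
    · intro i hi j hj
      obtain ⟨w, hw, rfl⟩ := Finset.mem_image.1 hi
      obtain ⟨w', hw', rfl⟩ := Finset.mem_image.1 hj
      obtain ⟨hw, hwr⟩ := Finset.mem_filter.1 hw
      obtain ⟨hw', hwr'⟩ := Finset.mem_filter.1 hw'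
      have hlen : w / I - w' / I ≤ m := by
        rcases hm with hm | ⟨hD0, hm⟩
        · linarith [hY w hw, hY w' hw']
        · have h1 := hnear w hw
          have h2 := hnear w' hw'
          rw [hwr] at h1
          rw [hwr'] at h2
          have h3 : |(w / I - w' / I) * D| ≤ m * |D| := by
            have e : (w / I - w' / I) * D = (w / I * D - ρ) - (w' / I * D - ρ) := by ring
            rw [e]
            refine (abs_sub _ _).trans (by linarith)
          rw [abs_mul] at h3
          exact (le_abs_self _).trans (le_of_mul_le_mul_right h3 hD0)
      have h1 := hn w hw
      have h2 := hn w' hw'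
      unfold dist1 at h1 h2
      have h1 := (abs_le.1 h1).1
      have h2 := (abs_le.1 h2).2
      have h3 : (w / I - w' / I) * Fn ≤ m * Fn := by gcongr
      simp only [ha]
      linarith
    · intro i hi j hj
      obtain ⟨w, hw, rfl⟩ := Finset.mem_image.1 hi
      obtain ⟨w', hw', rfl⟩ := Finset.mem_image.1 hj
      have h1 := ((Finset.mem_filter.1 hw).2).trans (Finset.mem_filter.1 hw').2.symm
      simp only [hr] at h1
      have h2 : IsCoprime (q : ℤ) (p : ℤ) := (Nat.isCoprime_iff_coprime.2 hpq).symm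
      refine h2.dvd_of_dvd_mul_left ⟨b w - b w', by linarith⟩
  refine (card_le_mul_image Y r hmid).trans ?_
  exact mul_le_mul_of_nonneg_left hrimage (by positivity)

lemma exists_approx_ratio {Fn Fj ηn ηj : ℝ} (hFn : 0 < Fn) (hFj : 0 < Fj) (hηn : 0 < ηn)
    (hη : ηj ≤ ηn) (hF : Fn ≤ 4 * Fj) (hη1 : ηn ≤ 1 / 16)
    (hQ : 16 * (Fj / Fn) * ηn ≤ 1) :
    ∃ p q : ℕ, 0 < p ∧ 0 < q ∧ p.Coprime q ∧ q * (16 * (Fj / Fn) * ηn) ≤ 1 ∧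
      |q * Fj - p * Fn| ≤ 16 * Fj * ηn ∧ q * ηj + p * ηn ≤ 1 / 2 ∧
      p * ηn ≤ q * (Fj / Fn) * ηn + ηn := by
  set ξ := Fj / Fn with hξ
  have hξ0 : 0 < ξ := by positivity
  have hξ4 : 1 / 4 ≤ ξ := by rw [hξ, div_le_div_iff₀ (by norm_num) hFn]; linarith
  have hX : 0 < 16 * ξ * ηn := by positivity
  set Q := ⌊1 / (16 * ξ * ηn)⌋₊ with hQdef
  have hQ1 : 0 < Q := Nat.floor_pos.2 (by rw [le_div_iff₀ hX]; linarith)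
  have hQle : (Q : ℝ) * (16 * ξ * ηn) ≤ 1 := by
    rw [← le_div_iff₀ hX]; exact Nat.floor_le (by positivity)
  have hQlt : 1 < (Q + 1 : ℝ) * (16 * ξ * ηn) := by
    rw [← div_lt_iff₀ hX]; exact Nat.lt_floor_add_one _
  obtain ⟨ρ, hρ, hden⟩ := Real.exists_rat_abs_sub_le_and_den_le ξ hQ1
  have hq0 : (0 : ℝ) < ρ.den := by exact_mod_cast ρ.den_pos
  have hq1 : (1 : ℝ) ≤ ρ.den := by exact_mod_cast ρ.den_pos
  have hρeq : (ρ : ℝ) * ρ.den = ρ.num := by exact_mod_cast ρ.mul_den_eq_num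
  have hkey : |ρ.den * ξ - ρ.num| * (Q + 1) ≤ 1 := by
    have e : ρ.den * ξ - ρ.num = (ξ - ρ) * ρ.den := by rw [← hρeq]; ring
    rw [e, abs_mul, abs_of_pos hq0, mul_assoc, mul_comm _ (Q + 1 : ℝ)]
    rwa [le_div_iff₀ (by positivity)] at hρ
  have hnear : |ρ.den * ξ - ρ.num| < 16 * ξ * ηn := by
    rw [← mul_lt_mul_iff_left₀ (by positivity : (0 : ℝ) < Q + 1)]
    linarith
  have hone : |ρ.den * ξ - ρ.num| ≤ 1 := by
    have h0 := abs_nonneg (ρ.den * ξ - ρ.num)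
    nlinarith
  have hnum : 0 < ρ.num := by
    have h1 := (abs_lt.1 hnear).2
    have : (0 : ℝ) < ρ.num := by nlinarith
    exact_mod_cast this
  have hcast : ((ρ.num.natAbs : ℕ) : ℝ) = ρ.num := by
    rw [Nat.cast_natAbs, abs_of_pos hnum]
  have hqQ : (ρ.den : ℝ) * (16 * ξ * ηn) ≤ 1 :=
    le_trans (mul_le_mul_of_nonneg_right (by exact_mod_cast hden) hX.le) hQle
  have hp : (ρ.num : ℝ) * ηn ≤ ρ.den * ξ * ηn + ηn := by
    have h1 := (abs_le.1 hone).1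
    nlinarith
  refine ⟨ρ.num.natAbs, ρ.den, by omega, ρ.den_pos, ρ.reduced, hqQ, ?_, ?_, ?_⟩
  · rw [hcast]
    have e : ρ.den * Fj - ρ.num * Fn = (ρ.den * ξ - ρ.num) * Fn := by
      rw [hξ]; field_simp
    rw [e, abs_mul, abs_of_pos hFn]
    calc _ ≤ 16 * ξ * ηn * Fn := by gcongr
      _ = 16 * Fj * ηn := by rw [hξ]; field_simp
  · rw [hcast]
    have h1 : ρ.den * ηj ≤ 1 / 4 := by
      have : ρ.den * ηj ≤ ρ.den * ηn := by gcongr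
      have h0 : 0 < ρ.den * ηn := by positivity
      nlinarith
    nlinarith
  · rwa [hcast]

lemma card_common_hits_le_of_pos {I Fn Fj ηn ηj v x : ℝ} (hI : 0 < I) (hFn : 0 < Fn)
    (hFj : 0 < Fj) (hηn : 0 < ηn) (hηj : 0 < ηj) (hη : ηj ≤ ηn) (hF : Fn ≤ 4 * Fj)
    (hη1 : ηn ≤ 1 / 16) (hv : 0 ≤ v) {p q : ℕ} (hq : 0 < q)
    (hpq : p.Coprime q) (hτ : q * ηj + p * ηn ≤ 1 / 2) (hD0 : 0 < |q * Fj - p * Fn|)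
    (hDle : |q * Fj - p * Fn| ≤ 16 * Fj * ηn) (hIη : Fj ≤ ηj * I)
    (Y : Finset ℤ) (hY : ∀ w ∈ Y, x ≤ w / I ∧ w / I ≤ x + v)
    (hn : ∀ w ∈ Y, dist1 (w / I * Fn) ≤ ηn) (hj : ∀ w ∈ Y, dist1 (w / I * Fj) ≤ ηj) :
    (Y.card : ℝ) ≤ 126 * (v + 2 / |q * Fj - p * Fn|) * I * ηn * ηj := by
  set D := |q * Fj - p * Fn| with hD
  set τ := q * ηj + p * ηn with hτdef
  have hqr : (1 : ℝ) ≤ q := by exact_mod_cast hq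
  have hτ0 : 0 ≤ τ := by positivity
  refine (card_common_hits_le (m := 2 * τ / D) hI hFn hFj hηn.le hηj.le hv (by positivity) hq hpq hτ
    (Or.inr ⟨hD0, le_of_eq (div_mul_cancel₀ _ hD0.ne').symm⟩) Y hY hn hj).trans ?_
  rw [← hD]
  have h1 : 2 * ηj * I / Fj + 1 ≤ 3 * ηj * I / Fj := by
    have : 1 ≤ ηj * I / Fj := by rwa [le_div_iff₀ hFj, one_mul]
    have e1 : 2 * ηj * I / Fj = 2 * (ηj * I / Fj) := by ring
    have e2 : 3 * ηj * I / Fj = 3 * (ηj * I / Fj) := by ring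
    rw [e1, e2]; linarith
  have h2 : (2 * τ / D * Fn + 2 * ηn) / q + 1 ≤ 42 * Fj * ηn / D := by
    have hpF : p * Fn ≤ q * Fj + D := by
      have := neg_abs_le (q * Fj - p * Fn)
      rw [← hD] at this
      linarith
    have hτF : τ * Fn ≤ q * (5 * Fj * ηn) + D * ηn := by
      have a1 : q * (ηj * Fn) ≤ q * (4 * Fj * ηn) := by
        have : ηj * Fn ≤ ηn * (4 * Fj) := by gcongr
        calc q * (ηj * Fn) ≤ q * (ηn * (4 * Fj)) := mul_le_mul_of_nonneg_left this (by positivity)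
          _ = _ := by ring
      have a2 : p * Fn * ηn ≤ (q * Fj + D) * ηn := by gcongr
      rw [hτdef]
      linarith
    have e : (2 * τ / D * Fn + 2 * ηn) / q + 1 = (2 * (τ * Fn) + 2 * ηn * D + D * q) / (D * q) := by
      field_simp
    rw [e, div_le_div_iff₀ (by positivity) hD0]
    have h3 : 2 * (τ * Fn) + 2 * ηn * D + D * q ≤ 42 * Fj * ηn * q := by
      have b1 : 4 * (D * ηn) ≤ 1 * D := by nlinarith
      have b2 : D ≤ D * q := by nlinarith
      have b3 : D * q ≤ 16 * Fj * ηn * q := by gcongr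
      nlinarith
    calc _ ≤ 42 * Fj * ηn * q * D := by gcongr
      _ = _ := by ring
  calc _ ≤ (3 * ηj * I / Fj) * (42 * Fj * ηn / D) * (v * D + 2) := by gcongr
    _ = _ := by field_simp; ring

lemma card_common_hits_le_of_small {I Fn Fj ηn ηj v x : ℝ} (hI : 0 < I) (hFn : 0 < Fn)
    (hFj : 0 < Fj) (hηn : 0 < ηn) (hηj : 0 < ηj)
    (hη1 : ηn ≤ 1 / 16) (hv : 0 ≤ v) {p q : ℕ} (hq : 0 < q)
    (hpq : p.Coprime q) (hτ : q * ηj + p * ηn ≤ 1 / 2) (hD1 : v * |q * Fj - p * Fn| ≤ 1)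
    (hqv : q ≤ v * Fn) (hIη : Fj ≤ ηj * I)
    (Y : Finset ℤ) (hY : ∀ w ∈ Y, x ≤ w / I ∧ w / I ≤ x + v)
    (hn : ∀ w ∈ Y, dist1 (w / I * Fn) ≤ ηn) (hj : ∀ w ∈ Y, dist1 (w / I * Fj) ≤ ηj) :
    (Y.card : ℝ) ≤ 27 * v * I * (Fn / Fj) * ηj / q := by
  have hqr : (1 : ℝ) ≤ q := by exact_mod_cast hq
  refine (card_common_hits_le (m := v) hI hFn hFj hηn.le hηj.le hv hv hq hpq hτ
    (Or.inl le_rfl) Y hY hn hj).trans ?_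
  have h1 : 2 * ηj * I / Fj + 1 ≤ 3 * ηj * I / Fj := by
    have : 1 ≤ ηj * I / Fj := by rwa [le_div_iff₀ hFj, one_mul]
    have e1 : 2 * ηj * I / Fj = 2 * (ηj * I / Fj) := by ring
    have e2 : 3 * ηj * I / Fj = 3 * (ηj * I / Fj) := by ring
    rw [e1, e2]; linarith
  have h2 : (v * Fn + 2 * ηn) / q + 1 ≤ 3 * v * Fn / q := by
    rw [div_add_one (by positivity)]
    gcongr
    linarith
  calc _ ≤ (3 * ηj * I / Fj) * (3 * v * Fn / q) * 3 := by
        gcongr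
        linarith
    _ = _ := by field_simp; ring

lemma sq_sum_card_le {ι α : Type*} [DecidableEq α] (s : Finset ι)
    (A : ι → Finset α) (U : Finset α) (hA : ∀ i ∈ s, A i ⊆ U) :
    (∑ i ∈ s, ((A i).card : ℝ)) ^ 2 ≤ U.card * ∑ i ∈ s, ∑ j ∈ s, ((A i ∩ A j).card : ℝ) := by
  have e1 : ∑ i ∈ s, ((A i).card : ℝ) = ∑ w ∈ U, ((s.filter fun i => w ∈ A i).card : ℝ) := by
    have h := Finset.sum_card_bipartiteAbove_eq_sum_card_bipartiteBelow (s := s) (t := U)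
      (fun i w => w ∈ A i)
    simp only [Finset.bipartiteAbove, Finset.bipartiteBelow] at h
    rw [← Nat.cast_sum, ← Nat.cast_sum, ← h]
    congr 1
    refine Finset.sum_congr rfl fun i hi => ?_
    rw [Finset.filter_mem_eq_inter, Finset.inter_eq_right.2 (hA i hi)]
  have e2 : ∑ i ∈ s, ∑ j ∈ s, ((A i ∩ A j).card : ℝ)
      = ∑ w ∈ U, ((s.filter fun i => w ∈ A i).card : ℝ) ^ 2 := by
    have h := Finset.sum_card_bipartiteAbove_eq_sum_card_bipartiteBelow (s := s ×ˢ s) (t := U)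
      (fun x w => w ∈ A x.1 ∩ A x.2)
    simp only [Finset.bipartiteAbove, Finset.bipartiteBelow] at h
    rw [← Finset.sum_product' s s (fun i j => ((A i ∩ A j).card : ℝ))]
    have h' : ∑ x ∈ s ×ˢ s, (A x.1 ∩ A x.2).card
        = ∑ w ∈ U, ((s.filter fun i => w ∈ A i).card) ^ 2 := by
      refine Eq.trans (Finset.sum_congr rfl fun x hx => ?_) (h.trans
        (Finset.sum_congr rfl fun w _ => ?_))
      · rw [Finset.filter_mem_eq_inter]
        exact congrArg _ (Finset.inter_eq_right.2
          (Finset.inter_subset_left.trans (hA _ (Finset.mem_product.1 hx).1))).symm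
      · rw [sq, ← Finset.card_product]
        congr 1
        ext x
        simp only [Finset.mem_filter, Finset.mem_product, Finset.mem_inter]
        tauto
    exact_mod_cast h'
  rw [e1, e2]
  exact sq_sum_le_card_mul_sum_sq

lemma le_of_sq_le_mul {c C W M U : ℝ} (hc : 0 < c) (hC : 0 ≤ C) (hW : 0 ≤ W) (hU : 0 ≤ U)
    (hM : c * W ≤ M) (h : M ^ 2 ≤ U * (M + 2 * (C * W))) : c ^ 2 / (c + 2 * C) * W ≤ U := by
  rw [div_mul_eq_mul_div, div_le_iff₀ (by positivity)]
  rcases hW.eq_or_lt with h0 | hW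
  · rw [← h0, mul_zero]
    positivity
  have hM0 : 0 < M := lt_of_lt_of_le (by positivity) hM
  have h0 : 0 ≤ C * W := by positivity
  have h4 : 0 ≤ C * W * (M - c * W) := mul_nonneg h0 (by linarith)
  have h7 : 0 < M + 2 * (C * W) := by positivity
  have h6 : M * (c * W) ≤ U * (c * W + 2 * (C * W)) := by
    refine le_of_mul_le_mul_right ?_ h7
    calc M * (c * W) * (M + 2 * (C * W)) ≤ M ^ 2 * (c * W + 2 * (C * W)) := by nlinarith
      _ ≤ U * (M + 2 * (C * W)) * (c * W + 2 * (C * W)) := by gcongr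
      _ = _ := by ring
  have h8 : c * W * (c * W) ≤ U * (c * W + 2 * (C * W)) :=
    (mul_le_mul_of_nonneg_right hM (by positivity)).trans h6
  refine le_of_mul_le_mul_right ?_ hW
  calc c ^ 2 * W * W = c * W * (c * W) := by ring
    _ ≤ _ := h8
    _ = _ := by ring

/-- A second moment bound for the size of a union. -/
lemma le_card_of_sum_inter_le {ι α : Type*} [LinearOrder ι] [DecidableEq α]
    (s : Finset ι) (A : ι → Finset α) (U : Finset α) (hA : ∀ i ∈ s, A i ⊆ U) {c C W : ℝ}
    (hc : 0 < c) (hC : 0 ≤ C) (hW : 0 ≤ W) (hlow : c * W ≤ ∑ i ∈ s, ((A i).card : ℝ))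
    (hup : ∑ x ∈ (s ×ˢ s).filter (fun x => x.1 < x.2), ((A x.1 ∩ A x.2).card : ℝ) ≤ C * W) :
    c ^ 2 / (c + 2 * C) * W ≤ U.card := by
  set M := ∑ i ∈ s, ((A i).card : ℝ) with hM
  have h := sq_sum_card_le s A U hA
  have hs : ∑ i ∈ s, ∑ j ∈ s, ((A i ∩ A j).card : ℝ) ≤ M + 2 * (C * W) := by
    rw [← Finset.sum_product' s s (fun i j => ((A i ∩ A j).card : ℝ)),
      ← Finset.sum_filter_add_sum_filter_not (s ×ˢ s) (fun x => x.1 < x.2),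
      ← Finset.sum_filter_add_sum_filter_not ((s ×ˢ s).filter fun x => ¬ x.1 < x.2)
        (fun x => x.1 = x.2), Finset.filter_filter, Finset.filter_filter]
    have h1 : ∑ x ∈ (s ×ˢ s).filter (fun x => ¬ x.1 < x.2 ∧ x.1 = x.2),
        ((A x.1 ∩ A x.2).card : ℝ) = M := by
      symm
      refine Finset.sum_bij (fun i _ => (i, i)) ?_ ?_ ?_ ?_
      · intro i hi; simp [hi]
      · intro i _ j _ hij; simpa using hij
      · rintro ⟨i, j⟩ hx
        simp only [Finset.mem_filter, Finset.mem_product] at hx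
        obtain ⟨⟨hi, _⟩, _, rfl⟩ := hx
        exact ⟨i, hi, rfl⟩
      · intro i _; simp
    have h2 : ∑ x ∈ (s ×ˢ s).filter (fun x => ¬ x.1 < x.2 ∧ ¬ x.1 = x.2),
        ((A x.1 ∩ A x.2).card : ℝ)
        = ∑ x ∈ (s ×ˢ s).filter (fun x => x.1 < x.2), ((A x.1 ∩ A x.2).card : ℝ) := by
      refine Finset.sum_bij (fun x _ => (x.2, x.1)) ?_ ?_ ?_ ?_
      · rintro ⟨i, j⟩ hx
        simp only [Finset.mem_filter, Finset.mem_product] at hx ⊢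
        exact ⟨hx.1.symm, lt_of_le_of_ne (not_lt.1 hx.2.1) (Ne.symm hx.2.2)⟩
      · rintro ⟨i, j⟩ _ ⟨k, l⟩ _ hx
        simp only [Prod.mk.injEq] at hx ⊢
        exact hx.symm
      · rintro ⟨i, j⟩ hx
        simp only [Finset.mem_filter, Finset.mem_product] at hx
        refine ⟨(j, i), ?_, rfl⟩
        simp only [Finset.mem_filter, Finset.mem_product]
        exact ⟨hx.1.symm, hx.2.not_gt, hx.2.ne'⟩
      · rintro ⟨i, j⟩ _
        rw [Finset.inter_comm]
    rw [h1, h2]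
    linarith
  exact le_of_sq_le_mul hc hC hW (Nat.cast_nonneg _) hlow
    (h.trans (mul_le_mul_of_nonneg_left hs (Nat.cast_nonneg _)))

lemma HalfTree.mono {d k L l : ℕ} {z : ℤ} {T : ℕ → Finset ℤ} (h : HalfTree d k L z T)
    (hl : l ≤ L) : HalfTree d k l z T :=
  ⟨h.root, fun m h1 h2 => h.parent m h1 (h2.trans_le hl),
    fun m h1 h2 => h.half m h1 (h2.trans_le hl)⟩

lemma HalfTree.card_succ {d k L : ℕ} {z : ℤ} {T : ℕ → Finset ℤ} (h : HalfTree d k L z T) {l : ℕ}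
    (hk : k ≤ l) (hl : l < L) : 2 * (T (l + 1)).card = (T l).card * ratio d l := by
  classical
  have e : (T (l + 1)).card = ∑ y ∈ T l, (T (l + 1) ∩ descendants d l (l + 1) y).card := by
    rw [Finset.card_eq_sum_card_fiberwise (f := fun x => x / (desc d l (l + 1) : ℤ)) (t := T l)]
    · refine Finset.sum_congr rfl fun y _ => ?_
      congr 1
      ext x
      rw [Finset.mem_filter, Finset.mem_inter, mem_descendants (by omega)]
    · intro x hx
      obtain ⟨y, hy, hxy⟩ := h.parent l hk hl x hx
      rw [mem_descendants (by omega)] at hxy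
      simp only [hxy]
      exact hy
  rw [e, Finset.mul_sum, Finset.sum_congr rfl fun y hy => h.half l hk hl y hy]
  simp

lemma HalfTree.card_mul_desc {d k L : ℕ} {z : ℤ} {T : ℕ → Finset ℤ} (h : HalfTree d k L z T)
    {l j : ℕ} (hk : k ≤ l) (hl : l ≤ L) (hj : L ≤ j) :
    (T l).card * desc d l j = 2 ^ (L - l) * ((T L).card * desc d L j) := by
  induction L, hl using Nat.le_induction with
  | base => simp
  | succ L hl ih =>
    rw [ih (h.mono (by omega)) (by omega), ← desc_mul d (show L ≤ L + 1 by omega) hj, desc_succ,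
      Nat.succ_sub hl, pow_succ, ← mul_assoc (T L).card, ← h.card_succ (by omega) (by omega)]
    ring

/-- Summing a bound over the cells of one level of a tree. -/
lemma HalfTree.card_filter_le {d k L : ℕ} {z : ℤ} {T : ℕ → Finset ℤ} (h : HalfTree d k L z T)
    {l j : ℕ} (hk : k ≤ l) (hl : l ≤ L) (hj : L ≤ j) (Y : Finset ℤ)
    (hY : ∀ w ∈ Y, ∃ y ∈ T L, w ∈ descendants d L j y) {B : ℝ}
    (hB : ∀ y ∈ T l, ∀ Y' ⊆ Y, Y' ⊆ descendants d l j y → (Y'.card : ℝ) ≤ B) :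
    (Y.card : ℝ) ≤ (T l).card * B := by
  classical
  have hsub : Y ⊆ (T l).biUnion fun y => Y ∩ descendants d l j y := by
    intro w hw
    obtain ⟨y, hy, hwy⟩ := hY w hw
    obtain ⟨x, hx, hxy⟩ := h.ancestor hk hl le_rfl y hy
    rw [Finset.mem_biUnion]
    exact ⟨x, hx, Finset.mem_inter.2 ⟨hw, mem_descendants_trans hl hj hxy hwy⟩⟩
  calc (Y.card : ℝ) ≤ ((T l).biUnion fun y => Y ∩ descendants d l j y).card := by
        exact_mod_cast Finset.card_le_card hsub
    _ ≤ ∑ y ∈ T l, ((Y ∩ descendants d l j y).card : ℝ) := by exact_mod_cast Finset.card_biUnion_le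
    _ ≤ ∑ y ∈ T l, B := Finset.sum_le_sum fun y hy =>
        hB y hy _ Finset.inter_subset_left Finset.inter_subset_right
    _ = _ := by simp

section

/-- The integers `w` with `|w / I * F - a| ≤ η`. -/
noncomputable def nearInts (I F η : ℝ) (a : ℤ) : Finset ℤ :=
  Finset.Icc ⌈(a - η) * I / F⌉ ⌊(a + η) * I / F⌋

lemma mem_nearInts {I F η : ℝ} (hI : 0 < I) (hF : 0 < F) {a w : ℤ} :
    w ∈ nearInts I F η a ↔ |w / I * F - a| ≤ η := by
  rw [nearInts, Finset.mem_Icc, Int.ceil_le, Int.le_floor, abs_le, div_le_iff₀ hF, le_div_iff₀ hF,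
    show (w : ℝ) / I * F - a = (w * F - a * I) / I by field_simp, le_div_iff₀ hI, div_le_iff₀ hI]
  constructor <;> rintro ⟨h1, h2⟩ <;> constructor <;> linarith

lemma dist1_le_of_mem_nearInts {I F η : ℝ} (hI : 0 < I) (hF : 0 < F) {a w : ℤ}
    (h : w ∈ nearInts I F η a) : dist1 (w / I * F) ≤ η :=
  (dist1_le _ a).trans ((mem_nearInts hI hF).1 h)

lemma le_card_nearInts {I F η : ℝ} (h : F ≤ η * I) (hF : 0 < F) (a : ℤ) :
    η * I / F ≤ (nearInts I F η a).card := by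
  have h1 : 1 ≤ η * I / F := by rwa [le_div_iff₀ hF, one_mul]
  have h2 := Int.ceil_lt_add_one ((a - η) * I / F)
  have h3 := Int.lt_floor_add_one ((a + η) * I / F)
  have e1 : (a - η) * I / F = a * I / F - η * I / F := by ring
  have e2 : (a + η) * I / F = a * I / F + η * I / F := by ring
  rw [nearInts, Int.card_Icc]
  have h4 : ((⌊(a + η) * I / F⌋ + 1 - ⌈(a - η) * I / F⌉ : ℤ) : ℝ)
      ≤ ((⌊(a + η) * I / F⌋ + 1 - ⌈(a - η) * I / F⌉).toNat : ℝ) := by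
    exact_mod_cast Int.self_le_toNat _
  refine le_trans ?_ h4
  push_cast
  linarith

lemma disjoint_nearInts {I F η : ℝ} (hI : 0 < I) (hF : 0 < F) (hη : η < 1 / 2) {a b : ℤ}
    (hab : a ≠ b) : Disjoint (nearInts I F η a) (nearInts I F η b) := by
  rw [Finset.disjoint_left]
  intro w h1 h2
  rw [mem_nearInts hI hF] at h1 h2
  apply hab
  have h3 : |(a : ℝ) - b| < 1 := by
    rw [abs_lt]
    rw [abs_le] at h1 h2
    constructor <;> linarith
  have h4 : |a - b| < 1 := by exact_mod_cast h3
  have := Int.abs_lt_one_iff.1 h4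
  omega

/-- The integers `a` such that every point of `nearInts I F η a` lies below the cell `y`. -/
noncomputable def innerInts (d L : ℕ) (F η : ℝ) (y : ℤ) : Finset ℤ :=
  Finset.Ico ⌈y * F / scale d L + η⌉ ⌈(y + 1) * F / scale d L - η⌉

lemma nearInts_subset_descendants {d L j : ℕ} (hLj : L ≤ j) {F η : ℝ} (hF : 0 < F) {y a : ℤ}
    (ha : a ∈ innerInts d L F η y) : nearInts (scale d j) F η a ⊆ descendants d L j y := by
  intro w hw
  have hL := scale_pos' d L
  have hj := scale_pos' d j
  rw [innerInts, Finset.mem_Ico, Int.ceil_le, Int.lt_ceil] at ha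
  rw [mem_nearInts hj hF, abs_le] at hw
  have e : (scale d j : ℝ) = scale d L * desc d L j := by exact_mod_cast (scale_mul_desc d hLj).symm
  have hP : (0 : ℝ) < desc d L j := by exact_mod_cast desc_pos d hLj
  have e2 : (w : ℝ) / scale d j * F = w * F / (desc d L j) / scale d L := by rw [e]; field_simp
  have h1 : (y : ℝ) * F / scale d L ≤ w * F / (desc d L j) / scale d L := by linarith
  have h2 : w * F / (desc d L j) / scale d L < (y + 1) * F / scale d L := by linarith
  rw [div_le_div_iff_of_pos_right hL, le_div_iff₀ hP] at h1
  rw [div_lt_div_iff_of_pos_right hL, div_lt_iff₀ hP] at h2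
  have h3 : (y : ℝ) * desc d L j ≤ w := le_of_mul_le_mul_right (by linarith) hF
  have h4 : (w : ℝ) < (y + 1) * desc d L j := lt_of_mul_lt_mul_right (by linarith) hF.le
  rw [descendants, Finset.mem_Ico]
  exact ⟨by exact_mod_cast h3, by exact_mod_cast h4⟩

lemma le_card_innerInts {d L : ℕ} {F η : ℝ} (hF : 4 * scale d L ≤ F) (hη : η ≤ 1 / 2) (y : ℤ) :
    F / (2 * scale d L) ≤ (innerInts d L F η y).card := by
  have hL := scale_pos' d L
  have h1 : 4 ≤ F / scale d L := by rwa [le_div_iff₀ hL]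
  have h2 := Int.ceil_lt_add_one (y * F / scale d L + η)
  have h3 := Int.le_ceil ((y + 1) * F / scale d L - η)
  have e1 : (y + 1) * F / scale d L = y * F / scale d L + F / scale d L := by ring
  have e2 : F / (2 * scale d L) = F / scale d L / 2 := by field_simp
  rw [innerInts, Int.card_Ico]
  have h4 : ((⌈(y + 1) * F / scale d L - η⌉ - ⌈y * F / scale d L + η⌉ : ℤ) : ℝ)
      ≤ ((⌈(y + 1) * F / scale d L - η⌉ - ⌈y * F / scale d L + η⌉).toNat : ℝ) := by
    exact_mod_cast Int.self_le_toNat _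
  refine le_trans ?_ h4
  push_cast
  linarith

/-- The cells below `s` hit by `n`. -/
noncomputable def hitSet (F : ℕ → ℝ) (d L : ℕ) (s : Finset ℤ) (n : ℕ) : Finset ℤ :=
  open Classical in
  (s.biUnion (descendants d L (L + 3))).filter fun w =>
    dist1 ((w : ℝ) / scale d (L + 3) * F n) ≤ tol n

lemma mem_hitSet {F : ℕ → ℝ} {d L : ℕ} {s : Finset ℤ} {n : ℕ} {w : ℤ} : w ∈ hitSet F d L s n ↔
    (∃ y ∈ s, w ∈ descendants d L (L + 3) y) ∧
      dist1 ((w : ℝ) / scale d (L + 3) * F n) ≤ tol n := by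
  simp [hitSet]

lemma hitSet_subset {F : ℕ → ℝ} {d L : ℕ} {s : Finset ℤ} {n : ℕ}
    (hn : n ∈ Finset.Ioc (cutoff L) (cutoff (L + 3))) : hitSet F d L s n ⊆ hitCells F d L s := by
  intro w hw
  rw [mem_hitSet] at hw
  exact mem_hitCells.2 ⟨hw.1, n, hn, hw.2⟩

lemma le_card_hitSet {F : ℕ → ℝ} {d L : ℕ} {s : Finset ℤ} {n : ℕ} (hF : 4 * scale d L ≤ F n)
    (hη : tol n < 1 / 2) (hI : F n ≤ tol n * scale d (L + 3)) :
    tol n / 2 * (s.card * desc d L (L + 3)) ≤ (hitSet F d L s n).card := by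
  classical
  have hL := scale_pos' d L
  have hj := scale_pos' d (L + 3)
  have hF0 : 0 < F n := lt_of_lt_of_le (by positivity) hF
  have hη0 : 0 < tol n := by
    by_contra h
    nlinarith
  have hone : ∀ y, tol n / 2 * desc d L (L + 3)
      ≤ ((hitSet F d L s n ∩ descendants d L (L + 3) y).card : ℝ) ∨ y ∉ s := by
    intro y
    by_cases hy : y ∈ s
    swap; · exact Or.inr hy
    left
    have hsub : (innerInts d L (F n) (tol n) y).biUnion (nearInts (scale d (L + 3)) (F n) (tol n))
        ⊆ hitSet F d L s n ∩ descendants d L (L + 3) y := by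
      intro w hw
      rw [Finset.mem_biUnion] at hw
      obtain ⟨a, ha, hw⟩ := hw
      have h1 := nearInts_subset_descendants (by omega) hF0 ha hw
      exact Finset.mem_inter.2 ⟨mem_hitSet.2 ⟨⟨y, hy, h1⟩, dist1_le_of_mem_nearInts hj hF0 hw⟩, h1⟩
    have hcard := Finset.card_le_card hsub
    rw [Finset.card_biUnion fun a _ b _ hab => disjoint_nearInts hj hF0 hη hab] at hcard
    have hcard' : (∑ a ∈ innerInts d L (F n) (tol n) y,
        ((nearInts (scale d (L + 3)) (F n) (tol n) a).card : ℝ))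
        ≤ ((hitSet F d L s n ∩ descendants d L (L + 3) y).card : ℝ) := by exact_mod_cast hcard
    refine le_trans ?_ hcard'
    calc tol n / 2 * desc d L (L + 3)
        = F n / (2 * scale d L) * (tol n * scale d (L + 3) / F n) := by
          rw [desc_cast d (by omega)]; field_simp
      _ ≤ (innerInts d L (F n) (tol n) y).card * (tol n * scale d (L + 3) / F n) := by
          gcongr; exact le_card_innerInts hF hη.le y
      _ = ∑ a ∈ innerInts d L (F n) (tol n) y, tol n * scale d (L + 3) / F n := by simp
      _ ≤ _ := Finset.sum_le_sum fun a _ => le_card_nearInts hI hF0 a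
  have hdis : (s.biUnion fun y => hitSet F d L s n ∩ descendants d L (L + 3) y).card
      = ∑ y ∈ s, (hitSet F d L s n ∩ descendants d L (L + 3) y).card := by
    refine Finset.card_biUnion fun y _ z _ hyz => ?_
    rw [Function.onFun, Finset.disjoint_left]
    intro w h1 h2
    have h1 := (mem_descendants (by omega)).1 (Finset.mem_inter.1 h1).2
    have h2 := (mem_descendants (by omega)).1 (Finset.mem_inter.1 h2).2
    exact hyz (h1.symm.trans h2)
  calc tol n / 2 * (s.card * desc d L (L + 3)) = ∑ y ∈ s, tol n / 2 * desc d L (L + 3) := by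
        rw [Finset.sum_const, nsmul_eq_mul]; ring
    _ ≤ ∑ y ∈ s, ((hitSet F d L s n ∩ descendants d L (L + 3) y).card : ℝ) :=
        Finset.sum_le_sum fun y hy => (hone y).resolve_right (not_not.2 hy)
    _ = ((s.biUnion fun y => hitSet F d L s n ∩ descendants d L (L + 3) y).card : ℝ) := by
        exact_mod_cast hdis.symm
    _ ≤ _ := by
        exact_mod_cast Finset.card_le_card
          (Finset.biUnion_subset.2 fun y _ => Finset.inter_subset_left)

variable {d k L : ℕ} {z : ℤ} {T : ℕ → Finset ℤ} {F : ℕ → ℝ} {n j p q : ℕ}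

lemma card_inter_hitSet_le (h : HalfTree d k L z T) {l : ℕ} (hk : k ≤ l) (hl : l ≤ L) {B : ℝ}
    (hB : ∀ (x : ℝ) (Y : Finset ℤ), (∀ w ∈ Y, x ≤ w / scale d (L + 3) ∧
      w / scale d (L + 3) ≤ x + 1 / (scale d l : ℝ)) →
      (∀ w ∈ Y, dist1 ((w : ℝ) / scale d (L + 3) * F n) ≤ tol n) →
      (∀ w ∈ Y, dist1 ((w : ℝ) / scale d (L + 3) * F j) ≤ tol j) → (Y.card : ℝ) ≤ B) :
    ((hitSet F d L (T L) n ∩ hitSet F d L (T L) j).card : ℝ) ≤ (T l).card * B := by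
  refine h.card_filter_le hk hl (by omega) _
    (fun w hw => (mem_hitSet.1 (Finset.mem_inter.1 hw).1).1) (j := L + 3) fun y _ Y hY hYd => ?_
  refine hB (y / scale d l) Y (fun w hw => ?_) (fun w hw => ?_) fun w hw => ?_
  · obtain ⟨h1, h2⟩ := mem_descendants_cast (by omega) (hYd hw)
    refine ⟨h1, ?_⟩
    rw [← add_div]
    refine le_trans ?_ h2
    gcongr
    linarith
  · exact (mem_hitSet.1 (Finset.mem_inter.1 (hY hw)).1).2
  · exact (mem_hitSet.1 (Finset.mem_inter.1 (hY hw)).2).2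

lemma HalfTree.card_mul_scale (h : HalfTree d k L z T) {l : ℕ} (hk : k ≤ l) (hl : l ≤ L) :
    ((T l).card : ℝ) * ((scale d (L + 3) : ℝ) / scale d l)
      = 2 ^ (L - l) * ((T L).card * desc d L (L + 3)) := by
  rw [← desc_cast d (by omega)]
  exact_mod_cast h.card_mul_desc hk hl (by omega)

lemma card_inter_hitSet_le_of_pos (h : HalfTree d k L z T) {l : ℕ} (hk : k ≤ l) (hl : l ≤ L)
    (hFn : 0 < F n) (hFj : 0 < F j) (hηn : 0 < tol n) (hηj : 0 < tol j) (hη : tol j ≤ tol n)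
    (hF : F n ≤ 4 * F j) (hη1 : tol n ≤ 1 / 16) (hq : 0 < q) (hpq : p.Coprime q)
    (hτ : q * tol j + p * tol n ≤ 1 / 2) (hDle : |q * F j - p * F n| ≤ 16 * F j * tol n)
    (hIη : F j ≤ tol j * scale d (L + 3)) {δ : ℝ} (hδ : 0 < δ) (hD0 : δ ≤ |q * F j - p * F n|) :
    ((hitSet F d L (T L) n ∩ hitSet F d L (T L) j).card : ℝ)
      ≤ 126 * (1 + 2 * scale d l / δ) * 2 ^ (L - l)
        * ((T L).card * desc d L (L + 3)) * (tol n * tol j) := by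
  have hl0 := scale_pos' d l
  have hj0 := scale_pos' d (L + 3)
  refine (card_inter_hitSet_le h hk hl fun x Y hY hn hj => card_common_hits_le_of_pos hj0 hFn hFj
    hηn hηj hη hF hη1 (by positivity) hq hpq hτ (hδ.trans_le hD0) hDle hIη Y hY hn hj).trans ?_
  calc _ ≤ ((T l).card : ℝ) * (126 * (1 / scale d l + 2 / δ) * scale d (L + 3)
          * tol n * tol j) := by
        gcongr
    _ = 126 * (1 + 2 * scale d l / δ) * ((T l).card * ((scale d (L + 3) : ℝ) / scale d l))
        * (tol n * tol j) := by field_simp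
    _ = _ := by rw [h.card_mul_scale hk hl]; ring

lemma card_inter_hitSet_le_of_small (h : HalfTree d k L z T) (hkL : k ≤ L)
    (hFn : 0 < F n) (hFj : 0 < F j) (hηn : 0 < tol n) (hηj : 0 < tol j)
    (hη1 : tol n ≤ 1 / 16) (hq : 0 < q) (hpq : p.Coprime q)
    (hτ : q * tol j + p * tol n ≤ 1 / 2) (hD : |q * F j - p * F n| ≤ 1)
    (hqF : q * scale d L ≤ F n) (hIη : F j ≤ tol j * scale d (L + 3)) :
    ((hitSet F d L (T L) n ∩ hitSet F d L (T L) j).card : ℝ)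
      ≤ 27 * ((T L).card * desc d L (L + 3)) * (F n / F j) * tol j / q := by
  have hl0 := scale_pos' d L
  have hl1 : (1 : ℝ) ≤ scale d L := by exact_mod_cast scale_pos d L
  have hj0 := scale_pos' d (L + 3)
  have hq0 : (0 : ℝ) < q := by exact_mod_cast hq
  refine (card_inter_hitSet_le h hkL le_rfl fun x Y hY hn hj => card_common_hits_le_of_small hj0 hFn
    hFj hηn hηj hη1 (by positivity) hq hpq hτ ?_ ?_ hIη Y hY hn hj).trans ?_
  · rw [one_div_mul_eq_div, div_le_one hl0]
    exact hD.trans hl1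
  · rw [one_div_mul_eq_div, le_div_iff₀ hl0]
    exact hqF
  · have := h.card_mul_scale hkL le_rfl
    rw [Nat.sub_self, pow_zero, one_mul] at this
    rw [← this]
    apply le_of_eq
    field_simp

end

section

/-- An averaged bound for the number of near coincidences of `q * F j` and `p * F n`. -/
def SumInvBound (F : ℕ → ℝ) (d : ℕ) (C : ℝ) (N₀ : ℕ) : Prop :=
  ∀ N T : ℕ, N₀ ≤ N → 1 ≤ T → ∀ Δ : ℝ, 1 ≤ Δ → C * (T + Δ) ≤ N →
    ∀ (Q : ℕ) (p q : ℕ × ℕ → ℕ) (S : Finset (ℕ × ℕ)),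
    (∀ x ∈ S, N ≤ x.1 ∧ x.1 < 2 * N ∧ T * N ≤ x.2 ∧ x.2 < 2 * (T * N)) →
    (∀ x ∈ S, 0 < p x ∧ 0 < q x ∧ (p x).Coprime (q x) ∧ q x ≤ Q ∧
      |q x * F x.2 - p x * F x.1| ≤ Δ) →
    ∑ x ∈ S, 1 / (q x : ℝ) ≤ C * (Q * T ^ (d + 1) * Δ ^ 2 + T * N)

variable {F : ℕ → ℝ} {d N₀ N T : ℕ} {C : ℝ} {p q : ℕ × ℕ → ℕ} {S : Finset (ℕ × ℕ)}
  {X : ℕ × ℕ → ℝ}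

lemma card_block_le (hS : ∀ x ∈ S, N ≤ x.1 ∧ x.1 < 2 * N ∧ T * N ≤ x.2 ∧ x.2 < 2 * (T * N)) :
    (S.card : ℝ) ≤ T * N ^ 2 := by
  have h : S ⊆ Finset.Ico N (2 * N) ×ˢ Finset.Ico (T * N) (2 * (T * N)) := by
    intro x hx
    have := hS x hx
    simp only [Finset.mem_product, Finset.mem_Ico]
    omega
  have h2 := Finset.card_le_card h
  rw [Finset.card_product, Nat.card_Ico, Nat.card_Ico,
    show 2 * N - N = N by omega, show 2 * (T * N) - T * N = T * N by omega] at h2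
  calc (S.card : ℝ) ≤ (N * (T * N) : ℕ) := by exact_mod_cast h2
    _ = _ := by push_cast; ring

lemma sum_block_le_const {u K : ℝ} (hu : 0 < u) (hK : 0 ≤ K) (hN : 0 < N) (hT : 0 < T)
    (hS : ∀ x ∈ S, N ≤ x.1 ∧ x.1 < 2 * N ∧ T * N ≤ x.2 ∧ x.2 < 2 * (T * N))
    (hX : ∀ x ∈ S, X x ≤ K * (4 / (T * N ^ 2 * u ^ 2))) :
    ∑ x ∈ S, X x ≤ 4 * K / u ^ 2 := by
  have hN' : (0 : ℝ) < N := by exact_mod_cast hN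
  have hT' : (0 : ℝ) < T := by exact_mod_cast hT
  calc ∑ x ∈ S, X x ≤ S.card * (K * (4 / (T * N ^ 2 * u ^ 2))) := by
        rw [← nsmul_eq_mul]; exact Finset.sum_le_card_nsmul _ _ _ hX
    _ ≤ T * N ^ 2 * (K * (4 / (T * N ^ 2 * u ^ 2))) := by gcongr; exact card_block_le hS
    _ = _ := by field_simp

lemma sum_block_le_mid {u K A R Δ : ℝ} {Q : ℕ} (hd : 2 ≤ d) (hF : SumInvBound F d C N₀)
    (hC : 0 ≤ C) (hu : 1 ≤ u)
    (hK : 0 ≤ K) (hA : 1 ≤ A) (hR : 1 ≤ R) (hN0 : N₀ ≤ N) (hN : 0 < N) (hT : 1 ≤ T)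
    (hΔ : 1 ≤ Δ) (hΔR : Δ ^ 2 ≤ R * T) (hNΔ : C * (T + Δ) ≤ N) (hQ : Q * T ^ d ≤ A * N * u)
    (hS : ∀ x ∈ S, N ≤ x.1 ∧ x.1 < 2 * N ∧ T * N ≤ x.2 ∧ x.2 < 2 * (T * N))
    (hpq : ∀ x ∈ S, 0 < p x ∧ 0 < q x ∧ (p x).Coprime (q x) ∧ q x ≤ Q ∧
      |q x * F x.2 - p x * F x.1| ≤ Δ)
    (hX : ∀ x ∈ S, X x ≤ K * (4 / (T * N ^ 2 * u ^ 2))) :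
    ∑ x ∈ S, X x ≤ 8 * K * C * A ^ 2 * R / T := by
  have hN' : (0 : ℝ) < N := by exact_mod_cast hN
  have hT' : (0 : ℝ) < T := by exact_mod_cast hT
  have hT1 : (1 : ℝ) ≤ T := by exact_mod_cast hT
  have hsol := hF N T hN0 hT Δ hΔ hNΔ Q p q S hS hpq
  have hcard : (S.card : ℝ) ≤ Q * ∑ x ∈ S, 1 / (q x : ℝ) := by
    rw [Finset.mul_sum, Finset.card_eq_sum_ones, Nat.cast_sum]
    refine Finset.sum_le_sum fun x hx => ?_
    obtain ⟨_, h1, _, h2, _⟩ := hpq x hx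
    have h1' : (0 : ℝ) < q x := by exact_mod_cast h1
    have h2' : (q x : ℝ) ≤ Q := by exact_mod_cast h2
    rw [mul_one_div, le_div_iff₀ h1']
    simpa using h2'
  have hQT : Q * (T : ℝ) ^ 2 ≤ A * N * u := by
    refine le_trans ?_ hQ
    gcongr
  have hmain : (Q : ℝ) * (C * (Q * T ^ (d + 1) * Δ ^ 2 + T * N))
      ≤ 2 * C * A ^ 2 * R * N ^ 2 * u ^ 2 := by
    have h1 : (Q : ℝ) * (Q * T ^ (d + 1) * Δ ^ 2) ≤ A ^ 2 * R * N ^ 2 * u ^ 2 := by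
      calc (Q : ℝ) * (Q * T ^ (d + 1) * Δ ^ 2) ≤ (Q : ℝ) * (Q * T ^ (d + 1) * (R * T)) := by gcongr
        _ = R * ((Q * T ^ d) * (Q * (T : ℝ) ^ 2)) := by ring
        _ ≤ R * ((A * N * u) * (A * N * u)) := by gcongr
        _ = _ := by ring
    have h2 : (Q : ℝ) * (T * N) ≤ A ^ 2 * R * N ^ 2 * u ^ 2 := by
      calc (Q : ℝ) * (T * N) ≤ Q * (T ^ 2 * N) := by
            gcongr
            exact le_self_pow₀ hT1 (by norm_num)
        _ = (Q * T ^ 2) * N := by ring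
        _ ≤ (A * N * u) * N := by gcongr
        _ = A * 1 * N ^ 2 * u := by ring
        _ ≤ A ^ 2 * R * N ^ 2 * u ^ 2 := by
          gcongr
          · exact le_self_pow₀ hA (by norm_num)
          · exact le_self_pow₀ hu (by norm_num)
    calc _ = C * (Q * (Q * T ^ (d + 1) * Δ ^ 2) + Q * (T * N)) := by ring
      _ ≤ C * (A ^ 2 * R * N ^ 2 * u ^ 2 + A ^ 2 * R * N ^ 2 * u ^ 2) := by gcongr
      _ = _ := by ring
  calc ∑ x ∈ S, X x ≤ S.card * (K * (4 / (T * N ^ 2 * u ^ 2))) := by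
        rw [← nsmul_eq_mul]; exact Finset.sum_le_card_nsmul _ _ _ hX
    _ ≤ (2 * C * A ^ 2 * R * N ^ 2 * u ^ 2) * (K * (4 / (T * N ^ 2 * u ^ 2))) := by
        gcongr
        exact hcard.trans ((mul_le_mul_of_nonneg_left hsol (by positivity)).trans hmain)
    _ = _ := by field_simp; ring

lemma sum_block_le_small {u K A : ℝ} {Q : ℕ} (hd : 2 ≤ d) (hF : SumInvBound F d C N₀)
    (hC : 0 ≤ C) (hu : 1 ≤ u) (hK : 0 ≤ K) (hA : 1 ≤ A) (hN0 : N₀ ≤ N) (hN : 0 < N) (hT : 1 ≤ T)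
    (hNΔ : C * (T + 1) ≤ N) (hQ : Q * T = N)
    (hS : ∀ x ∈ S, N ≤ x.1 ∧ x.1 < 2 * N ∧ T * N ≤ x.2 ∧ x.2 < 2 * (T * N))
    (hpq : ∀ x ∈ S, 0 < p x ∧ 0 < q x ∧ (p x).Coprime (q x) ∧
      |q x * F x.2 - p x * F x.1| ≤ 1)
    (hX : ∀ x ∈ S, X x ≤ K * (A / T ^ d) * (2 / (T * N * u)) / q x) :
    ∑ x ∈ S, X x ≤ 2 * K * A * (1 + 2 * C) / (T * u) := by
  classical
  have hN' : (0 : ℝ) < N := by exact_mod_cast hN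
  have hT' : (0 : ℝ) < T := by exact_mod_cast hT
  have hT1 : (1 : ℝ) ≤ T := by exact_mod_cast hT
  have hQN : (Q : ℝ) * T = N := by exact_mod_cast hQ
  have hQ0 : (0 : ℝ) < Q := by
    by_contra h
    nlinarith
  set E := K * (A / T ^ d) * (2 / (T * N * u)) with hE
  have hE0 : 0 ≤ E := by positivity
  have hTd : (T : ℝ) ^ 2 ≤ T ^ d := pow_le_pow_right₀ hT1 hd
  rw [← Finset.sum_filter_add_sum_filter_not S (fun x => q x ≤ Q)]
  have h1 : ∑ x ∈ S.filter (fun x => q x ≤ Q), X x ≤ 4 * C * K * A / (T * u) := by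
    have hsol := hF N T hN0 hT 1 le_rfl hNΔ Q p q (S.filter fun x => q x ≤ Q)
      (fun x hx => hS x (Finset.mem_filter.1 hx).1) (fun x hx => by
        obtain ⟨a, b, c, e⟩ := hpq x (Finset.mem_filter.1 hx).1
        exact ⟨a, b, c, (Finset.mem_filter.1 hx).2, e⟩)
    calc ∑ x ∈ S.filter (fun x => q x ≤ Q), X x
        ≤ ∑ x ∈ S.filter (fun x => q x ≤ Q), E * (1 / (q x : ℝ)) :=
          Finset.sum_le_sum fun x hx => (hX x (Finset.mem_filter.1 hx).1).trans_eq (by ring)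
      _ = E * ∑ x ∈ S.filter (fun x => q x ≤ Q), (1 / (q x : ℝ)) := by rw [Finset.mul_sum]
      _ ≤ E * (C * (Q * T ^ (d + 1) * 1 ^ 2 + T * N)) := by gcongr
      _ ≤ E * (C * (N * T ^ d + T ^ d * N)) := by
          have e : (Q : ℝ) * T ^ (d + 1) * 1 ^ 2 = N * T ^ d := by rw [← hQN]; ring
          have : (T : ℝ) ≤ T ^ d := le_self_pow₀ hT1 (by omega)
          rw [e]
          gcongr
      _ = _ := by rw [hE]; field_simp; ring
  have h2 : ∑ x ∈ S.filter (fun x => ¬ q x ≤ Q), X x ≤ 2 * K * A / (T * u) := by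
    calc ∑ x ∈ S.filter (fun x => ¬ q x ≤ Q), X x
        ≤ (S.filter fun x => ¬ q x ≤ Q).card * (E / Q) := by
          rw [← nsmul_eq_mul]
          refine Finset.sum_le_card_nsmul _ _ _ fun x hx => ?_
          rw [Finset.mem_filter, not_le] at hx
          refine (hX x hx.1).trans ?_
          have : (Q : ℝ) ≤ q x := by exact_mod_cast hx.2.le
          gcongr
      _ ≤ T * N ^ 2 * (E / Q) := by
          gcongr
          exact card_block_le fun x hx => hS x (Finset.mem_filter.1 hx).1
      _ = 2 * K * A * T / (u * T ^ d) := by rw [hE, ← hQN]; field_simp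
      _ ≤ 2 * K * A * T / (u * T ^ 2) := by gcongr
      _ = _ := by field_simp
  calc _ ≤ 4 * C * K * A / (T * u) + 2 * K * A / (T * u) := add_le_add h1 h2
    _ = _ := by ring

end

section

lemma tol_le_of_two_pow_le {a n : ℕ} (ha : 1 ≤ a) (hn : 2 ^ a ≤ n) : tol n ≤ 2 / (2 ^ a * a) := by
  have h1 : (2 : ℝ) ^ a ≤ n := by exact_mod_cast hn
  have h2 : (a : ℝ) / 2 ≤ Real.log n := by
    calc (a : ℝ) / 2 ≤ a * Real.log 2 := by
          have := Real.log_two_gt_d9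
          have : (0 : ℝ) ≤ a := by positivity
          nlinarith
      _ = Real.log (2 ^ a) := by rw [Real.log_pow]
      _ ≤ _ := Real.log_le_log (by positivity) h1
  have ha' : (0 : ℝ) < a := by exact_mod_cast ha
  rw [tol, show (2 : ℝ) / (2 ^ a * a) = 1 / (2 ^ a * (a / 2)) by field_simp]
  gcongr

lemma log_le_of_lt_two_pow {a n : ℕ} (hn2 : 1 ≤ n) (hn : n < 2 ^ a) : Real.log n ≤ a := by
  have h1 : (n : ℝ) ≤ 2 ^ a := by exact_mod_cast hn.le
  have hn0 : (0 : ℝ) < n := by exact_mod_cast hn2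
  calc Real.log n ≤ Real.log (2 ^ a) := Real.log_le_log hn0 h1
    _ = a * Real.log 2 := by rw [Real.log_pow]
    _ ≤ a * 1 := by
        gcongr
        have := Real.log_two_lt_d9
        linarith
    _ = a := mul_one _

lemma le_mul_tol_of_lt_two_pow {a n : ℕ} (hn2 : 2 ≤ n) (hn : n < 2 ^ a) :
    1 / (a : ℝ) ≤ n * tol n := by
  have h1 : (1 : ℝ) < n := by exact_mod_cast hn2
  have h2 := Real.log_pos h1
  rw [tol, mul_one_div, show (n : ℝ) / (n * Real.log n) = 1 / Real.log n by field_simp]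
  exact one_div_le_one_div_of_le h2 (log_le_of_lt_two_pow (by omega) hn)

lemma le_tol_of_lt_two_pow {a n : ℕ} (hn2 : 2 ≤ n) (hn : n < 2 ^ a) :
    1 / ((2 : ℝ) ^ a * a) ≤ tol n := by
  have h1 : (1 : ℝ) < n := by exact_mod_cast hn2
  have h := le_mul_tol_of_lt_two_pow hn2 hn
  have h3 : (n : ℝ) ≤ 2 ^ a := by exact_mod_cast hn.le
  have h4 := (tol_pos hn2).le
  have h5 : 1 / (a : ℝ) ≤ 2 ^ a * tol n := h.trans (by gcongr)
  rw [mul_comm, ← div_div, div_le_iff₀ (by positivity)]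
  linarith

lemma tol_anti {n j : ℕ} (hn : 2 ≤ n) (hnj : n ≤ j) : tol j ≤ tol n := by
  have h1 : (1 : ℝ) < n := by exact_mod_cast hn
  have h2 := Real.log_pos h1
  have h3 : (n : ℝ) ≤ j := by exact_mod_cast hnj
  unfold tol
  gcongr

lemma four_pow_add_two (L : ℕ) : 4 ^ (L + 2) = 16 * 4 ^ L := by ring

lemma sixteen_mul_le_two_pow {v : ℕ} (hv : 1 ≤ v) : 16 * v ≤ 2 ^ (5 * v) := by
  have h1 : v < 2 ^ v := Nat.lt_pow_self (by norm_num)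
  calc 16 * v ≤ 2 ^ 4 * 2 ^ v := by omega
    _ = 2 ^ (4 + v) := by rw [pow_add]
    _ ≤ _ := Nat.pow_le_pow_right (by norm_num) (by omega)

lemma scale_mul_le {d L : ℕ} (hd : 2 ≤ d) :
    scale d L * 4 ^ (L + 2) ≤ 2 ^ (4 ^ (L + 2) * (d - 1)) := by
  obtain ⟨e, rfl⟩ := Nat.exists_eq_add_of_le hd
  have hv : 1 ≤ 4 ^ L := Nat.one_le_pow _ _ (by norm_num)
  rw [four_pow_add_two, scale]
  generalize 4 ^ L = v at hv
  calc 2 ^ ((2 + e + 2) * v) * (16 * v) ≤ 2 ^ ((2 + e + 2) * v) * 2 ^ (5 * v) :=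
        Nat.mul_le_mul_left _ (sixteen_mul_le_two_pow hv)
    _ = 2 ^ ((2 + e + 2) * v + 5 * v) := by rw [pow_add]
    _ ≤ 2 ^ (16 * v * (2 + e - 1)) := by
        apply Nat.pow_le_pow_right (by norm_num)
        rw [show 2 + e - 1 = e + 1 by omega]
        nlinarith [Nat.zero_le (e * v)]

variable {F : ℕ → ℝ} {d n₀ L n j : ℕ}

/-- In the window `2 ^ u ≤ n < 2 ^ (2 * u)` every hit is detected at level `L + 3`. -/
lemma growth_le_tol_mul_scale (hF : Growth F d n₀) (hn₀ : n₀ ≤ n) (hn2 : 2 ≤ n)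
    (hn : n < 2 ^ (2 * 4 ^ (L + 2))) : F n ≤ tol n * scale d (L + 3) := by
  have h1 := (hF n hn₀).2
  set u := 4 ^ (L + 2) with hu
  have hu1 : 1 ≤ u := Nat.one_le_pow _ _ (by norm_num)
  have h2 := le_mul_tol_of_lt_two_pow hn2 hn
  have hn0 : (0 : ℝ) < n := by exact_mod_cast (show 0 < n by omega)
  have e : (scale d (L + 3) : ℝ) = 2 ^ ((d + 2) * (4 * u)) := by
    rw [scale, show 4 ^ (L + 3) = 4 * u by rw [hu]; ring]; push_cast; rfl
  have h3 : (2 : ℝ) * n ^ (d + 1) * (2 * u) ≤ 2 ^ ((d + 2) * (4 * u)) := by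
    have a1 : n ^ (d + 1) ≤ 2 ^ (2 * u * (d + 1)) := by
      rw [pow_mul]; exact Nat.pow_le_pow_left hn.le _
    have a2 : u < 2 ^ u := Nat.lt_pow_self (by norm_num)
    have a3 : 2 * n ^ (d + 1) * (2 * u) ≤ 2 ^ ((d + 2) * (4 * u)) := by
      calc 2 * n ^ (d + 1) * (2 * u) ≤ 2 * 2 ^ (2 * u * (d + 1)) * (2 * 2 ^ u) := by gcongr
        _ = 2 ^ (2 * u * (d + 1) + u + 2) := by ring
        _ ≤ _ := by
          apply Nat.pow_le_pow_right (by norm_num)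
          nlinarith [Nat.zero_le (d * u)]
    exact_mod_cast a3
  have h2u : (0 : ℝ) < 2 * u := by positivity
  push_cast at h2
  rw [div_le_iff₀ h2u] at h2
  rw [e]
  have h4 := (tol_pos hn2).le
  calc F n ≤ 2 * n ^ d * 1 := by linarith
    _ ≤ 2 * n ^ d * (n * tol n * (2 * u)) := by gcongr
    _ = tol n * (2 * n ^ (d + 1) * (2 * u)) := by ring
    _ ≤ _ := by gcongr

lemma four_mul_scale_le (hd : 1 ≤ d) (hF : Growth F d n₀) (hn₀ : n₀ ≤ n)
    (hn : 2 ^ (4 ^ (L + 2)) ≤ n) :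
    4 * scale d L ≤ F n := by
  have h1 := (hF n hn₀).1
  have hv : 1 ≤ 4 ^ L := Nat.one_le_pow _ _ (by norm_num)
  have h2 : 8 * scale d L ≤ n ^ d := by
    calc 8 * scale d L = 2 ^ 3 * 2 ^ ((d + 2) * 4 ^ L) := rfl
      _ = 2 ^ (3 + (d + 2) * 4 ^ L) := by rw [pow_add]
      _ ≤ 2 ^ (4 ^ (L + 2) * d) := by
        apply Nat.pow_le_pow_right (by norm_num)
        rw [four_pow_add_two]
        nlinarith
      _ = (2 ^ (4 ^ (L + 2))) ^ d := by rw [pow_mul]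
      _ ≤ _ := Nat.pow_le_pow_left hn _
  have h3 : (8 : ℝ) * scale d L ≤ n ^ d := by exact_mod_cast h2
  linarith

variable {k : ℕ} {z : ℤ} {T : ℕ → Finset ℤ}

lemma exists_pair_bound (hd : 2 ≤ d) (hF : Growth F d n₀) (hn₀ : n₀ ≤ 2 ^ (4 ^ (L + 2)))
    (h : HalfTree d k L z T) (hkL : k ≤ L) (hn : 2 ^ (4 ^ (L + 2)) ≤ n) (hnj : n < j)
    (hj : j < 2 ^ (4 ^ (L + 2) + 4 ^ (L + 2) / (2 * d))) :
    ∃ p q : ℕ, 0 < p ∧ 0 < q ∧ p.Coprime q ∧ q * (16 * (F j / F n) * tol n) ≤ 1 ∧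
      (∀ l δ, k ≤ l → l ≤ L → 0 < δ → δ ≤ |q * F j - p * F n| →
        ((hitSet F d L (T L) n ∩ hitSet F d L (T L) j).card : ℝ) ≤
          126 * (1 + 2 * scale d l / δ) * 2 ^ (L - l)
          * ((T L).card * desc d L (L + 3)) * (tol n * tol j)) ∧
      (|q * F j - p * F n| ≤ 1 →
        ((hitSet F d L (T L) n ∩ hitSet F d L (T L) j).card : ℝ)
          ≤ 27 * ((T L).card * desc d L (L + 3)) * (F n / F j) * tol j / q) := by
  have hscale := scale_mul_le (L := L) hd
  have hIη : F j ≤ tol j * scale d (L + 3) := by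
    refine growth_le_tol_mul_scale hF (by omega) ?_ (hj.trans_le ?_)
    · have : 1 ≤ 2 ^ 4 ^ (L + 2) := Nat.one_le_pow _ _ (by norm_num)
      omega
    · apply Nat.pow_le_pow_right (by norm_num)
      have := Nat.div_le_self (4 ^ (L + 2)) (2 * d)
      omega
  have hu16 : 16 ≤ 4 ^ (L + 2) := by
    have hv : 1 ≤ 4 ^ L := Nat.one_le_pow _ _ (by norm_num)
    rw [four_pow_add_two]; omega
  set u := 4 ^ (L + 2) with hu
  set b := u / (2 * d) with hb
  have hbd : 2 * (b * d) ≤ u := by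
    have := Nat.div_mul_le_self u (2 * d)
    rw [← hb] at this
    calc 2 * (b * d) = b * (2 * d) := by ring
      _ ≤ u := this
  have hbu : b ≤ u := Nat.div_le_self _ _
  have h16 : 2 ^ 16 ≤ 2 ^ u := Nat.pow_le_pow_right (by norm_num) hu16
  have hn2 : 2 ≤ n := by omega
  have hgn := hF n (by omega)
  have hgj := hF j (by omega)
  have hn0 : (0 : ℝ) < n := by exact_mod_cast (show 0 < n by omega)
  have hj0 : (0 : ℝ) < j := by exact_mod_cast (show 0 < j by omega)
  have hFn : 0 < F n := lt_of_lt_of_le (by positivity) hgn.1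
  have hFj : 0 < F j := lt_of_lt_of_le (by positivity) hgj.1
  have hnjd : (n : ℝ) ^ d ≤ j ^ d := by gcongr
  have hF4 : F n ≤ 4 * F j := by linarith [hgn.2, hgj.1]
  have hηn := tol_pos hn2
  have hηj := tol_pos (show 2 ≤ j by omega)
  have hη := tol_anti hn2 hnj.le
  have hun : (2 : ℝ) ^ u ≤ n := by exact_mod_cast hn
  have hu16' : (16 : ℝ) ≤ u := by exact_mod_cast hu16
  have htol : tol n ≤ 1 / (8 * 2 ^ u) := by
    refine (tol_le_of_two_pow_le (by omega) hn).trans ?_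
    rw [div_le_div_iff₀ (by positivity) (by positivity)]
    have : (0 : ℝ) < 2 ^ u := by positivity
    nlinarith
  have hη1 : tol n ≤ 1 / 16 := by
    refine htol.trans (one_div_le_one_div_of_le (by norm_num) ?_)
    have : (2 : ℝ) ≤ 2 ^ u := le_self_pow₀ (by norm_num) (by omega)
    linarith
  have hratio : F j / F n ≤ 4 * 2 ^ (b * d) := by
    rw [div_le_iff₀ hFn]
    have h1 : (j : ℝ) ^ d ≤ 2 ^ (b * d) * n ^ d := by
      have : (j : ℝ) ≤ 2 ^ b * n := by
        calc (j : ℝ) ≤ 2 ^ (u + b) := by exact_mod_cast hj.le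
          _ = 2 ^ b * 2 ^ u := by rw [pow_add, mul_comm]
          _ ≤ _ := by gcongr
      calc (j : ℝ) ^ d ≤ (2 ^ b * n) ^ d := by gcongr
        _ = _ := by rw [mul_pow, ← pow_mul]
    have h2 : (0 : ℝ) < 2 ^ (b * d) := by positivity
    nlinarith [hgn.1, hgj.2]
  have hQ : 16 * (F j / F n) * tol n ≤ 1 := by
    calc 16 * (F j / F n) * tol n ≤ 16 * (4 * 2 ^ (b * d)) * (1 / (8 * 2 ^ u)) := by gcongr
      _ = 2 ^ (b * d + 3) / 2 ^ u := by rw [pow_add]; field_simp; norm_num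
      _ ≤ 1 := by
        rw [div_le_one (by positivity)]
        exact pow_le_pow_right₀ (by norm_num) (by omega)
  obtain ⟨p, q, hp, hq, hpq, hqQ, hD, hτ, -⟩ :=
    exists_approx_ratio hFn hFj hηn hη hF4 hη1 hQ
  refine ⟨p, q, hp, hq, hpq, hqQ, fun l δ hkl hlL hδ hδD => ?_, fun hD1 => ?_⟩
  · exact card_inter_hitSet_le_of_pos h hkl hlL hFn hFj hηn hηj hη hF4 hη1 hq hpq hτ hD hIη hδ hδD
  · refine card_inter_hitSet_le_of_small h hkL hFn hFj hηn hηj hη1 hq hpq hτ hD1 ?_ hIη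
    have hlow : (scale d L : ℝ) ≤ 16 * F j * tol n := by
      have h1 : (1 : ℝ) / (2 * u) ≤ n * tol n := by
        have := le_mul_tol_of_lt_two_pow (a := 2 * u) hn2
          ((hnj.trans hj).trans_le (Nat.pow_le_pow_right (by norm_num) (by omega)))
        exact_mod_cast this
      have h2 : (scale d L : ℝ) * u ≤ n ^ (d - 1) := by
        calc (scale d L : ℝ) * u ≤ 2 ^ (u * (d - 1)) := by exact_mod_cast hscale
          _ = (2 ^ u) ^ (d - 1) := by rw [pow_mul]
          _ ≤ _ := by gcongr
      have hu0 : (0 : ℝ) < u := by linarith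
      calc (scale d L : ℝ) = scale d L * u * (1 / u) := by field_simp
        _ ≤ n ^ (d - 1) * (1 / u) := by gcongr
        _ = 2 * n ^ (d - 1) * (1 / (2 * u)) := by field_simp
        _ ≤ 2 * n ^ (d - 1) * (n * tol n) := by gcongr
        _ = 2 * n ^ d * tol n := by
          rw [show (n : ℝ) ^ d = n ^ (d - 1) * n by rw [← pow_succ, Nat.sub_add_cancel (by omega)]]
          ring
        _ ≤ 16 * F j * tol n := by
          refine mul_le_mul_of_nonneg_right ?_ hηn.le
          linarith [hgj.1]
    have h3 : q * (16 * F j * tol n) ≤ F n := by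
      have e : q * (16 * (F j / F n) * tol n) = q * (16 * F j * tol n) / F n := by
        field_simp
      rwa [e, div_le_one hFn] at hqQ
    calc (q : ℝ) * scale d L ≤ q * (16 * F j * tol n) := by gcongr
      _ ≤ _ := h3

end

section

lemma exists_level (d : ℕ) {k L t : ℕ} (hkL : k ≤ L) (ht : t + 1 ≤ 4 ^ (L + 2)) :
    ∃ l, k ≤ l ∧ l ≤ L ∧ scale d l ≤ scale d k * 2 ^ (t / 4) ∧
      (t + 1) * 4 ^ (L - l) ≤ (d + 2) * 4 ^ (L + 2) := by
  let P : ℕ → Prop := fun l => k ≤ l ∧ scale d l ≤ scale d k * 2 ^ (t / 4)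
  have hk : P k := ⟨le_rfl, Nat.le_mul_of_pos_right _ (by positivity)⟩
  classical
  have hl := Nat.findGreatest_spec hkL hk
  have hlL := Nat.findGreatest_le (P := P) L
  have hmax := fun m => Nat.findGreatest_is_greatest (P := P) (n := L) (k := m)
  set l := Nat.findGreatest P L with hldef
  refine ⟨l, hl.1, hlL, hl.2, ?_⟩
  rcases hlL.eq_or_lt with e | hlt
  · rw [e, Nat.sub_self, pow_zero, mul_one]
    exact ht.trans (Nat.le_mul_of_pos_left _ (by omega))
  · have h1 := hmax (l + 1) (by omega) (by omega)
    have h2 : scale d k * 2 ^ (t / 4) < scale d (l + 1) := by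
      by_contra h3
      exact h1 ⟨by omega, not_lt.1 h3⟩
    have h3 : 2 ^ (t / 4) < scale d (l + 1) :=
      lt_of_le_of_lt (Nat.le_mul_of_pos_left _ (scale_pos d k)) h2
    rw [scale, Nat.pow_lt_pow_iff_right (by norm_num)] at h3
    have h4 : t + 1 ≤ 16 * ((d + 2) * 4 ^ l) := by
      have e : (d + 2) * 4 ^ (l + 1) = 4 * ((d + 2) * 4 ^ l) := by ring
      omega
    calc (t + 1) * 4 ^ (L - l) ≤ 16 * ((d + 2) * 4 ^ l) * 4 ^ (L - l) := by gcongr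
      _ = 16 * (d + 2) * (4 ^ l * 4 ^ (L - l)) := by ring
      _ = (d + 2) * 4 ^ (L + 2) := by
        rw [← pow_add, Nat.add_sub_cancel' hlL]; ring

lemma sum_inv_sqrt_le (n : ℕ) : ∑ t ∈ Finset.range n, 1 / √((t : ℝ) + 1) ≤ 2 * √n := by
  induction n with
  | zero => simp
  | succ n ih =>
    rw [Finset.sum_range_succ]
    have h1 : 0 < √((n : ℝ) + 1) := Real.sqrt_pos.2 (by positivity)
    have h2 : √((n : ℝ) + 1) ^ 2 = n + 1 := Real.sq_sqrt (by positivity)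
    have h3 : √(n : ℝ) ^ 2 = n := Real.sq_sqrt (by positivity)
    have h4 : 1 / √((n : ℝ) + 1) ≤ 2 * √((n : ℝ) + 1) - 2 * √n := by
      rw [div_le_iff₀ h1]
      nlinarith [sq_nonneg (√((n : ℝ) + 1) - √n)]
    push_cast
    linarith

variable {F : ℕ → ℝ} {d n₀ N₀ k L a t : ℕ} {C : ℝ} {z : ℤ} {Tr : ℕ → Finset ℤ}
  {p q : ℕ × ℕ → ℕ} {S : Finset (ℕ × ℕ)}

/-- The bound for the contribution of a pair of dyadic blocks at distance `t`. -/
noncomputable def blockBound (d k L : ℕ) (C : ℝ) (t : ℕ) : ℝ :=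
  1512 * (√(((d : ℝ) + 2) * 4 ^ (L + 2)) * (1 / √((t : ℝ) + 1))) / ((4 : ℝ) ^ (L + 2)) ^ 2
  + (if t < 6 * (L + 2) then 1512 * (scale d k : ℝ) * 2 ^ L / ((4 : ℝ) ^ (L + 2)) ^ 2 else
      3024 * (scale d k : ℝ) * 2 ^ L * C * (2 ^ (d + 2)) ^ 2 * (scale d k : ℝ) ^ 2 / 2 ^ t)
  + 54 * 2 ^ (d + 2) * (1 + 2 * C) / (2 ^ t * 4 ^ (L + 2))

lemma sum_block_le (hd : 2 ≤ d) (hF : Growth F d n₀) (hSI : SumInvBound F d C N₀) (hC : 1 ≤ C)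
    (hkL : k ≤ L) (hn₀ : n₀ ≤ 2 ^ (4 ^ (L + 2)))
    (hN₀ : N₀ ≤ 2 ^ (4 ^ (L + 2))) (ha : 4 ^ (L + 2) ≤ a)
    (hat : a + t < 4 ^ (L + 2) + 4 ^ (L + 2) / (2 * d)) (hbig : 2 * C * scale d k * 2 ^ t ≤ 2 ^ a)
    (hS : ∀ x ∈ S, 2 ^ a ≤ x.1 ∧ x.1 < 2 * 2 ^ a ∧ 2 ^ t * 2 ^ a ≤ x.2 ∧ x.2 < 2 * (2 ^ t * 2 ^ a))
    {W : ℝ} (hW : 0 ≤ W) {X : ℕ × ℕ → ℝ}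
    (hpair : ∀ x ∈ S, 0 < p x ∧ 0 < q x ∧ (p x).Coprime (q x) ∧
      q x * (16 * (F x.2 / F x.1) * tol x.1) ≤ 1 ∧
      (∀ l δ, k ≤ l → l ≤ L → 0 < δ → δ ≤ |q x * F x.2 - p x * F x.1| →
        X x ≤ 126 * (1 + 2 * scale d l / δ) * 2 ^ (L - l) * W * (tol x.1 * tol x.2)) ∧
      (|q x * F x.2 - p x * F x.1| ≤ 1 → X x ≤ 27 * W * (F x.1 / F x.2) * tol x.2 / q x)) :
    ∑ x ∈ S, X x ≤ W * blockBound d k L C t := by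
  classical
  set u := 4 ^ (L + 2) with hu
  have hu16 : 16 ≤ u := by
    have hv : 1 ≤ 4 ^ L := Nat.one_le_pow _ _ (by norm_num)
    rw [hu, four_pow_add_two]; omega
  set b := u / (2 * d) with hb
  have hbd : 2 * (b * d) ≤ u := by
    have := Nat.div_mul_le_self u (2 * d)
    rw [← hb] at this
    calc 2 * (b * d) = b * (2 * d) := by ring
      _ ≤ u := this
  have hbu : b ≤ u := Nat.div_le_self _ _
  have htb : t < b := by omega
  have htd : t * d ≤ b * d := Nat.mul_le_mul_right _ htb.le
  have hta : t ≤ a := by omega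
  have h16 : 2 ^ 16 ≤ 2 ^ u := Nat.pow_le_pow_right (by norm_num) hu16
  have hua : 2 ^ u ≤ 2 ^ a := Nat.pow_le_pow_right (by norm_num) ha
  have hucast : ((u : ℕ) : ℝ) = 4 ^ (L + 2) := by rw [hu]; push_cast; rfl
  have hu16' : (16 : ℝ) ≤ u := by exact_mod_cast hu16
  have hu0 : (0 : ℝ) < u := by linarith
  have hK1 : (1 : ℝ) ≤ scale d k := by exact_mod_cast scale_pos d k
  have hT1 : (1 : ℝ) ≤ 2 ^ t := one_le_pow₀ (by norm_num)
  -- elementary facts on pairs of the block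
  have hfacts : ∀ x ∈ S, 0 < F x.1 ∧ 0 < F x.2 ∧ 0 < tol x.1 ∧ 0 < tol x.2 ∧
      tol x.1 ≤ 2 / (2 ^ a * u) ∧ tol x.2 ≤ 2 / (2 ^ t * 2 ^ a * u) ∧
      1 / (4 * 2 ^ a * u) ≤ tol x.1 ∧ F x.1 / F x.2 ≤ 2 ^ (d + 2) / (2 ^ t) ^ d := by
    intro x hx
    obtain ⟨h1, h2, h3, h4⟩ := hS x hx
    have h5 : 2 ^ a ≤ 2 ^ t * 2 ^ a := Nat.le_mul_of_pos_left _ (by positivity)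
    have hn2 : 2 ≤ x.1 := by omega
    have hgn := hF x.1 (by omega)
    have hgj := hF x.2 (by omega)
    have hn0 : (0 : ℝ) < x.1 := by exact_mod_cast (show 0 < x.1 by omega)
    have hj0 : (0 : ℝ) < x.2 := by exact_mod_cast (show 0 < x.2 by omega)
    have hFn : 0 < F x.1 := lt_of_lt_of_le (by positivity) hgn.1
    have hFj : 0 < F x.2 := lt_of_lt_of_le (by positivity) hgj.1
    have hau : (u : ℝ) ≤ a := by exact_mod_cast ha
    refine ⟨hFn, hFj, tol_pos hn2, tol_pos (by omega), ?_, ?_, ?_, ?_⟩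
    · refine (tol_le_of_two_pow_le (by omega) h1).trans ?_
      gcongr
    · rw [← pow_add] at h3 ⊢
      refine (tol_le_of_two_pow_le (a := t + a) (by omega) h3).trans ?_
      gcongr
      omega
    · refine le_trans ?_ (le_tol_of_lt_two_pow (a := a + 1) hn2 (by rw [pow_succ]; omega))
      apply one_div_le_one_div_of_le (by positivity)
      have : ((a + 1 : ℕ) : ℝ) ≤ 2 * u := by exact_mod_cast (show a + 1 ≤ 2 * u by omega)
      calc (2 : ℝ) ^ (a + 1) * ((a + 1 : ℕ) : ℝ) ≤ 2 ^ (a + 1) * (2 * u) := by gcongr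
        _ = _ := by ring
    · rw [div_le_div_iff₀ hFj (by positivity)]
      have a1 : (x.1 : ℝ) ≤ 2 * 2 ^ a := by exact_mod_cast h2.le
      have a2 : (2 : ℝ) ^ t * 2 ^ a ≤ x.2 := by exact_mod_cast h3
      calc F x.1 * ((2 : ℝ) ^ t) ^ d ≤ 2 * (2 * 2 ^ a) ^ d * (2 ^ t) ^ d := by
            gcongr
            exact hgn.2.trans (by gcongr)
        _ = 2 ^ (d + 2) * ((2 ^ t * 2 ^ a) ^ d / 2) := by rw [mul_pow, mul_pow]; ring
        _ ≤ 2 ^ (d + 2) * (x.2 ^ d / 2) := by gcongr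
        _ ≤ _ := by
            gcongr
            exact hgj.1
  have htt : ∀ x ∈ S, tol x.1 * tol x.2 ≤ 4 / (2 ^ t * (2 ^ a) ^ 2 * u ^ 2) := by
    intro x hx
    obtain ⟨-, -, h3, h4, h5, h6, -, -⟩ := hfacts x hx
    calc _ ≤ 2 / (2 ^ a * u) * (2 / (2 ^ t * 2 ^ a * (u : ℝ))) := by gcongr
      _ = _ := by field_simp; norm_num
  have hqQ : ∀ x ∈ S, q x ≤ 2 ^ d * u * 2 ^ (a - t * d) := by
    intro x hx
    obtain ⟨h1, h2, h3, h4, h5, h6, h7, h8⟩ := hfacts x hx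
    have hq := (hpair x hx).2.2.2.1
    have hTd : (0 : ℝ) < (2 ^ t) ^ d := by positivity
    have hratio : (2 ^ t) ^ d / 2 ^ (d + 2) ≤ F x.2 / F x.1 := by
      rw [div_le_div_iff₀ h2 hTd] at h8
      rw [div_le_div_iff₀ (by positivity) h1]
      linarith
    have h9 : (q x : ℝ) * (16 * ((2 ^ t) ^ d / 2 ^ (d + 2)) * (1 / (4 * 2 ^ a * u))) ≤ 1 := by
      refine le_trans ?_ hq
      gcongr
    have e1 : (q x : ℝ) * (16 * ((2 ^ t) ^ d / 2 ^ (d + 2)) * (1 / (4 * 2 ^ a * u)))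
        = q x * 2 ^ (t * d) / (2 ^ d * u * 2 ^ a) := by
      rw [← pow_mul, pow_add]; field_simp; ring
    rw [e1, div_le_one (by positivity)] at h9
    have e2 : (2 : ℝ) ^ a = 2 ^ (a - t * d) * 2 ^ (t * d) := by
      rw [← pow_add, Nat.sub_add_cancel (by omega)]
    rw [e2, ← mul_assoc] at h9
    have := le_of_mul_le_mul_right h9 (by positivity)
    exact_mod_cast this
  obtain ⟨l, hkl, hlL, hlΔ, hlt⟩ := exists_level d (t := t) hkL (by omega)
  set Δ : ℝ := scale d k * 2 ^ (t / 4) with hΔ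
  have hΔ1 : 1 ≤ Δ := one_le_mul_of_one_le_of_one_le hK1 (one_le_pow₀ (by norm_num))
  have hlΔ' : (scale d l : ℝ) ≤ Δ := by rw [hΔ]; exact_mod_cast hlΔ
  have hΔT : Δ ≤ scale d k * 2 ^ t := by
    rw [hΔ]; gcongr
    · norm_num
    · omega
  have hΔR : Δ ^ 2 ≤ (scale d k : ℝ) ^ 2 * 2 ^ t := by
    rw [hΔ, mul_pow, ← pow_mul]
    gcongr
    · norm_num
    · omega
  have hTK : (2 : ℝ) ^ t ≤ scale d k * 2 ^ t := le_mul_of_one_le_left (by positivity) hK1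
  have hCTΔ : C * (((2 ^ t : ℕ) : ℝ) + Δ) ≤ ((2 ^ a : ℕ) : ℝ) := by
    push_cast
    calc C * (2 ^ t + Δ) ≤ C * (scale d k * 2 ^ t + scale d k * 2 ^ t) := by gcongr
      _ = 2 * C * scale d k * 2 ^ t := by ring
      _ ≤ _ := hbig
  have hCT1 : C * (((2 ^ t : ℕ) : ℝ) + 1) ≤ ((2 ^ a : ℕ) : ℝ) := by
    refine le_trans ?_ hCTΔ
    gcongr
  set Dd : ℕ × ℕ → ℝ := fun x => |q x * F x.2 - p x * F x.1| with hDd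
  -- large determinants
  have hlarge : ∑ x ∈ S.filter (fun x => Δ ≤ Dd x), X x
      ≤ 4 * (378 * 2 ^ (L - l) * W) / u ^ 2 := by
    refine sum_block_le_const (N := 2 ^ a) (T := 2 ^ t) hu0 (by positivity) (by positivity)
      (by positivity) (fun x hx => hS x (Finset.mem_filter.1 hx).1) fun x hx => ?_
    obtain ⟨hx, hxD⟩ := Finset.mem_filter.1 hx
    refine ((hpair x hx).2.2.2.2.1 l Δ hkl hlL (by linarith) hxD).trans ?_
    have h1 : 2 * scale d l / Δ ≤ 2 := by
      rw [div_le_iff₀ (by linarith)]; linarith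
    have h2 : 126 * (1 + 2 * scale d l / Δ) ≤ 378 := by linarith
    push_cast
    obtain ⟨-, -, h3, h4, -⟩ := hfacts x hx
    have := htt x hx
    gcongr
  have hcoef : ∀ x ∈ S, 1 ≤ Dd x →
      X x ≤ 378 * scale d k * 2 ^ L * W * (4 / ((2 ^ t : ℕ) * ((2 ^ a : ℕ) : ℝ) ^ 2 * u ^ 2)) := by
    intro x hx hxD
    refine ((hpair x hx).2.2.2.2.1 k 1 le_rfl hkL one_pos hxD).trans ?_
    have h2 : 126 * (1 + 2 * (scale d k : ℝ) / 1) ≤ 378 * scale d k := by linarith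
    obtain ⟨-, -, h3, h4, -⟩ := hfacts x hx
    have := htt x hx
    push_cast
    gcongr
    · norm_num
    · omega
  -- intermediate determinants
  have hmid : ∑ x ∈ (S.filter (fun x => ¬ Δ ≤ Dd x)).filter (fun x => 1 ≤ Dd x), X x
      ≤ if t < 6 * (L + 2) then 4 * (378 * scale d k * 2 ^ L * W) / u ^ 2
        else 8 * (378 * scale d k * 2 ^ L * W) * C * (2 ^ (d + 2)) ^ 2 * scale d k ^ 2
          / ((2 ^ t : ℕ) : ℝ) := by
    have hmem : ∀ x ∈ (S.filter (fun x => ¬ Δ ≤ Dd x)).filter (fun x => 1 ≤ Dd x),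
        x ∈ S ∧ Dd x ≤ Δ ∧ 1 ≤ Dd x := by
      intro x hx
      simp only [Finset.mem_filter, not_le] at hx
      exact ⟨hx.1.1, hx.1.2.le, hx.2⟩
    split_ifs with hcase
    · exact sum_block_le_const (N := 2 ^ a) (T := 2 ^ t) hu0 (by positivity) (by positivity)
        (by positivity) (fun x hx => hS x (hmem x hx).1) fun x hx =>
          hcoef x (hmem x hx).1 (hmem x hx).2.2
    · refine sum_block_le_mid (p := p) (q := q) (N := 2 ^ a) (T := 2 ^ t)
        (Q := 2 ^ d * u * 2 ^ (a - t * d)) hd hSI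
        (by linarith) (by linarith) (by positivity) (one_le_pow₀ (by norm_num)) (one_le_pow₀ hK1)
        (by omega) (by positivity) (by exact_mod_cast hT1) hΔ1 (by exact_mod_cast hΔR) hCTΔ ?_
        (fun x hx => hS x (hmem x hx).1) (fun x hx => ?_)
        fun x hx => hcoef x (hmem x hx).1 (hmem x hx).2.2
      · push_cast
        have e2 : (2 : ℝ) ^ a = 2 ^ (a - t * d) * 2 ^ (t * d) := by
          rw [← pow_add, Nat.sub_add_cancel (by omega)]
        rw [e2, ← pow_mul, pow_add]
        have : (0 : ℝ) ≤ 2 ^ d * (2 ^ (a - t * d) * 2 ^ (t * d)) * u := by positivity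
        linarith
      · obtain ⟨hxS, hxD, -⟩ := hmem x hx
        obtain ⟨h1, h2, h3, -⟩ := hpair x hxS
        exact ⟨h1, h2, h3, hqQ x hxS, hxD⟩
  -- small determinants
  have hsmall : ∑ x ∈ (S.filter (fun x => ¬ Δ ≤ Dd x)).filter (fun x => ¬ 1 ≤ Dd x), X x
      ≤ 2 * (27 * W) * 2 ^ (d + 2) * (1 + 2 * C) / (((2 ^ t : ℕ) : ℝ) * u) := by
    have hmem : ∀ x ∈ (S.filter (fun x => ¬ Δ ≤ Dd x)).filter (fun x => ¬ 1 ≤ Dd x),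
        x ∈ S ∧ Dd x ≤ 1 := by
      intro x hx
      simp only [Finset.mem_filter, not_le] at hx
      exact ⟨hx.1.1, hx.2.le⟩
    refine sum_block_le_small (p := p) (q := q) (N := 2 ^ a) (T := 2 ^ t) (Q := 2 ^ (a - t)) hd hSI
      (by linarith) (by linarith) (by positivity) (one_le_pow₀ (by norm_num)) (by omega)
      (by positivity) (by exact_mod_cast hT1) hCT1 ?_
      (fun x hx => hS x (hmem x hx).1) (fun x hx => ?_) (fun x hx => ?_)
    · rw [← pow_add, Nat.sub_add_cancel hta]
    · obtain ⟨hxS, hxD⟩ := hmem x hx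
      obtain ⟨h1, h2, h3, -⟩ := hpair x hxS
      exact ⟨h1, h2, h3, hxD⟩
    · obtain ⟨hxS, hxD⟩ := hmem x hx
      refine ((hpair x hxS).2.2.2.2.2 hxD).trans ?_
      obtain ⟨h1, h2, h3, h4, -, h6, -, h8⟩ := hfacts x hxS
      push_cast
      gcongr
  have hρ : (2 : ℝ) ^ (L - l) ≤ √((d + 2) * 4 ^ (L + 2)) * (1 / √((t : ℝ) + 1)) := by
    rw [mul_one_div, ← Real.sqrt_div (by positivity)]
    apply Real.le_sqrt_of_sq_le
    rw [le_div_iff₀ (by positivity), ← pow_mul, mul_comm (L - l) 2, pow_mul]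
    have : (((t + 1) * 4 ^ (L - l) : ℕ) : ℝ) ≤ ((d + 2) * 4 ^ (L + 2) : ℕ) := by exact_mod_cast hlt
    push_cast at this
    norm_num
    linarith
  rw [← Finset.sum_filter_add_sum_filter_not S (fun x => Δ ≤ Dd x),
    ← Finset.sum_filter_add_sum_filter_not (S.filter fun x => ¬ Δ ≤ Dd x) (fun x => 1 ≤ Dd x)]
  have hlarge' : 4 * (378 * 2 ^ (L - l) * W) / u ^ 2 ≤ 4 * (378 *
      (√((d + 2) * 4 ^ (L + 2)) * (1 / √((t : ℝ) + 1))) * W) / u ^ 2 := by gcongr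
  rw [hucast] at hlarge hlarge' hmid hsmall
  refine (add_le_add (hlarge.trans hlarge') (add_le_add hmid hsmall)).trans (le_of_eq ?_)
  rw [blockBound]
  push_cast
  split_ifs <;> ring

end

section

variable {F : ℕ → ℝ} {d n₀ N₀ k L : ℕ} {C : ℝ} {z : ℤ} {T : ℕ → Finset ℤ}

lemma exists_mul_le_two_pow (M : ℝ) : ∃ L₀ : ℕ, ∀ L : ℕ, L₀ ≤ L → M * (L + 2) ≤ 2 ^ L := by
  have h1 := tendsto_pow_const_div_const_pow_of_one_lt 1 (r := (2 : ℝ)) (by norm_num)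
  have h2 := tendsto_pow_const_div_const_pow_of_one_lt 0 (r := (2 : ℝ)) (by norm_num)
  have h3 : Tendsto (fun n : ℕ => M * ((n : ℝ) ^ 1 / 2 ^ n + 2 * ((n : ℝ) ^ 0 / 2 ^ n))) atTop
      (nhds (M * (0 + 2 * 0))) := (h1.add (h2.const_mul 2)).const_mul M
  have h4 : M * (0 + 2 * 0) < (1 : ℝ) := by norm_num
  obtain ⟨L₀, h⟩ := eventually_atTop.1 (h3.eventually_lt_const h4)
  refine ⟨L₀, fun L hL => ?_⟩
  have h5 := h L hL
  have h6 : (0 : ℝ) < 2 ^ L := by positivity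
  have e : M * ((L : ℝ) ^ 1 / 2 ^ L + 2 * ((L : ℝ) ^ 0 / 2 ^ L)) = M * (L + 2) / 2 ^ L := by
    field_simp
  rw [e, div_lt_one h6] at h5
  exact h5.le

lemma blockBound_nonneg (hC : 0 ≤ C) (t : ℕ) : 0 ≤ blockBound d k L C t := by
  unfold blockBound
  split_ifs <;> positivity

/-- The coefficient of the terms that disappear at high levels. -/
noncomputable def minorCoeff (d k : ℕ) (C : ℝ) : ℝ :=
  9072 * scale d k + 3024 * scale d k * C * (2 ^ (d + 2)) ^ 2 * (scale d k : ℝ) ^ 2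

/-- A bound for the total contribution of all pairs of blocks. -/
noncomputable def pairConst (d : ℕ) (C : ℝ) : ℝ :=
  3024 * √((d : ℝ) + 2) + 1 + 108 * 2 ^ (d + 2) * (1 + 2 * C)

lemma blockBound_le (hC : 0 ≤ C) (t : ℕ) : blockBound d k L C t ≤
    1512 * √((d : ℝ) + 2) * √((4 : ℝ) ^ (L + 2)) / ((4 : ℝ) ^ (L + 2)) ^ 2 * (1 / √((t : ℝ) + 1))
    + ((if t < 6 * (L + 2) then 1512 * (scale d k : ℝ) * 2 ^ L / ((4 : ℝ) ^ (L + 2)) ^ 2 else 0)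
    + 3024 * (scale d k : ℝ) * C * (2 ^ (d + 2)) ^ 2 * (scale d k : ℝ) ^ 2
        * (2 ^ L / ((4 : ℝ) ^ (L + 2)) ^ 3))
    + 54 * 2 ^ (d + 2) * (1 + 2 * C) / 4 ^ (L + 2) * (1 / 2) ^ t := by
  unfold blockBound
  rw [Real.sqrt_mul (by positivity)]
  refine add_le_add (add_le_add (le_of_eq (by ring)) ?_) (le_of_eq ?_)
  · split_ifs with h
    · have : 0 ≤ 3024 * (scale d k : ℝ) * C * (2 ^ (d + 2)) ^ 2 * (scale d k : ℝ) ^ 2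
        * (2 ^ L / ((4 : ℝ) ^ (L + 2)) ^ 3) := by positivity
      linarith
    · rw [zero_add]
      have e : ((4 : ℝ) ^ (L + 2)) ^ 3 = 2 ^ (6 * (L + 2)) := by
        rw [← pow_mul, show (4 : ℝ) = 2 ^ 2 by norm_num, ← pow_mul]; congr 1; ring
      have h2 : ((4 : ℝ) ^ (L + 2)) ^ 3 ≤ 2 ^ t := by
        rw [e]; exact pow_le_pow_right₀ (by norm_num) (not_lt.1 h)
      calc _ = 3024 * (scale d k : ℝ) * C * (2 ^ (d + 2)) ^ 2 * (scale d k : ℝ) ^ 2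
            * (2 ^ L / 2 ^ t) := by ring
        _ ≤ _ := by gcongr
  · rw [one_div, inv_pow]; field_simp

lemma sum_blockBound_le (hC : 0 ≤ C) {b : ℕ} (hb : b ≤ 4 ^ (L + 2))
    (hL : minorCoeff d k C * (L + 2) ≤ 2 ^ L) :
    b * ∑ t ∈ Finset.range b, blockBound d k L C t ≤ pairConst d C := by
  set u : ℝ := (4 : ℝ) ^ (L + 2) with hu
  have hu0 : 0 < u := by positivity
  have hb' : (b : ℝ) ≤ u := by rw [hu]; exact_mod_cast hb
  have huL : u = 16 * (2 ^ L) ^ 2 := by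
    rw [hu, ← pow_mul, mul_comm L 2, pow_mul]; norm_num; ring
  have hL1 : (1 : ℝ) ≤ 2 ^ L := one_le_pow₀ (by norm_num)
  have hsu := Real.sq_sqrt hu0.le
  have h1 : ∑ t ∈ Finset.range b, 1512 * √((d : ℝ) + 2) * √u / u ^ 2 * (1 / √((t : ℝ) + 1))
      ≤ 3024 * √((d : ℝ) + 2) / u := by
    rw [← Finset.mul_sum]
    calc _ ≤ 1512 * √((d : ℝ) + 2) * √u / u ^ 2 * (2 * √u) := by
          gcongr
          exact (sum_inv_sqrt_le b).trans (by gcongr)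
      _ = 3024 * √((d : ℝ) + 2) * √u ^ 2 / u ^ 2 := by ring
      _ = _ := by rw [hsu]; field_simp
  have h2 : ∑ t ∈ Finset.range b,
      (if t < 6 * (L + 2) then 1512 * (scale d k : ℝ) * 2 ^ L / u ^ 2 else 0)
      ≤ 6 * (L + 2) * (1512 * (scale d k : ℝ) * 2 ^ L / u ^ 2) := by
    rw [← Finset.sum_filter, Finset.sum_const, nsmul_eq_mul]
    gcongr
    have : ((Finset.range b).filter fun t => t < 6 * (L + 2)).card ≤ 6 * (L + 2) := by
      calc _ ≤ (Finset.range (6 * (L + 2))).card := by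
            apply Finset.card_le_card
            intro t ht
            simpa using (Finset.mem_filter.1 ht).2
        _ = _ := Finset.card_range _
    exact_mod_cast this
  set M₂ := 3024 * (scale d k : ℝ) * C * (2 ^ (d + 2)) ^ 2 * (scale d k : ℝ) ^ 2 with hM₂
  have hM₂0 : 0 ≤ M₂ := by positivity
  have h3 : ∑ t ∈ Finset.range b, M₂ * (2 ^ L / u ^ 3) ≤ M₂ * 2 ^ L / u ^ 2 := by
    rw [Finset.sum_const, nsmul_eq_mul, Finset.card_range]
    calc (b : ℝ) * (M₂ * (2 ^ L / u ^ 3)) ≤ u * (M₂ * (2 ^ L / u ^ 3)) := by gcongr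
      _ = _ := by field_simp
  have h4 : ∑ t ∈ Finset.range b, 54 * 2 ^ (d + 2) * (1 + 2 * C) / u * (1 / 2 : ℝ) ^ t
      ≤ 108 * 2 ^ (d + 2) * (1 + 2 * C) / u := by
    rw [← Finset.mul_sum]
    calc _ ≤ 54 * 2 ^ (d + 2) * (1 + 2 * C) / u * 2 := by
          gcongr
          exact sum_geometric_two_le b
      _ = _ := by ring
  have hsum : ∑ t ∈ Finset.range b, blockBound d k L C t ≤ 3024 * √((d : ℝ) + 2) / u
      + (6 * (L + 2) * (1512 * (scale d k : ℝ) * 2 ^ L / u ^ 2) + M₂ * 2 ^ L / u ^ 2)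
      + 108 * 2 ^ (d + 2) * (1 + 2 * C) / u := by
    refine (Finset.sum_le_sum fun t _ => blockBound_le hC t).trans ?_
    rw [Finset.sum_add_distrib, Finset.sum_add_distrib, Finset.sum_add_distrib]
    exact add_le_add (add_le_add h1 (add_le_add h2 h3)) h4
  have hmid : u * (6 * (L + 2) * (1512 * (scale d k : ℝ) * 2 ^ L / u ^ 2) + M₂ * 2 ^ L / u ^ 2)
      ≤ 1 := by
    have e : u * (6 * (L + 2) * (1512 * (scale d k : ℝ) * 2 ^ L / u ^ 2) + M₂ * 2 ^ L / u ^ 2)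
        = (9072 * (scale d k : ℝ) * (L + 2) + M₂) * 2 ^ L / u := by field_simp; ring
    rw [e, div_le_one hu0, huL]
    have : 9072 * (scale d k : ℝ) * (L + 2) + M₂ ≤ 2 ^ L := by
      refine le_trans ?_ hL
      rw [minorCoeff, ← hM₂]
      have : (0 : ℝ) ≤ L := by positivity
      nlinarith
    nlinarith
  have h0 : 0 ≤ ∑ t ∈ Finset.range b, blockBound d k L C t :=
    Finset.sum_nonneg fun t _ => blockBound_nonneg hC t
  calc _ ≤ u * ∑ t ∈ Finset.range b, blockBound d k L C t := by gcongr
    _ ≤ u * (3024 * √((d : ℝ) + 2) / u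
      + (6 * (L + 2) * (1512 * (scale d k : ℝ) * 2 ^ L / u ^ 2) + M₂ * 2 ^ L / u ^ 2)
      + 108 * 2 ^ (d + 2) * (1 + 2 * C) / u) := by gcongr
    _ = 3024 * √((d : ℝ) + 2)
      + u * (6 * (L + 2) * (1512 * (scale d k : ℝ) * 2 ^ L / u ^ 2) + M₂ * 2 ^ L / u ^ 2)
      + 108 * 2 ^ (d + 2) * (1 + 2 * C) := by field_simp
    _ ≤ _ := by rw [pairConst]; linarith

lemma le_sum_tol {u b : ℕ} (hu : 1 ≤ u) (hb : b ≤ u) :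
    (b : ℝ) / (4 * u) ≤ ∑ n ∈ Finset.Ico (2 ^ u) (2 ^ (u + b)), tol n := by
  induction b with
  | zero => simp
  | succ b ih =>
    have hstep : (1 : ℝ) / (4 * u) ≤ ∑ n ∈ Finset.Ico (2 ^ (u + b)) (2 ^ (u + (b + 1))), tol n := by
      have hle : ∀ n ∈ Finset.Ico (2 ^ (u + b)) (2 ^ (u + (b + 1))),
          1 / ((2 : ℝ) ^ (u + b + 1) * (u + b + 1 : ℕ)) ≤ tol n := by
        intro n hn
        rw [Finset.mem_Ico] at hn
        have : 2 ^ 1 ≤ 2 ^ (u + b) := Nat.pow_le_pow_right (by norm_num) (by omega)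
        exact le_tol_of_lt_two_pow (by omega) hn.2
      have h := Finset.card_nsmul_le_sum _ _ _ hle
      rw [Nat.card_Ico, nsmul_eq_mul] at h
      refine le_trans ?_ h
      have e : 2 ^ (u + (b + 1)) - 2 ^ (u + b) = 2 ^ (u + b) := by rw [← add_assoc, pow_succ]; omega
      rw [e]
      push_cast
      have hu' : (1 : ℝ) ≤ u := by exact_mod_cast hu
      have hb' : (b : ℝ) + 1 ≤ u := by exact_mod_cast hb
      calc (1 : ℝ) / (4 * u) ≤ 1 / (2 * (u + b + 1)) := by
            apply one_div_le_one_div_of_le (by positivity); linarith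
        _ = _ := by rw [pow_succ]; field_simp
    have hcons := Finset.sum_Ico_consecutive tol
      (Nat.pow_le_pow_right (n := 2) (by norm_num) (Nat.le_add_right u b))
      (Nat.pow_le_pow_right (n := 2) (by norm_num) (show u + b ≤ u + (b + 1) by omega))
    rw [← hcons]
    have := ih (by omega)
    push_cast
    have e : ((b : ℝ) + 1) / (4 * u) = b / (4 * u) + 1 / (4 * u) := by ring
    rw [e]
    exact add_le_add this hstep

lemma sum_inter_hitSet_le (hd : 2 ≤ d) (hF : Growth F d n₀) (hSI : SumInvBound F d C N₀)
    (hC : 1 ≤ C) (h : HalfTree d k L z T) (hkL : k ≤ L) (hn₀ : n₀ ≤ 2 ^ (4 ^ (L + 2)))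
    (hN₀ : N₀ ≤ 2 ^ (4 ^ (L + 2)))
    (hL : (minorCoeff d k C + 2 * C * scale d k) * (L + 2) ≤ 2 ^ L) :
    ∑ x ∈ (Finset.Ico (2 ^ (4 ^ (L + 2))) (2 ^ (4 ^ (L + 2) + 4 ^ (L + 2) / (2 * d))) ×ˢ
      Finset.Ico (2 ^ (4 ^ (L + 2))) (2 ^ (4 ^ (L + 2) + 4 ^ (L + 2) / (2 * d)))).filter
        (fun x => x.1 < x.2),
      ((hitSet F d L (T L) x.1 ∩ hitSet F d L (T L) x.2).card : ℝ)
      ≤ pairConst d C * ((T L).card * desc d L (L + 3)) := by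
  classical
  have hpb := fun n j => exists_pair_bound (n := n) (j := j) hd hF hn₀ h hkL
  set u := 4 ^ (L + 2) with hu
  set b := u / (2 * d) with hb
  have hbu : b ≤ u := Nat.div_le_self _ _
  have hb4 : 4 * b ≤ u := by
    have := Nat.div_mul_le_self u (2 * d)
    rw [← hb] at this
    calc 4 * b ≤ 2 * d * b := by gcongr; omega
      _ = b * (2 * d) := by ring
      _ ≤ u := this
  set W : ℝ := (T L).card * desc d L (L + 3) with hW
  set X : ℕ × ℕ → ℝ := fun x => ((hitSet F d L (T L) x.1 ∩ hitSet F d L (T L) x.2).card : ℝ) with hX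
  set R := (Finset.Ico (2 ^ u) (2 ^ (u + b)) ×ˢ Finset.Ico (2 ^ u) (2 ^ (u + b))).filter
        (fun x => x.1 < x.2) with hR
  have hmemR : ∀ x ∈ R, 2 ^ u ≤ x.1 ∧ x.1 < x.2 ∧ x.2 < 2 ^ (u + b) := by
    intro x hx
    simp only [hR, Finset.mem_filter, Finset.mem_product, Finset.mem_Ico] at hx
    omega
  have hpq : ∀ x : ℕ × ℕ, ∃ p q : ℕ, x ∈ R → 0 < p ∧ 0 < q ∧ p.Coprime q ∧
      q * (16 * (F x.2 / F x.1) * tol x.1) ≤ 1 ∧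
      (∀ l δ, k ≤ l → l ≤ L → 0 < δ → δ ≤ |q * F x.2 - p * F x.1| →
        X x ≤ 126 * (1 + 2 * scale d l / δ) * 2 ^ (L - l) * W * (tol x.1 * tol x.2)) ∧
      (|q * F x.2 - p * F x.1| ≤ 1 → X x ≤ 27 * W * (F x.1 / F x.2) * tol x.2 / q) := by
    intro x
    by_cases hx : x ∈ R
    · obtain ⟨h1, h2, h3⟩ := hmemR x hx
      obtain ⟨p, q, hpq⟩ := hpb x.1 x.2 h1 h2 h3
      exact ⟨p, q, fun _ => hpq⟩
    · exact ⟨0, 0, fun h => absurd h hx⟩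
  choose p q hpq using hpq
  have hW0 : 0 ≤ W := by positivity
  have hmaps : ∀ x ∈ R, (Nat.log 2 x.1, Nat.log 2 x.2 - Nat.log 2 x.1) ∈
      Finset.Ico u (u + b) ×ˢ Finset.range b := by
    intro x hx
    obtain ⟨h1, h2, h3⟩ := hmemR x hx
    have hp : 0 < 2 ^ u := by positivity
    have g1 : u ≤ Nat.log 2 x.1 := Nat.le_log_of_pow_le (by norm_num) h1
    have g2 : Nat.log 2 x.1 ≤ Nat.log 2 x.2 := Nat.log_mono_right h2.le
    have g3 : Nat.log 2 x.2 < u + b := Nat.log_lt_of_lt_pow (by omega) h3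
    simp only [Finset.mem_product, Finset.mem_Ico, Finset.mem_range]
    omega
  rw [← Finset.sum_fiberwise_of_maps_to hmaps]
  have hfib : ∀ y ∈ Finset.Ico u (u + b) ×ˢ Finset.range b,
      ∑ x ∈ R.filter (fun x => (Nat.log 2 x.1, Nat.log 2 x.2 - Nat.log 2 x.1) = y), X x
        ≤ W * blockBound d k L C y.2 := by
    rintro ⟨a, t⟩ hy
    simp only [Finset.mem_product, Finset.mem_Ico, Finset.mem_range] at hy
    obtain ⟨⟨hua, hab⟩, htb⟩ := hy
    have hfm : ∀ x ∈ R.filter (fun x => (Nat.log 2 x.1, Nat.log 2 x.2 - Nat.log 2 x.1) = (a, t)),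
        x ∈ R ∧ Nat.log 2 x.1 = a ∧ Nat.log 2 x.2 = a + t := by
      intro x hx
      rw [Finset.mem_filter, Prod.mk.injEq] at hx
      have := hmemR x hx.1
      have g2 : Nat.log 2 x.1 ≤ Nat.log 2 x.2 := Nat.log_mono_right this.2.1.le
      exact ⟨hx.1, hx.2.1, by omega⟩
    have hp : 0 < 2 ^ u := by positivity
    by_cases hat : a + t < u + b
    · refine sum_block_le hd hF hSI hC hkL hn₀ hN₀ hua hat ?_ (fun x hx => ?_) hW0
        (p := p) (q := q) (fun x hx => hpq x (hfm x hx).1)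
      · have h1 : (0 : ℝ) ≤ minorCoeff d k C := by unfold minorCoeff; positivity
        have h2 : 2 * C * scale d k ≤ 2 ^ L := by
          refine le_trans ?_ hL
          have : (0 : ℝ) ≤ L := by positivity
          have : 0 ≤ 2 * C * scale d k := by positivity
          nlinarith
        have hLu : L < 4 ^ L := Nat.lt_pow_self (by norm_num)
        have hu16 : u = 16 * 4 ^ L := by rw [hu]; ring
        calc 2 * C * scale d k * 2 ^ t ≤ 2 ^ L * 2 ^ t := by gcongr
          _ = 2 ^ (L + t) := by rw [pow_add]
          _ ≤ 2 ^ a := pow_le_pow_right₀ (by norm_num) (by omega)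
      · obtain ⟨hxR, ha, ht⟩ := hfm x hx
        obtain ⟨h1, h2, h3⟩ := hmemR x hxR
        have g1 := Nat.pow_log_le_self 2 (show x.1 ≠ 0 by omega)
        have g2 := Nat.lt_pow_succ_log_self (b := 2) (by norm_num) x.1
        have g3 := Nat.pow_log_le_self 2 (show x.2 ≠ 0 by omega)
        have g4 := Nat.lt_pow_succ_log_self (b := 2) (by norm_num) x.2
        rw [ha] at g1 g2
        rw [ht] at g3 g4
        have e : 2 ^ t * 2 ^ a = 2 ^ (a + t) := by rw [← pow_add, add_comm]
        rw [e]
        rw [Nat.succ_eq_add_one, pow_succ] at g2 g4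
        omega
    · rw [Finset.sum_eq_zero]
      · exact mul_nonneg hW0 (blockBound_nonneg (by linarith) _)
      · intro x hx
        obtain ⟨hxR, ha, ht⟩ := hfm x hx
        obtain ⟨h1, h2, h3⟩ := hmemR x hxR
        have g3 : Nat.log 2 x.2 < u + b := Nat.log_lt_of_lt_pow (by omega) h3
        omega
  refine (Finset.sum_le_sum hfib).trans ?_
  simp only [Finset.sum_product]
  rw [Finset.sum_const, Nat.card_Ico, Nat.add_sub_cancel_left, nsmul_eq_mul,
    ← Finset.mul_sum]
  have hmc : minorCoeff d k C * (L + 2) ≤ 2 ^ L := by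
    refine le_trans ?_ hL
    gcongr
    have : 0 ≤ 2 * C * scale d k := by positivity
    linarith
  have := sum_blockBound_le (by linarith) hbu hmc
  calc (b : ℝ) * (W * ∑ t ∈ Finset.range b, blockBound d k L C t)
      = (b * ∑ t ∈ Finset.range b, blockBound d k L C t) * W := by ring
    _ ≤ _ := by gcongr

theorem hitProp_of_sumInvBound (hd : 2 ≤ d) (hF : Growth F d n₀) (hSI : SumInvBound F d C N₀)
    (hC : 1 ≤ C) : HitProp F d := by
  have hd0 : (0 : ℝ) < d := by exact_mod_cast (by omega : 0 < d)
  have hc : (0 : ℝ) < 1 / (32 * d) := by positivity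
  have hP : 0 ≤ pairConst d C := by unfold pairConst; positivity
  refine ⟨(1 / (32 * d : ℝ)) ^ 2 / (1 / (32 * d) + 2 * pairConst d C), by positivity, fun k => ?_⟩
  obtain ⟨L₀, hL₀⟩ := exists_mul_le_two_pow (minorCoeff d k C + 2 * C * scale d k)
  refine ⟨L₀ + k + n₀ + N₀ + d, fun L hL z T hT => ?_⟩
  have hLu : L < 4 ^ L := Nat.lt_pow_self (by norm_num)
  have hu16 : 4 ^ (L + 2) = 16 * 4 ^ L := four_pow_add_two L
  have hu2 : 4 ^ (L + 2) < 2 ^ 4 ^ (L + 2) := Nat.lt_pow_self (by norm_num)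
  have hsum := sum_inter_hitSet_le hd hF hSI hC hT (by omega) (by omega) (by omega)
    (hL₀ L (by omega))
  rw [mul_assoc]
  refine le_card_of_sum_inter_le _ (hitSet F d L (T L)) _ (fun n hn => ?_) hc hP (by positivity)
    ?_ hsum
  · apply hitSet_subset
    rw [Finset.mem_Ico] at hn
    rw [Finset.mem_Ioc, cutoff, cutoff]
    have hb : 4 ^ (L + 2) / (2 * d) ≤ 4 ^ (L + 2) := Nat.div_le_self _ _
    constructor
    · refine lt_of_lt_of_le ?_ hn.1
      exact Nat.pow_lt_pow_right (by norm_num) (by omega)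
    · refine hn.2.le.trans (Nat.pow_le_pow_right (by norm_num) ?_)
      have : 4 ^ (L + 3) = 4 * 4 ^ (L + 2) := by ring
      omega
  · set W : ℝ := (T L).card * desc d L (L + 3) with hW
    set u := 4 ^ (L + 2) with hu
    set b := u / (2 * d) with hb
    have hbu : b ≤ u := Nat.div_le_self _ _
    have hub : u ≤ 4 * d * b := by
      have h1 : u < (u / (2 * d) + 1) * (2 * d) := by
        have := Nat.lt_mul_div_succ u (show 0 < 2 * d by omega)
        linarith
      have h2 : 1 ≤ b := (Nat.one_le_div_iff (by omega)).2 (by omega)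
      rw [← hb] at h1
      have h3 : 2 * d ≤ 2 * d * b := Nat.le_mul_of_pos_right _ h2
      have e1 : (b + 1) * (2 * d) = 2 * d * b + 2 * d := by ring
      have e2 : 4 * d * b = 2 * d * b + 2 * d * b := by ring
      omega
    have hub' : (u : ℝ) ≤ 4 * d * b := by exact_mod_cast hub
    have hu0 : (0 : ℝ) < u := by exact_mod_cast (by omega : 0 < u)
    have hst := le_sum_tol (show 1 ≤ u by omega) hbu
    have h1 : 1 / (16 * d : ℝ) ≤ ∑ n ∈ Finset.Ico (2 ^ u) (2 ^ (u + b)), tol n := by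
      refine le_trans ?_ hst
      rw [div_le_div_iff₀ (by positivity) (by positivity)]
      linarith
    calc 1 / (32 * d : ℝ) * W = 1 / (16 * d : ℝ) * (W / 2) := by ring
      _ ≤ (∑ n ∈ Finset.Ico (2 ^ u) (2 ^ (u + b)), tol n) * (W / 2) := by gcongr
      _ = ∑ n ∈ Finset.Ico (2 ^ u) (2 ^ (u + b)), tol n / 2 * W := by
          rw [Finset.sum_mul]; exact Finset.sum_congr rfl fun n _ => by ring
      _ ≤ _ := Finset.sum_le_sum fun n hn => ?_
    rw [Finset.mem_Ico] at hn
    have h16 : 2 ^ 16 ≤ 2 ^ u := Nat.pow_le_pow_right (by norm_num) (by omega)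
    have hn2 : 2 ≤ n := by omega
    refine le_card_hitSet (four_mul_scale_le (by omega) hF (by omega) hn.1) ?_
      (growth_le_tol_mul_scale hF (by omega) hn2 ?_)
    · refine (tol_le_of_two_pow_le (by omega) hn.1).trans_lt ?_
      rw [div_lt_div_iff₀ (by positivity) (by norm_num)]
      have g1 : (2 ^ 16 : ℝ) ≤ 2 ^ u := pow_le_pow_right₀ (by norm_num) (by omega)
      have g2 : (1 : ℝ) ≤ u := by exact_mod_cast (by omega : 1 ≤ u)
      nlinarith
    · refine hn.2.trans_le (Nat.pow_le_pow_right (by norm_num) ?_)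
      omega

end

lemma card_le_of_separated {ι : Type*} (P : Finset ι) (γ : ι → ℝ) {s x r : ℝ} (hs : 0 < s)
    (hr : 0 ≤ r) (hsep : ∀ i ∈ P, ∀ j ∈ P, i ≠ j → s ≤ |γ i - γ j|)
    (h : ∀ i ∈ P, |γ i - x| ≤ r) : (P.card : ℝ) ≤ 2 * r / s + 1 := by
  classical
  have hinj : Set.InjOn (fun i => ⌊(γ i - x + r) / s⌋) P := by
    intro i hi j hj hij
    by_contra hne
    have h1 := hsep i hi j hj hne
    have h2 : |(γ i - x + r) / s - (γ j - x + r) / s| < 1 :=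
      Int.abs_sub_lt_one_of_floor_eq_floor hij
    rw [← sub_div, abs_div, abs_of_pos hs, div_lt_one hs] at h2
    rw [show γ i - x + r - (γ j - x + r) = γ i - γ j by ring] at h2
    linarith
  have hsub : P.image (fun i => ⌊(γ i - x + r) / s⌋) ⊆ Finset.Icc 0 ⌊2 * r / s⌋ := by
    intro v hv
    obtain ⟨i, hi, rfl⟩ := Finset.mem_image.1 hv
    have h1 := abs_le.1 (h i hi)
    rw [Finset.mem_Icc]
    exact ⟨Int.floor_nonneg.2 (div_nonneg (by linarith) hs.le),
      Int.floor_le_floor (by gcongr; linarith)⟩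
  have h1 := Finset.card_le_card hsub
  rw [Finset.card_image_of_injOn hinj, Int.card_Icc, sub_zero] at h1
  have h2 : 0 ≤ ⌊2 * r / s⌋ := Int.floor_nonneg.2 (by positivity)
  have h3 : (P.card : ℤ) ≤ ⌊2 * r / s⌋ + 1 := by omega
  have h4 : (P.card : ℝ) ≤ ⌊2 * r / s⌋ + 1 := by exact_mod_cast h3
  linarith [Int.floor_le (2 * r / s)]

lemma card_near_fractions_le {β I : ℝ} {N M : ℕ} (hN : 0 < N) (hI : 0 < I) (y : ℤ)
    (B : Finset (ℕ × ℤ)) (D : ℕ × ℤ → ℕ) (e : ℕ × ℤ → ℤ)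
    (hB : ∀ x ∈ B, N ≤ x.1 ∧ x.1 < N + M ∧ 0 < x.1 + β ∧ x.1 + β ≤ 4 * N ∧
      y / I ≤ x.2 / (x.1 + β) ∧ x.2 / (x.1 + β) ≤ (y + 1) / I)
    (hD : ∀ x ∈ B, 1 ≤ D x ∧ D x < M ∧ IsCoprime (e x) (D x : ℤ) ∧
      |x.2 / (x.1 + β) * D x - e x| ≤ 1 / (16 * N)) :
    (B.card : ℝ) ≤ 2 * M ^ 2 / I + 9 * M * √M := by
  classical
  have hN' : (0 : ℝ) < N := by exact_mod_cast hN
  have hN1 : (1 : ℝ) ≤ N := by exact_mod_cast hN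
  -- the points close to a given fraction
  have hfib : ∀ D₀ e₀, 1 ≤ D₀ →
      (((B.filter fun x => D x = D₀).filter fun x => e x = e₀).card : ℝ) ≤ M / D₀ + 1 := by
    intro D₀ e₀ hD₀
    set S := (B.filter fun x => D x = D₀).filter fun x => e x = e₀ with hS
    have hmem : ∀ x ∈ S, x ∈ B ∧ D x = D₀ ∧ e x = e₀ := by
      intro x hx
      simp only [hS, Finset.mem_filter] at hx
      exact ⟨hx.1.1, hx.1.2, hx.2⟩
    have hD₀' : (D₀ : ℤ) ≠ 0 := by exact_mod_cast (by omega : D₀ ≠ 0)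
    have hclose : ∀ x ∈ S, |x.2 * D₀ - e₀ * x.1 - e₀ * β| ≤ 1 / 4 := by
      intro x hx
      obtain ⟨hxB, h1, h2⟩ := hmem x hx
      obtain ⟨-, -, h3, h4, -⟩ := hB x hxB
      have h5 := (hD x hxB).2.2.2
      rw [h1, h2] at h5
      have e1 : (x.2 : ℝ) * D₀ - e₀ * x.1 - e₀ * β = (x.2 / (x.1 + β) * D₀ - e₀) * (x.1 + β) := by
        field_simp; ring
      rw [e1, abs_mul, abs_of_pos h3]
      calc _ ≤ 1 / (16 * (N : ℝ)) * (4 * N) := by gcongr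
        _ = 1 / 4 := by field_simp; norm_num
    have hdet : ∀ x ∈ S, ∀ x' ∈ S, (x.2 - x'.2) * (D₀ : ℤ) = e₀ * ((x.1 : ℤ) - x'.1) := by
      intro x hx x' hx'
      have h1 := abs_le.1 (hclose x hx)
      have h2 := abs_le.1 (hclose x' hx')
      have h3 : |(((x.2 - x'.2) * (D₀ : ℤ) - e₀ * ((x.1 : ℤ) - x'.1) : ℤ) : ℝ)| < 1 := by
        push_cast
        rw [abs_lt]
        constructor <;> linarith
      generalize hv : (x.2 - x'.2) * (D₀ : ℤ) - e₀ * ((x.1 : ℤ) - x'.1) = v at h3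
      have h4 := Int.abs_lt_one_iff.1 (by exact_mod_cast h3)
      linarith
    have hinj : Set.InjOn (fun x : ℕ × ℤ => (x.1 : ℤ)) S := by
      intro x hx x' hx' h
      have h1 := hdet x hx x' hx'
      simp only at h
      rw [h, sub_self, mul_zero, mul_eq_zero, or_iff_left hD₀'] at h1
      exact Prod.ext (by exact_mod_cast h) (by linarith)
    rw [← Finset.card_image_of_injOn hinj]
    refine card_int_dvd_le (x := N) _ (by positivity) hD₀ (fun i hi => ?_) fun i hi j hj => ?_
    · obtain ⟨x, hx, rfl⟩ := Finset.mem_image.1 hi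
      obtain ⟨h1, h2, -⟩ := hB x (hmem x hx).1
      exact ⟨by exact_mod_cast h1, by exact_mod_cast h2.le⟩
    · obtain ⟨x, hx, rfl⟩ := Finset.mem_image.1 hi
      obtain ⟨x', hx', rfl⟩ := Finset.mem_image.1 hj
      obtain ⟨hxB, h1, h2⟩ := hmem x hx
      have hco := (hD x hxB).2.2.1
      rw [h1, h2] at hco
      refine hco.symm.dvd_of_dvd_mul_left (Dvd.intro_left _ (hdet x hx x' hx'))
  have himg : ∀ D₀, 1 ≤ D₀ →
      (((B.filter fun x => D x = D₀).image e).card : ℝ) ≤ D₀ / I + 3 := by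
    intro D₀ hD₀
    have h := card_int_le (x := y * D₀ / I - 1) (v := D₀ / I + 2)
      ((B.filter fun x => D x = D₀).image e) (by positivity) fun i hi => ?_
    · linarith
    obtain ⟨x, hx, rfl⟩ := Finset.mem_image.1 hi
    obtain ⟨hxB, h1⟩ := Finset.mem_filter.1 hx
    obtain ⟨-, -, -, -, h3, h4⟩ := hB x hxB
    have h5 := (hD x hxB).2.2.2
    rw [h1] at h5
    have h6 : 1 / (16 * (N : ℝ)) ≤ 1 := by
      rw [div_le_one (by positivity)]; linarith
    have h7 := abs_le.1 (h5.trans h6)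
    have h8 : (y / I) * D₀ ≤ x.2 / (x.1 + β) * D₀ := by gcongr
    have h9 : x.2 / (x.1 + β) * D₀ ≤ (y + 1) / I * D₀ := by gcongr
    have e1 : (y : ℝ) * D₀ / I = y / I * D₀ := by ring
    have e2 : ((y : ℝ) + 1) / I * D₀ = y / I * D₀ + D₀ / I := by ring
    rw [e1]
    constructor <;> linarith
  have hmaps : ∀ x ∈ B, D x ∈ Finset.Ico 1 M := by
    intro x hx
    obtain ⟨h1, h2, -⟩ := hD x hx
    exact Finset.mem_Ico.2 ⟨h1, h2⟩
  have hterm : ∀ i ∈ Finset.range (M - 1), ((B.filter fun x => D x = 1 + i).card : ℝ)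
      ≤ 2 * M / I + 3 * M * (1 / √((i : ℝ) + 1)) + 3 := by
    intro i hi
    rw [Finset.mem_range] at hi
    have h1 := card_le_mul_image (B.filter fun x => D x = 1 + i) e
      (fun b _ => hfib (1 + i) b (by omega))
    have h2 := himg (1 + i) (by omega)
    have hi1 : ((i : ℝ) + 1) ≤ M := by exact_mod_cast (by omega : i + 1 ≤ M)
    have hi0 : (0 : ℝ) < (i : ℝ) + 1 := by positivity
    push_cast at h1 h2
    rw [add_comm 1 (i : ℝ)] at h1 h2
    have h3 : 1 / ((i : ℝ) + 1) ≤ 1 / √((i : ℝ) + 1) := by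
      apply one_div_le_one_div_of_le (Real.sqrt_pos.2 hi0)
      exact Real.sqrt_le_left (by positivity) |>.2 (by nlinarith)
    calc _ ≤ (M / ((i : ℝ) + 1) + 1) * (((i : ℝ) + 1) / I + 3) := h1.trans (by gcongr)
      _ = M / I + 3 * M * (1 / ((i : ℝ) + 1)) + ((i : ℝ) + 1) / I + 3 := by field_simp; ring
      _ ≤ M / I + 3 * M * (1 / √((i : ℝ) + 1)) + M / I + 3 := by gcongr
      _ = _ := by ring
  rw [Finset.card_eq_sum_card_fiberwise hmaps, Finset.sum_Ico_eq_sum_range]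
  push_cast
  refine (Finset.sum_le_sum hterm).trans ?_
  rw [Finset.sum_add_distrib, Finset.sum_add_distrib, ← Finset.mul_sum]
  simp only [Finset.sum_const, Finset.card_range, nsmul_eq_mul]
  have hM1 : ((M - 1 : ℕ) : ℝ) ≤ M := by exact_mod_cast Nat.sub_le M 1
  have hsq : (M : ℝ) ≤ M * √M := by
    rcases Nat.eq_zero_or_pos M with h | h
    · simp [h]
    · have : 1 ≤ √(M : ℝ) := Real.one_le_sqrt.2 (by exact_mod_cast h)
      nlinarith [(Nat.cast_nonneg M : (0 : ℝ) ≤ M)]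
  have hs2 := sum_inv_sqrt_le (M - 1)
  have hs3 : √((M - 1 : ℕ) : ℝ) ≤ √M := Real.sqrt_le_sqrt hM1
  calc _ ≤ (M : ℝ) * (2 * M / I) + 3 * M * (2 * √M) + M * 3 := by
        gcongr
        exact hs2.trans (by gcongr)
    _ ≤ (M : ℝ) * (2 * M / I) + 3 * M * (2 * √M) + M * √M * 3 := by gcongr
    _ = _ := by ring

lemma mem_innerInts_bounds {d L : ℕ} {F η : ℝ} {y a : ℤ} (hF : 0 < F) (hη : 0 ≤ η)
    (ha : a ∈ innerInts d L F η y) :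
    y / scale d L ≤ a / F ∧ a / F ≤ ((y : ℝ) + 1) / scale d L := by
  rw [innerInts, Finset.mem_Ico, Int.ceil_le, Int.lt_ceil] at ha
  rw [le_div_iff₀ hF, div_le_iff₀ hF]
  have e1 : (y : ℝ) / scale d L * F = y * F / scale d L := by ring
  have e2 : ((y : ℝ) + 1) / scale d L * F = (y + 1) * F / scale d L := by ring
  constructor <;> linarith

/-- A positive proportion of the points `a / (n + β)` with `n` in a dyadic block, lying in a given
cell, are well separated. -/
lemma exists_separated_points {β : ℝ} {L M N : ℕ} (hM : 1 ≤ M) (hNM : N = 32 * M)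
    (hF : ∀ n, N ≤ n → n < N + M → N / 2 ≤ n + β ∧ n + β ≤ 4 * N ∧ 4 * scale 1 L ≤ n + β ∧
      tol n ≤ 1 / 2)
    (hL : 144 * (scale 1 L : ℝ) ≤ √N) (y : ℤ) :
    ∃ P : Finset (ℕ × ℤ), (∀ x ∈ P, N ≤ x.1 ∧ x.1 < N + M ∧
        x.2 ∈ innerInts 1 L (x.1 + β) (tol x.1) y) ∧
      (∀ x ∈ P, ∀ x' ∈ P, x ≠ x' →
        1 / (64 * (N : ℝ) ^ 2) ≤ |x.2 / (x.1 + β) - x'.2 / (x'.1 + β)|) ∧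
      (N : ℝ) ^ 2 / (256 * scale 1 L) ≤ P.card := by
  classical
  have hI := scale_pos' 1 L
  have hN' : (0 : ℝ) < N := by exact_mod_cast (by omega : 0 < N)
  have hN1 : (1 : ℝ) ≤ N := by exact_mod_cast (by omega : 1 ≤ N)
  set A : Finset (ℕ × ℤ) := (Finset.Ico N (N + M)).biUnion fun n =>
    (innerInts 1 L (n + β) (tol n) y).image (Prod.mk n) with hA
  have hmemA : ∀ x ∈ A, N ≤ x.1 ∧ x.1 < N + M ∧ x.2 ∈ innerInts 1 L (x.1 + β) (tol x.1) y := by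
    intro x hx
    simp only [hA, Finset.mem_biUnion, Finset.mem_image, Finset.mem_Ico] at hx
    obtain ⟨n, hn, a, ha, rfl⟩ := hx
    exact ⟨hn.1, hn.2, ha⟩
  have hcardA : (M : ℝ) * (N / (4 * scale 1 L)) ≤ A.card := by
    rw [hA, Finset.card_biUnion]
    · push_cast
      have h : ∀ n ∈ Finset.Ico N (N + M), (N : ℝ) / (4 * scale 1 L) ≤
          (((innerInts 1 L (n + β) (tol n) y).image (Prod.mk n)).card : ℝ) := by
        intro n hn
        rw [Finset.mem_Ico] at hn
        obtain ⟨h1, h2, h3, h4⟩ := hF n hn.1 hn.2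
        rw [Finset.card_image_of_injective _ (Prod.mk_right_injective n)]
        refine le_trans ?_ (le_card_innerInts h3 h4 y)
        calc (N : ℝ) / (4 * scale 1 L) = N / 2 / (2 * scale 1 L) := by ring
          _ ≤ _ := by gcongr
      have := Finset.card_nsmul_le_sum _ _ _ h
      rwa [Nat.card_Ico, Nat.add_sub_cancel_left, nsmul_eq_mul] at this
    · intro n _ m _ hnm
      refine Finset.disjoint_left.2 fun x h1 h2 => ?_
      simp only [Finset.mem_image] at h1 h2
      obtain ⟨a, -, rfl⟩ := h1
      obtain ⟨b, -, hb⟩ := h2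
      exact hnm (Prod.mk.inj hb).1.symm
  have hfacts : ∀ x ∈ A, N / 2 ≤ x.1 + β ∧ (x.1 : ℝ) + β ≤ 4 * N ∧ 0 < x.1 + β ∧
      y / (scale 1 L : ℝ) ≤ x.2 / (x.1 + β) ∧ x.2 / (x.1 + β) ≤ ((y : ℝ) + 1) / scale 1 L := by
    intro x hx
    obtain ⟨h1, h2, h3⟩ := hmemA x hx
    obtain ⟨h4, h5, -⟩ := hF _ h1 h2
    have h6 : 0 < x.1 + β := by linarith
    have h7 := mem_innerInts_bounds h6 (tol_pos (by omega)).le h3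
    exact ⟨h4, h5, h6, h7.1, h7.2⟩
  let Bad : ℕ × ℤ → Prop := fun x => ∃ D : ℕ, ∃ e : ℤ, 1 ≤ D ∧ D < M ∧ IsCoprime e (D : ℤ) ∧
      |x.2 / (x.1 + β) * D - e| ≤ 1 / (16 * (N : ℝ))
  have hbad : ((A.filter Bad).card : ℝ) ≤ 2 * M ^ 2 / scale 1 L + 9 * M * √M := by
    have hch : ∀ x : ℕ × ℤ, ∃ D : ℕ, ∃ e : ℤ, Bad x → 1 ≤ D ∧ D < M ∧ IsCoprime e (D : ℤ) ∧
      |x.2 / (x.1 + β) * D - e| ≤ 1 / (16 * (N : ℝ)) := by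
      intro x
      by_cases h : Bad x
      · obtain ⟨D, e, h⟩ := h
        exact ⟨D, e, fun _ => h⟩
      · exact ⟨0, 0, fun h' => absurd h' h⟩
    choose D e hDe using hch
    refine card_near_fractions_le (by omega) hI y (A.filter Bad) D e (fun x hx => ?_)
      fun x hx => hDe x (Finset.mem_filter.1 hx).2
    have hx := (Finset.mem_filter.1 hx).1
    obtain ⟨h1, h2, h3, h4, h5⟩ := hfacts x hx
    exact ⟨(hmemA x hx).1, (hmemA x hx).2.1, h3, h2, h4, h5⟩
  refine ⟨A.filter fun x => ¬ Bad x, fun x hx => hmemA x (Finset.mem_filter.1 hx).1, ?_, ?_⟩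
  · -- it suffices to consider points with increasing denominators
    have hlt : ∀ x ∈ A.filter (fun x => ¬ Bad x), ∀ x' ∈ A.filter (fun x => ¬ Bad x), x.1 < x'.1 →
        1 / (64 * (N : ℝ) ^ 2) ≤ |x.2 / (x.1 + β) - x'.2 / (x'.1 + β)| := by
      intro x hx x' hx' hlt
      obtain ⟨hxA, hxb⟩ := Finset.mem_filter.1 hx
      obtain ⟨hxA', -⟩ := Finset.mem_filter.1 hx'
      obtain ⟨h1, h2, h3, -⟩ := hfacts x hxA
      obtain ⟨h1', h2', h3', -⟩ := hfacts x' hxA'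
      by_contra hcon
      rw [not_le] at hcon
      apply hxb
      set D := x'.1 - x.1 with hD
      set e := x'.2 - x.2 with he
      have hD0 : 0 < D := by omega
      have hDM : D < M := by have := hmemA x hxA; have := hmemA x' hxA'; omega
      have hDe : |x.2 / (x.1 + β) * D - e| ≤ 1 / (16 * (N : ℝ)) := by
        have e1 : x.2 / (x.1 + β) * D - e
            = (x.2 / (x.1 + β) - x'.2 / (x'.1 + β)) * (x'.1 + β) := by
          rw [hD, he, Nat.cast_sub hlt.le]; push_cast; field_simp; ring
        rw [e1, abs_mul, abs_of_pos h3']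
        calc _ ≤ 1 / (64 * (N : ℝ) ^ 2) * (4 * N) := by gcongr
          _ = _ := by field_simp; norm_num
      set g := Int.gcd e D with hg
      have hg0 : 0 < g := Int.gcd_pos_of_ne_zero_right _ (by exact_mod_cast hD0.ne')
      obtain ⟨e', he'⟩ : (g : ℤ) ∣ e := Int.gcd_dvd_left ..
      obtain ⟨D', hD'⟩ : g ∣ D := by exact_mod_cast (Int.gcd_dvd_right e (D : ℤ))
      have hD'0 : 0 < D' := Nat.pos_of_mul_pos_left (hD' ▸ hD0)
      have hg1 : (1 : ℝ) ≤ g := by exact_mod_cast hg0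
      refine ⟨D', e', hD'0, ?_, ?_, ?_⟩
      · calc D' ≤ g * D' := Nat.le_mul_of_pos_left _ hg0
          _ < M := hD' ▸ hDM
      · rw [Int.isCoprime_iff_gcd_eq_one]
        have h5 : g * Int.gcd e' D' = g * 1 := by
          rw [mul_one]
          conv_rhs => rw [hg, he', hD']
          push_cast
          rw [Int.gcd_mul_left]; simp
        exact Nat.eq_of_mul_eq_mul_left hg0 h5
      · refine le_trans ?_ hDe
        have e2 : x.2 / (x.1 + β) * D - e = g * (x.2 / (x.1 + β) * D' - e') := by
          rw [he', hD']; push_cast; ring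
        rw [e2, abs_mul, abs_of_pos (by linarith : (0 : ℝ) < g)]
        exact le_mul_of_one_le_left (abs_nonneg _) hg1
    intro x hx x' hx' hne
    rcases lt_trichotomy x.1 x'.1 with h | h | h
    · exact hlt x hx x' hx' h
    · have hne2 : x.2 ≠ x'.2 := fun h2 => hne (Prod.ext h h2)
      obtain ⟨h1, h2, h3, -⟩ := hfacts x (Finset.mem_filter.1 hx).1
      rw [← h, ← sub_div, abs_div, abs_of_pos h3, div_le_div_iff₀ (by positivity) h3]
      have h4 : (1 : ℝ) ≤ |(x.2 : ℝ) - x'.2| := by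
        exact_mod_cast Int.one_le_abs (sub_ne_zero.2 hne2)
      nlinarith
    · rw [abs_sub_comm]
      exact hlt x' hx' x hx h
  · have hsplit := Finset.card_filter_add_card_filter_not (s := A) Bad
    have hsplit' : ((A.filter Bad).card : ℝ) + (A.filter fun x => ¬ Bad x).card = A.card := by
      exact_mod_cast hsplit
    have hM0 : (0 : ℝ) < M := by exact_mod_cast hM
    have hNM' : (N : ℝ) = 32 * M := by exact_mod_cast hNM
    have hMN : √(M : ℝ) ≤ √N := Real.sqrt_le_sqrt (by linarith)
    have hsq := Real.sq_sqrt hN'.le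
    have h1 : 9 * M * √M ≤ M * N / (16 * scale 1 L) := by
      rw [le_div_iff₀ (by positivity)]
      calc 9 * M * √(M : ℝ) * (16 * scale 1 L) = M * √M * (144 * scale 1 L) := by ring
        _ ≤ M * √N * √N := by gcongr
        _ = M * N := by rw [mul_assoc, ← sq, hsq]
    have h2 : 2 * (M : ℝ) ^ 2 / scale 1 L = M * N / (16 * scale 1 L) := by
      rw [hNM']; field_simp; ring
    have h3 : (M : ℝ) * (N / (4 * scale 1 L)) = 4 * (M * N / (16 * scale 1 L)) := by
      field_simp; ring
    have h4 : (N : ℝ) ^ 2 / (256 * scale 1 L) = 2 * (M * N / (16 * scale 1 L)) := by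
      rw [hNM']; field_simp; ring
    linarith

section

lemma card_nearInts_le {I F η : ℝ} (h : F ≤ η * I) (hF : 0 < F) (a : ℤ) :
    ((nearInts I F η a).card : ℝ) ≤ 3 * (η * I / F) := by
  have h1 : 1 ≤ η * I / F := by rwa [le_div_iff₀ hF, one_mul]
  have h2 := card_int_le (x := (a - η) * I / F) (v := 2 * (η * I / F)) (nearInts I F η a)
    (by linarith) fun w hw => by
      rw [nearInts, Finset.mem_Icc, Int.ceil_le, Int.le_floor] at hw
      have e : (a - η) * I / F + 2 * (η * I / F) = (a + η) * I / F := by ring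
      rwa [e]
  linarith

lemma card_inter_biUnion_le {ι α : Type*} [DecidableEq α] (P P' : Finset ι) (S S' : ι → Finset α)
    {K B A : ℝ} (hB : 0 ≤ B) (hK : 0 ≤ K) (hA : (P.card : ℝ) ≤ A)
    (hS' : ∀ x ∈ P', ((S' x).card : ℝ) ≤ B)
    (hP : ∀ x ∈ P, ((P'.filter fun x' => ¬ Disjoint (S x) (S' x')).card : ℝ) ≤ K) :
    ((P.biUnion S ∩ P'.biUnion S').card : ℝ) ≤ A * (K * B) := by
  have hsub : P.biUnion S ∩ P'.biUnion S' ⊆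
      P.biUnion fun x => (P'.filter fun x' => ¬ Disjoint (S x) (S' x')).biUnion S' := by
    intro w hw
    simp only [Finset.mem_inter, Finset.mem_biUnion] at hw
    obtain ⟨⟨x, hx, hwx⟩, x', hx', hwx'⟩ := hw
    simp only [Finset.mem_biUnion, Finset.mem_filter]
    exact ⟨x, hx, x', ⟨hx', Finset.not_disjoint_iff.2 ⟨w, hwx, hwx'⟩⟩, hwx'⟩
  calc ((P.biUnion S ∩ P'.biUnion S').card : ℝ)
      ≤ ∑ x ∈ P, ∑ x' ∈ P'.filter (fun x' => ¬ Disjoint (S x) (S' x')), ((S' x').card : ℝ) := by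
        have h1 := (Finset.card_le_card hsub).trans Finset.card_biUnion_le
        refine (Nat.cast_le.2 h1).trans ?_
        push_cast
        refine Finset.sum_le_sum fun x _ => ?_
        exact_mod_cast Finset.card_biUnion_le
    _ ≤ ∑ x ∈ P, K * B := by
        refine Finset.sum_le_sum fun x hx => ?_
        refine (Finset.sum_le_sum fun x' hx' => hS' x' (Finset.mem_filter.1 hx').1).trans ?_
        rw [Finset.sum_const, nsmul_eq_mul]
        gcongr
        exact hP x hx
    _ ≤ _ := by
        rw [Finset.sum_const, nsmul_eq_mul]
        gcongr

variable {β : ℝ} {n₀ L a : ℕ}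

lemma exists_block_hits (hF : Growth (fun n => (n : ℝ) + β) 1 n₀) (hL : 3 ≤ L)
    (hn₀ : n₀ ≤ 2 ^ (4 ^ (L + 2))) (ha : 4 ^ (L + 2) ≤ a) (ha2 : a < 2 * 4 ^ (L + 2)) (y : ℤ) :
    ∃ (P : Finset (ℕ × ℤ)) (γ : ℕ × ℤ → ℝ) (S : ℕ × ℤ → Finset ℤ),
      (∀ x ∈ P, S x ⊆ hitCells (fun n => (n : ℝ) + β) 1 L {y}) ∧
      (∀ x ∈ P, ∀ w ∈ S x, |w / scale 1 (L + 3) - γ x| ≤ 4 / ((2 ^ a) ^ 2 * 4 ^ (L + 2))) ∧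
      (∀ x ∈ P, scale 1 (L + 3) / (16 * (2 ^ a) ^ 2 * 4 ^ (L + 2)) ≤ ((S x).card : ℝ) ∧
        ((S x).card : ℝ) ≤ 12 * scale 1 (L + 3) / ((2 ^ a) ^ 2 * 4 ^ (L + 2))) ∧
      (∀ x ∈ P, ∀ x' ∈ P, x ≠ x' → 1 / (64 * (2 ^ a) ^ 2) ≤ |γ x - γ x'|) ∧
      (2 ^ a) ^ 2 / (256 * scale 1 L) ≤ (P.card : ℝ) ∧
      (P.card : ℝ) ≤ 65 * (2 ^ a) ^ 2 / scale 1 L := by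
  set u := 4 ^ (L + 2) with hu
  have hLu : L < 4 ^ L := Nat.lt_pow_self (by norm_num)
  have hu16 : u = 16 * 4 ^ L := four_pow_add_two L
  have hucast : (4 : ℝ) ^ (L + 2) = u := by rw [hu]; push_cast; rfl
  rw [hucast]
  have hu1 : (1 : ℝ) ≤ u := by exact_mod_cast (by omega : 1 ≤ u)
  have hu0 : (0 : ℝ) < u := by linarith
  have h2u : 2 ^ u ≤ 2 ^ a := Nat.pow_le_pow_right (by norm_num) ha
  have h16 : 2 ^ 16 ≤ 2 ^ u := Nat.pow_le_pow_right (by norm_num) (by omega)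
  have hI := scale_pos' 1 L
  have hI' := scale_pos' 1 (L + 3)
  set N : ℝ := 2 ^ a with hN
  have hN0 : 0 < N := by positivity
  have hNM : 2 ^ a = 32 * 2 ^ (a - 5) := by
    rw [show (32 : ℕ) = 2 ^ 5 by norm_num, ← pow_add]; congr 1; omega
  have hM1 : 1 ≤ 2 ^ (a - 5) := Nat.one_le_pow _ _ (by norm_num)
  have hfacts : ∀ n : ℕ, 2 ^ a ≤ n → n < 2 ^ a + 2 ^ (a - 5) → N / 2 ≤ n + β ∧ (n : ℝ) + β ≤ 4 * N ∧
      4 * scale 1 L ≤ n + β ∧ tol n ≤ 1 / 2 ∧ tol n ≤ 2 / (N * u) ∧ 1 / (4 * N * u) ≤ tol n ∧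
      n + β ≤ tol n * scale 1 (L + 3) := by
    intro n h1 h2
    have h3 := hF n (by omega)
    simp only [pow_one] at h3
    have h1' : N ≤ n := by rw [hN]; exact_mod_cast h1
    have h2' : (n : ℝ) ≤ 2 * N := by rw [hN]; exact_mod_cast (by omega : n ≤ 2 * 2 ^ a)
    have hau : (u : ℝ) ≤ a := by exact_mod_cast ha
    have h4 : tol n ≤ 2 / (N * u) := (tol_le_of_two_pow_le (by omega) h1).trans (by gcongr)
    have h5 : 4 ≤ N := by rw [hN]; exact_mod_cast (by omega : 4 ≤ 2 ^ a)
    refine ⟨by linarith [h3.1], by linarith [h3.2],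
      four_mul_scale_le le_rfl hF (by omega) (h2u.trans h1), ?_, h4, ?_,
      growth_le_tol_mul_scale (F := fun n => (n : ℝ) + β) hF (by omega) (by omega) ?_⟩
    · refine h4.trans ?_
      rw [div_le_div_iff₀ (by positivity) (by norm_num)]
      nlinarith
    · refine le_trans ?_ (le_tol_of_lt_two_pow (a := a + 1) (by omega) (by rw [pow_succ]; omega))
      apply one_div_le_one_div_of_le (by positivity)
      have : ((a + 1 : ℕ) : ℝ) ≤ 2 * u := by exact_mod_cast (by omega : a + 1 ≤ 2 * u)
      calc (2 : ℝ) ^ (a + 1) * ((a + 1 : ℕ) : ℝ) ≤ 2 ^ (a + 1) * (2 * u) := by gcongr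
        _ = _ := by rw [hN]; ring
    · calc n < 2 ^ (a + 1) := by rw [pow_succ]; omega
        _ ≤ 2 ^ (2 * u) := Nat.pow_le_pow_right (by norm_num) (by omega)
  have hIN : (scale 1 L : ℝ) ^ 2 * 144 ^ 2 ≤ N := by
    have h1 : scale 1 L ^ 2 * 144 ^ 2 ≤ 2 ^ a := by
      calc scale 1 L ^ 2 * 144 ^ 2 ≤ scale 1 L ^ 2 * 2 ^ 16 := Nat.mul_le_mul_left _ (by norm_num)
        _ = 2 ^ ((1 + 2) * 4 ^ L * 2 + 16) := by rw [scale, ← pow_mul, ← pow_add]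
        _ ≤ 2 ^ a := Nat.pow_le_pow_right (by norm_num) (by omega)
    rw [hN]; exact_mod_cast h1
  have hIsqrt : 144 * (scale 1 L : ℝ) ≤ √((2 ^ a : ℕ) : ℝ) := by
    apply Real.le_sqrt_of_sq_le
    push_cast
    rw [← hN]
    linarith
  obtain ⟨P, hP, hsep, hcard⟩ := exists_separated_points (β := β) (L := L) hM1 hNM
    (fun n h1 h2 => by
      obtain ⟨g1, g2, g3, g4, -⟩ := hfacts n h1 h2
      push_cast
      exact ⟨g1, g2, g3, g4⟩) hIsqrt y
  push_cast at hsep hcard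
  refine ⟨P, fun x => x.2 / (x.1 + β), fun x => nearInts (scale 1 (L + 3)) (x.1 + β) (tol x.1) x.2,
    fun x hx w hw => ?_, fun x hx w hw => ?_, fun x hx => ?_, hsep, hcard, ?_⟩
  · obtain ⟨h1, h2, h3⟩ := hP x hx
    obtain ⟨g1, g2, g3, g4, g5, g6, g7⟩ := hfacts _ h1 h2
    have hpos : 0 < (x.1 : ℝ) + β := by linarith
    refine mem_hitCells.2 ⟨⟨y, Finset.mem_singleton_self y,
      nearInts_subset_descendants (by omega) hpos h3 hw⟩, x.1, ?_,
      dist1_le_of_mem_nearInts hI' hpos hw⟩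
    rw [Finset.mem_Ioc, cutoff, cutoff]
    constructor
    · refine lt_of_lt_of_le (Nat.pow_lt_pow_right (by norm_num) (by omega)) h1
    · calc x.1 ≤ 2 ^ (a + 1) := by rw [pow_succ]; omega
        _ ≤ 2 ^ 4 ^ (L + 3) := Nat.pow_le_pow_right (by norm_num) (by
          have : 4 ^ (L + 3) = 4 * 4 ^ (L + 2) := by ring
          omega)
  · obtain ⟨h1, h2, h3⟩ := hP x hx
    obtain ⟨g1, g2, g3, g4, g5, g6, g7⟩ := hfacts _ h1 h2
    have hpos : 0 < (x.1 : ℝ) + β := by linarith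
    rw [mem_nearInts hI' hpos] at hw
    have e1 : (w : ℝ) / scale 1 (L + 3) - x.2 / (x.1 + β)
        = (w / scale 1 (L + 3) * (x.1 + β) - x.2) / (x.1 + β) := by field_simp
    rw [e1, abs_div, abs_of_pos hpos]
    calc _ ≤ 2 / (N * u) / (N / 2) := by gcongr; exact hw.trans g5
      _ = _ := by field_simp; norm_num
  · obtain ⟨h1, h2, h3⟩ := hP x hx
    obtain ⟨g1, g2, g3, g4, g5, g6, g7⟩ := hfacts _ h1 h2
    have hpos : 0 < (x.1 : ℝ) + β := by linarith
    have ht : 0 ≤ tol x.1 := (tol_pos (by omega)).le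
    constructor
    · refine le_trans ?_ (le_card_nearInts g7 hpos x.2)
      calc (scale 1 (L + 3) : ℝ) / (16 * N ^ 2 * u)
          = 1 / (4 * N * u) * scale 1 (L + 3) / (4 * N) := by field_simp; norm_num
        _ ≤ _ := by gcongr
    · refine (card_nearInts_le g7 hpos x.2).trans ?_
      calc 3 * (tol x.1 * scale 1 (L + 3) / (x.1 + β))
          ≤ 3 * (2 / (N * u) * scale 1 (L + 3) / (N / 2)) := by gcongr
        _ = _ := by field_simp; norm_num
  · have h := card_le_of_separated P (fun x => x.2 / (x.1 + β))
      (x := (y : ℝ) / scale 1 L + 1 / (2 * scale 1 L)) (r := 1 / (2 * scale 1 L))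
      (by positivity) (by positivity) hsep fun x hx => by
        obtain ⟨h1, h2, h3⟩ := hP x hx
        obtain ⟨g1, g2, g3, g4, g5, g6, g7⟩ := hfacts _ h1 h2
        have hpos : 0 < (x.1 : ℝ) + β := by linarith
        obtain ⟨b1, b2⟩ := mem_innerInts_bounds hpos (tol_pos (by omega)).le h3
        have e1 : ((y : ℝ) + 1) / scale 1 L = y / scale 1 L + 1 / scale 1 L := by ring
        have e2 : 1 / (2 * (scale 1 L : ℝ)) = 1 / scale 1 L / 2 := by field_simp
        rw [e1] at b2
        rw [e2, abs_le]
        constructor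
        · linarith
        · linarith
    refine h.trans ?_
    have hI1 : (1 : ℝ) ≤ scale 1 L := by exact_mod_cast scale_pos 1 L
    have h7 : (scale 1 L : ℝ) ≤ N := by nlinarith
    have h5 : (scale 1 L : ℝ) ≤ N ^ 2 := by nlinarith
    have h6 : 1 ≤ N ^ 2 / scale 1 L := by rwa [le_div_iff₀ hI, one_mul]
    have e : 2 * (1 / (2 * (scale 1 L : ℝ))) / (1 / (64 * N ^ 2)) = 64 * (N ^ 2 / scale 1 L) := by
      field_simp
    rw [e, mul_div_assoc]
    linarith

end

section

variable {β : ℝ} {n₀ L : ℕ}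

lemma sum_half_pow_le (a n : ℕ) : ∑ b ∈ Finset.Ico a n, (1 / 2 : ℝ) ^ (b - a) ≤ 2 := by
  rw [Finset.sum_Ico_eq_sum_range]
  simp only [Nat.add_sub_cancel_left]
  exact sum_geometric_two_le _

lemma sum_pairs_le {u : ℕ} (hu : 0 < u) {c C : ℝ} (hc : 0 ≤ c) (hC : 0 ≤ C) :
    ∑ x ∈ (Finset.Ico u (2 * u) ×ˢ Finset.Ico u (2 * u)).filter (fun x => x.1 < x.2),
      (c / u ^ 2 + C * (1 / 2 : ℝ) ^ (x.2 - x.1) / u) ≤ c + 2 * C := by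
  have hu0 : (0 : ℝ) < u := by exact_mod_cast hu
  rw [Finset.sum_filter, Finset.sum_product]
  calc _ ≤ ∑ a ∈ Finset.Ico u (2 * u), (c / u + 2 * C / u) := by
        refine Finset.sum_le_sum fun a ha => ?_
        rw [Finset.mem_Ico] at ha
        rw [← Finset.sum_filter]
        calc _ ≤ ∑ b ∈ Finset.Ico a (2 * u), (c / u ^ 2 + C * (1 / 2 : ℝ) ^ (b - a) / u) := by
              refine Finset.sum_le_sum_of_subset_of_nonneg (fun b hb => ?_)
                fun _ _ _ => by positivity
              rw [Finset.mem_filter, Finset.mem_Ico] at hb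
              rw [Finset.mem_Ico]
              omega
          _ = (2 * u - a : ℕ) * (c / u ^ 2)
              + C / u * ∑ b ∈ Finset.Ico a (2 * u), (1 / 2 : ℝ) ^ (b - a) := by
              rw [Finset.sum_add_distrib, Finset.sum_const, Nat.card_Ico, nsmul_eq_mul,
                Finset.mul_sum]
              congr 1
              exact Finset.sum_congr rfl fun b _ => by ring
          _ ≤ u * (c / u ^ 2) + C / u * 2 := by
              gcongr
              · omega
              · exact sum_half_pow_le _ _
          _ = _ := by field_simp
    _ = _ := by
        rw [Finset.sum_const, Nat.card_Ico, nsmul_eq_mul, show 2 * u - u = u by omega]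
        field_simp

lemma le_card_hitCells_singleton (hF : Growth (fun n => (n : ℝ) + β) 1 n₀) (hL : 3 ≤ L)
    (hn₀ : n₀ ≤ 2 ^ (4 ^ (L + 2))) (y : ℤ) :
    (1 / 4096 : ℝ) ^ 2 / (1 / 4096 + 2 * 800280) * desc 1 L (L + 3)
      ≤ (hitCells (fun n => (n : ℝ) + β) 1 L {y}).card := by
  have h := fun a ha ha2 => exists_block_hits (a := a) hF hL hn₀ ha ha2 y
  choose! P γ S hS hnear hcardS hsep hPlow hPup using h
  have hu16 : 4 ^ (L + 2) = 16 * 4 ^ L := four_pow_add_two L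
  have h4L : 4 ^ 3 ≤ 4 ^ L := Nat.pow_le_pow_right (by norm_num) hL
  have hucast : (4 : ℝ) ^ (L + 2) = (4 ^ (L + 2) : ℕ) := by push_cast; rfl
  rw [hucast] at hnear hcardS
  set u := 4 ^ (L + 2) with hu
  have hu512 : (512 : ℝ) < u := by exact_mod_cast (by omega : 512 < u)
  have hu0 : (0 : ℝ) < u := by linarith
  have hI := scale_pos' 1 L
  have hI' := scale_pos' 1 (L + 3)
  have hW := desc_cast 1 (show L ≤ L + 3 by omega)
  refine le_card_of_sum_inter_le (Finset.Ico u (2 * u)) (fun a => (P a).biUnion (S a)) _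
    (fun a ha => ?_) (by norm_num) (by norm_num) (by positivity) ?_ ?_
  · rw [Finset.mem_Ico] at ha
    exact Finset.biUnion_subset.2 fun x hx => hS a ha.1 ha.2 x hx
  · calc 1 / 4096 * (desc 1 L (L + 3) : ℝ)
        = ∑ a ∈ Finset.Ico u (2 * u), (desc 1 L (L + 3) : ℝ) / (4096 * u) := by
          rw [Finset.sum_const, Nat.card_Ico, nsmul_eq_mul, show 2 * u - u = u by omega]
          field_simp
      _ ≤ _ := Finset.sum_le_sum fun a ha => ?_
    rw [Finset.mem_Ico] at ha
    rw [Finset.card_biUnion]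
    · push_cast
      calc (desc 1 L (L + 3) : ℝ) / (4096 * u)
          = (2 ^ a) ^ 2 / (256 * scale 1 L)
            * (scale 1 (L + 3) / (16 * (2 ^ a) ^ 2 * u)) := by
            rw [hW]; field_simp; norm_num
        _ ≤ (P a).card * (scale 1 (L + 3) / (16 * (2 ^ a) ^ 2 * u)) := by
            gcongr; exact hPlow a ha.1 ha.2
        _ = ∑ x ∈ P a, scale 1 (L + 3) / (16 * (2 ^ a) ^ 2 * (u : ℝ)) := by
            rw [Finset.sum_const, nsmul_eq_mul]
        _ ≤ _ := Finset.sum_le_sum fun x hx => (hcardS a ha.1 ha.2 x hx).1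
    · intro x hx x' hx' hne
      refine Finset.disjoint_left.2 fun w hw hw' => ?_
      have g1 := hnear a ha.1 ha.2 x hx w hw
      have g2 := hnear a ha.1 ha.2 x' hx' w hw'
      have g3 := hsep a ha.1 ha.2 x hx x' hx' hne
      have g4 := abs_sub_le (γ a x) (w / scale 1 (L + 3)) (γ a x')
      rw [abs_sub_comm (γ a x) (w / scale 1 (L + 3))] at g4
      have g5 : 4 / ((2 ^ a) ^ 2 * (u : ℝ)) + 4 / ((2 ^ a) ^ 2 * u) < 1 / (64 * (2 ^ a) ^ 2) := by
        rw [← add_div, div_lt_div_iff₀ (by positivity) (by positivity)]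
        have : (0 : ℝ) < (2 ^ a) ^ 2 := by positivity
        nlinarith
      linarith
  · have hu1 : 0 < u := by omega
    calc _ ≤ ∑ x ∈ (Finset.Ico u (2 * u) ×ˢ Finset.Ico u (2 * u)).filter (fun x => x.1 < x.2),
          (780 * 1024 * (desc 1 L (L + 3) : ℝ) / u ^ 2
            + 780 * desc 1 L (L + 3) * (1 / 2 : ℝ) ^ (x.2 - x.1) / u) :=
          Finset.sum_le_sum fun ⟨a, b⟩ hx => ?_
      _ ≤ _ := (sum_pairs_le hu1 (by positivity) (by positivity)).trans (le_of_eq (by ring))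
    rw [Finset.mem_filter, Finset.mem_product, Finset.mem_Ico, Finset.mem_Ico] at hx
    obtain ⟨⟨⟨ha, ha2⟩, hb, hb2⟩, hab⟩ := hx
    dsimp only at ha ha2 hb hb2 hab ⊢
    refine (card_inter_biUnion_le (P a) (P b) (S a) (S b)
      (A := 65 * (2 ^ a) ^ 2 / scale 1 L)
      (B := 12 * scale 1 (L + 3) / ((2 ^ b) ^ 2 * u))
      (K := 1024 * (2 ^ b) ^ 2 / ((2 ^ a) ^ 2 * u) + 1) (by positivity) (by positivity)
      (hPup a ha ha2) (fun x hx => (hcardS b hb hb2 x hx).2) fun x hx => ?_).trans ?_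
    · refine (card_le_of_separated _ (γ b) (s := 1 / (64 * (2 ^ b) ^ 2)) (x := γ a x)
        (r := 8 / ((2 ^ a) ^ 2 * u)) (by positivity) (by positivity)
        (fun i hi j hj => hsep b hb hb2 i (Finset.mem_filter.1 hi).1 j (Finset.mem_filter.1 hj).1)
        fun i hi => ?_).trans (le_of_eq ?_)
      · obtain ⟨hi, hdis⟩ := Finset.mem_filter.1 hi
        obtain ⟨w, hw, hw'⟩ := Finset.not_disjoint_iff.1 hdis
        have g1 := hnear a ha ha2 x hx w hw
        have g2 := hnear b hb hb2 i hi w hw'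
        have g4 := abs_sub_le (γ b i) (w / scale 1 (L + 3)) (γ a x)
        rw [abs_sub_comm (γ b i) (w / scale 1 (L + 3))] at g4
        have g5 : 4 / ((2 ^ b) ^ 2 * (u : ℝ)) ≤ 4 / ((2 ^ a) ^ 2 * u) := by
          gcongr
          norm_num
        have g6 : 8 / ((2 ^ a) ^ 2 * (u : ℝ)) = 4 / ((2 ^ a) ^ 2 * u) + 4 / ((2 ^ a) ^ 2 * u) := by
          ring
        linarith
      · field_simp; ring
    · obtain ⟨t, rfl⟩ := Nat.exists_eq_add_of_le hab.le
      rw [Nat.add_sub_cancel_left, hW, pow_add]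
      have ht : (1 : ℝ) / (2 ^ t) ^ 2 ≤ (1 / 2) ^ t := by
        rw [div_pow, one_pow]
        apply one_div_le_one_div_of_le (by positivity)
        exact le_self_pow₀ (one_le_pow₀ (by norm_num)) (by norm_num)
      calc _ = 780 * 1024 * ((scale 1 (L + 3) : ℝ) / scale 1 L) / u ^ 2
            + 780 * (scale 1 (L + 3) / scale 1 L) * (1 / (2 ^ t) ^ 2) / u := by
            field_simp; ring
        _ ≤ _ := by gcongr

lemma hitProp_one (hF : Growth (fun n => (n : ℝ) + β) 1 n₀) :
    HitProp (fun n => (n : ℝ) + β) 1 := by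
  refine ⟨(1 / 4096 : ℝ) ^ 2 / (1 / 4096 + 2 * 800280), by norm_num, fun k =>
    ⟨3 + n₀, fun L hL z T _ => ?_⟩⟩
  have hn₀ : n₀ ≤ 2 ^ (4 ^ (L + 2)) := by
    have h1 : 4 ^ (L + 2) < 2 ^ (4 ^ (L + 2)) := Nat.lt_pow_self (by norm_num)
    have h2 : L + 2 < 4 ^ (L + 2) := Nat.lt_pow_self (by norm_num)
    omega
  have hsub : ((T L).biUnion fun y => hitCells (fun n => (n : ℝ) + β) 1 L {y})
      ⊆ hitCells (fun n => (n : ℝ) + β) 1 L (T L) := by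
    refine Finset.biUnion_subset.2 fun y hy w hw => ?_
    obtain ⟨⟨y', hy', h1⟩, h2⟩ := mem_hitCells.1 hw
    rw [Finset.mem_singleton] at hy'
    exact mem_hitCells.2 ⟨⟨y, hy, hy' ▸ h1⟩, h2⟩
  refine le_trans ?_ (Nat.cast_le.2 (Finset.card_le_card hsub))
  rw [Finset.card_biUnion]
  · push_cast
    calc _ = ∑ y ∈ T L,
          (1 / 4096 : ℝ) ^ 2 / (1 / 4096 + 2 * 800280) * (desc 1 L (L + 3) : ℝ) := by
          rw [Finset.sum_const, nsmul_eq_mul]; ring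
      _ ≤ _ := Finset.sum_le_sum fun y _ => le_card_hitCells_singleton hF (by omega) hn₀ y
  · intro y _ y' _ hne
    refine Finset.disjoint_left.2 fun w hw hw' => hne ?_
    obtain ⟨⟨x, hx, h1⟩, -⟩ := mem_hitCells.1 hw
    obtain ⟨⟨x', hx', h2⟩, -⟩ := mem_hitCells.1 hw'
    rw [Finset.mem_singleton] at hx hx'
    subst hx hx'
    exact ((mem_descendants (by omega)).1 h1).symm.trans ((mem_descendants (by omega)).1 h2)

end

lemma hitProp_of_monic (f : Polynomial ℝ) {d : ℕ} (hd : 1 ≤ d) (hf : f.Monic)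
    (hdeg : f.natDegree = d) : HitProp (fun n => f.eval (n : ℝ)) d := by
  obtain ⟨n₀, hF⟩ := growth_of_monic f hd hf hdeg
  rcases hd.eq_or_lt with rfl | hd2
  · have e : (fun n : ℕ => f.eval (n : ℝ)) = fun n : ℕ => (n : ℝ) + f.coeff 0 := by
      funext n
      conv_lhs => rw [hf.eq_X_add_C hdeg]
      simp
    rw [e] at hF ⊢
    exact hitProp_one hF
  · obtain ⟨C, hC, N₀, hSI⟩ := exists_sum_inv_le f hd2 hf hdeg
    exact hitProp_of_sumInvBound hd2 hF hSI hC

lemma liminf_pos_of_mem_badSet {F : ℕ → ℝ} {α : ℝ} (hα : α ∈ badSet F) :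
    0 < liminf (fun n : ℕ => (n : ℝ) * Real.log n * |α * F n - round (α * F n)|) atTop := by
  obtain ⟨c, hc, h1, h2⟩ := hα
  have hmul : ∀ᶠ n : ℕ in atTop, (0 : ℝ) < n * Real.log n := by
    filter_upwards [eventually_ge_atTop 2] with n hn
    have : (2 : ℝ) ≤ n := by exact_mod_cast hn
    exact mul_pos (by linarith) (Real.log_pos (by linarith))
  refine hc.trans_le (le_liminf_of_le ?_ ?_)
  · refine IsCoboundedUnder.of_frequently_le (a := 2) ((h2.and_eventually hmul).mono ?_)
    rintro n ⟨h, hn⟩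
    rw [tol, dist1, mul_one_div, le_div_iff₀ hn] at h
    linarith
  · filter_upwards [h1, hmul] with n h hn
    rw [tol, dist1, mul_one_div, div_le_iff₀ hn] at h
    linarith

end SmallFrac

/-- **Corollary.** For a real polynomial `f` of degree `d ≥ 1` with positive leading
coefficient, the set `{α : liminf n · log n · ‖α f(n)‖ > 0}` has Hausdorff dimension at
least `d/(d+1)`; in particular it has positive Hausdorff dimension. -/
theorem small_fractional_parts_of_polynomial
    (f : Polynomial ℝ) (d : ℕ) (hd : 1 ≤ d) (hdeg : f.natDegree = d)
    (hlead : 0 < f.leadingCoeff) :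
    ENNReal.ofReal ((d : ℝ) / (d + 1)) ≤
        dimH {α : ℝ | 0 < liminf (fun n : ℕ =>
          (n : ℝ) * Real.log n * |α * f.eval (n : ℝ) - round (α * f.eval (n : ℝ))|) atTop} ∧
    0 < dimH {α : ℝ | 0 < liminf (fun n : ℕ =>
          (n : ℝ) * Real.log n * |α * f.eval (n : ℝ) - round (α * f.eval (n : ℝ))|) atTop} := by
  set E : Set ℝ := {α : ℝ | 0 < liminf (fun n : ℕ =>
    (n : ℝ) * Real.log n * |α * f.eval (n : ℝ) - round (α * f.eval (n : ℝ))|) atTop} with hE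
  have hf0 : f ≠ 0 := Polynomial.leadingCoeff_ne_zero.1 hlead.ne'
  set g := f * Polynomial.C f.leadingCoeff⁻¹ with hg
  have hmon : g.Monic := Polynomial.monic_mul_leadingCoeff_inv hf0
  have hgdeg : g.natDegree = d := by
    rw [hg, Polynomial.natDegree_mul_leadingCoeff_inv _ hf0, hdeg]
  obtain ⟨n₀, hgrowth⟩ := SmallFrac.growth_of_monic g hd hmon hgdeg
  have hmeas := SmallFrac.hausdorffMeasure_badSet_ne_zero hd hgrowth
    (SmallFrac.hitProp_of_monic g hd hmon hgdeg)
  have hsub : SmallFrac.badSet (fun n => g.eval (n : ℝ)) ⊆ (fun α => f.leadingCoeff * α) '' E := by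
    intro α hα
    refine ⟨f.leadingCoeff⁻¹ * α, ?_, mul_inv_cancel_left₀ hlead.ne' α⟩
    have h := SmallFrac.liminf_pos_of_mem_badSet hα
    have e : ∀ n : ℕ, α * g.eval (n : ℝ) = f.leadingCoeff⁻¹ * α * f.eval (n : ℝ) := by
      intro n
      rw [hg, Polynomial.eval_mul, Polynomial.eval_C]
      ring
    simp only [e] at h
    exact h
  have hdim : ENNReal.ofReal ((d : ℝ) / (d + 1)) ≤ dimH E := by
    have hcoe : ((Real.toNNReal ((d : ℝ) / (d + 1)) : NNReal) : ℝ) = (d : ℝ) / (d + 1) :=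
      Real.coe_toNNReal _ (by positivity)
    have h1 := le_dimH_of_hausdorffMeasure_ne_zero
      (d := Real.toNNReal ((d : ℝ) / (d + 1))) (by rw [hcoe]; exact hmeas)
    exact h1.trans ((dimH_mono hsub).trans ((lipschitzWith_smul f.leadingCoeff).dimH_image_le E))
  have hd0 : (0 : ℝ) < d := by exact_mod_cast hd
  exact ⟨hdim, (ENNReal.ofReal_pos.2 (by positivity)).trans_le hdim⟩
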